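/- Under the standing assumptions, suppose the exponent p from hypothesis (f3) satisfies 2 + 4/N < p < 2*. Then ∫_Ω u_λ² dx → 0 as λ → +∞. -/

import Mathlib

open MeasureTheory Set Filter Topology

noncomputable section

/-- `N`-dimensional Euclidean space. -/
abbrev Euc (N : ℕ) := EuclideanSpace ℝ (Fin N)

/-- The Laplacian of a real-valued function on Euclidean space, defined as the
sum of the pure second partial derivatives in the coordinate directions. -/
def lap {N : ℕ} (u : Euc N → ℝ) (x : Euc N) : ℝ :=
  ∑ i : Fin N,
    fderiv ℝ (fun y => fderiv ℝ u y (EuclideanSpace.single i 1)) x (EuclideanSpace.single i 1)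

/-- The first Dirichlet eigenvalue of `-Δ` on `Ω`, defined as the infimum of
Rayleigh quotients of nonzero smooth functions with compact support contained in `Ω`. -/
def firstEig {N : ℕ} (Ω : Set (Euc N)) : ℝ :=
  sInf { r : ℝ | ∃ φ : Euc N → ℝ, ContDiff ℝ (⊤ : ℕ∞) φ ∧ HasCompactSupport φ ∧
    tsupport φ ⊆ Ω ∧ φ ≠ 0 ∧
    r = (∫ x, ‖fderiv ℝ φ x‖ ^ 2) / (∫ x, (φ x) ^ 2) }

/-- `u` is a (classical) positive solution of `-Δ u + lam • u = f(x, u)` in `Ω`,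
vanishing on the boundary: `u ∈ C²(Ω) ∩ C(closure Ω)`, `u > 0` in `Ω`, `u = 0` on `∂Ω`. -/
def IsPosSolution {N : ℕ} (Ω : Set (Euc N)) (f : Euc N → ℝ → ℝ) (lam : ℝ)
    (u : Euc N → ℝ) : Prop :=
  ContDiffOn ℝ 2 u Ω ∧ ContinuousOn u (closure Ω) ∧ (∀ x ∈ Ω, 0 < u x) ∧
    (∀ x ∈ frontier Ω, u x = 0) ∧ ∀ x ∈ Ω, - lap u x + lam * u x = f x (u x)

/-- The standing assumptions of the paper: `Ω ⊆ ℝ^N` is a bounded domain with `C¹`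
boundary, convex in every coordinate direction and invariant under a blockwise
orthogonal group `G = O(m₁) × ⋯ × O(m_ℓ)` with every `m_i ≥ 2`; the nonlinearity
`f` satisfies (f1), (f2), (f3) with splitting `f(x,t) = d(x)|t|^{p-2} t + g(x,t)`;
and for every `λ > -λ₁(Ω)` the problem has exactly one positive solution `u λ`. -/
structure Standing (N : ℕ) (Ω : Set (Euc N)) (f : Euc N → ℝ → ℝ)
    (d : Euc N → ℝ) (g : Euc N → ℝ → ℝ) (p : ℝ) (u : ℝ → Euc N → ℝ) : Prop where
  dim : 2 ≤ N
  isOpen : IsOpen Ω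
  conn : IsConnected Ω
  bdd : Bornology.IsBounded Ω
  c1bdry : ∀ x ∈ frontier Ω, ∃ U : Set (Euc N), IsOpen U ∧ x ∈ U ∧
      ∃ F : Euc N → ℝ, ContDiff ℝ 1 F ∧ (∀ y ∈ U, fderiv ℝ F y ≠ 0) ∧
        Ω ∩ U = {y ∈ U | F y < 0}
  conv : ∀ i : Fin N, ∀ x ∈ Ω, ∀ y ∈ Ω, (∀ j, j ≠ i → x j = y j) → segment ℝ x y ⊆ Ω
  symm : ∃ ℓ : ℕ, 1 ≤ ℓ ∧ ∃ β : Fin N → Fin ℓ, Monotone β ∧ Function.Surjective β ∧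
      (∀ j, 2 ≤ (Finset.univ.filter (fun i => β i = j)).card) ∧
      ∀ e : Euc N ≃ₗᵢ[ℝ] Euc N,
        (∀ j : Fin ℓ, ∀ x : Euc N, (∀ i, β i ≠ j → x i = 0) → ∀ i, β i ≠ j → e x i = 0) →
          e '' Ω = Ω ∧ (∀ x t, f (e x) t = f x t) ∧ ∀ x, d (e x) = d x
  f_c1 : ContDiffOn ℝ 1 (Function.uncurry f) (Ω ×ˢ (univ : Set ℝ))
  f_zero : ∀ x ∈ Ω, f x 0 = 0 ∧ deriv (f x) 0 = 0
  f_ar : ∃ a b : ℝ, 2 < a ∧ a ≤ b ∧ (3 ≤ N → b < 2 * N / ((N : ℝ) - 2)) ∧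
      ∀ᵐ x ∂(volume : Measure (Euc N)).restrict Ω, ∀ t : ℝ, t ≠ 0 →
        0 < (a - 1) * f x t * t ∧ (a - 1) * f x t * t ≤ deriv (f x) t * t ^ 2 ∧
          deriv (f x) t * t ^ 2 ≤ (b - 1) * f x t * t
  f_bdd : ∃ M : ℝ, 0 < M ∧ ∀ x ∈ Ω, |f x 1| < M ∧ |f x (-1)| < M
  hp : 2 < p ∧ (3 ≤ N → p < 2 * N / ((N : ℝ) - 2))
  f_split : ∀ x t, f x t = d x * |t| ^ (p - 2) * t + g x t
  d_c1 : ContDiffOn ℝ 1 d (closure Ω)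
  d_bdd : ∃ C : ℝ, ∀ x ∈ Ω, |d x| ≤ C
  d_nonneg : ∀ x ∈ closure Ω, 0 ≤ d x
  d_zero : d 0 = 1
  g_top : ∀ x ∈ Ω, Tendsto (fun t : ℝ => g x t / t ^ (p - 1)) atTop (𝓝 0)
  g_zero : ∀ x ∈ Ω, Tendsto (fun t : ℝ => g x t / t) (𝓝[≠] (0 : ℝ)) (𝓝 0)
  mono : ∀ i : Fin N, ∀ x ∈ Ω, ∀ y ∈ Ω, (∀ j, j ≠ i → x j = y j) → |x i| ≤ |y i| →
      (∀ t, f y t ≤ f x t) ∧ d y ≤ d x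
  sol : ∀ lam : ℝ, - firstEig Ω < lam →
      IsPosSolution Ω f lam (u lam) ∧
        ∀ v, IsPosSolution Ω f lam v → EqOn v (u lam) (closure Ω)

open scoped ContDiff

/-- Smooth compactly supported functions. -/
def Tst {N : ℕ} (φ : Euc N → ℝ) : Prop := ContDiff ℝ ∞ φ ∧ HasCompactSupport φ

/-- The `i`-th partial derivative. -/
def pd {N : ℕ} (i : Fin N) (φ : Euc N → ℝ) (x : Euc N) : ℝ :=
  fderiv ℝ φ x (EuclideanSpace.single i 1)

lemma lap_eq_sum_pd {N : ℕ} (φ : Euc N → ℝ) (x : Euc N) : lap φ x = ∑ i, pd i (pd i φ) x := rfl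

lemma Tst.pderiv {N : ℕ} {φ : Euc N → ℝ} (h : Tst φ) (i : Fin N) : Tst (pd i φ) := by
  refine ⟨?_, ?_⟩
  · exact (h.1.fderiv_right (m := ∞) (by simp)).clm_apply contDiff_const
  · exact h.2.fderiv_apply (𝕜 := ℝ) _

lemma Tst.continuous {N : ℕ} {φ : Euc N → ℝ} (h : Tst φ) : Continuous φ := h.1.continuous

lemma Tst.differentiable {N : ℕ} {φ : Euc N → ℝ} (h : Tst φ) : Differentiable ℝ φ :=
  h.1.differentiable (by simp)

lemma Tst.integrable {N : ℕ} {φ : Euc N → ℝ} (h : Tst φ) : Integrable φ :=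
  h.continuous.integrable_of_hasCompactSupport h.2

lemma Tst.laplace {N : ℕ} {φ : Euc N → ℝ} (h : Tst φ) : Tst (lap φ) := by
  have : lap φ = fun x => ∑ i, pd i (pd i φ) x := rfl
  refine ⟨?_, ?_⟩
  · rw [this]
    exact ContDiff.sum fun i _ => ((h.pderiv i).pderiv i).1
  · refine HasCompactSupport.of_support_subset_isCompact h.2 ?_
    intro x hx
    by_contra hx'
    apply hx
    rw [lap_eq_sum_pd]
    refine Finset.sum_eq_zero fun i _ => ?_
    have hz : ∀ᶠ y in 𝓝 x, pd i φ y = 0 := by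
      have : ∀ᶠ y in 𝓝 x, y ∉ tsupport φ := (isClosed_tsupport φ).isOpen_compl.mem_nhds hx'
      filter_upwards [this] with y hy
      have : fderiv ℝ φ y = 0 := by
        by_contra h0
        exact hy (support_fderiv_subset ℝ h0)
      simp [pd, this]
    have : fderiv ℝ (pd i φ) x = 0 := by
      rw [Filter.EventuallyEq.fderiv_eq (f := fun _ => (0:ℝ)) hz]; simp
    simp [pd] at this ⊢
    rw [this]; simp

lemma Tst.add {N : ℕ} {φ ψ : Euc N → ℝ} (h : Tst φ) (h' : Tst ψ) : Tst (fun x => φ x + ψ x) :=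
  ⟨h.1.add h'.1, h.2.add h'.2⟩

lemma Tst.const_mul {N : ℕ} {φ : Euc N → ℝ} (h : Tst φ) (c : ℝ) : Tst (fun x => c * φ x) :=
  ⟨contDiff_const.mul h.1, h.2.mul_left (f := fun _ => c)⟩

lemma Tst.mul {N : ℕ} {φ ψ : Euc N → ℝ} (h : Tst φ) (h' : ContDiff ℝ ∞ ψ) :
    Tst (fun x => φ x * ψ x) :=
  ⟨h.1.mul h', h.2.mul_right⟩

lemma Tst.bdd {N : ℕ} {φ : Euc N → ℝ} (h : Tst φ) : ∃ C, 0 ≤ C ∧ ∀ x, |φ x| ≤ C := by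
  obtain ⟨C, hC⟩ := h.continuous.bounded_above_of_compact_support h.2
  exact ⟨C, (norm_nonneg _).trans (hC 0), hC⟩

lemma Tst.reflect {N : ℕ} {φ : Euc N → ℝ} (h : Tst φ) (x : Euc N) : Tst (fun y => φ (x - y)) :=
  ⟨h.1.comp (contDiff_const.sub contDiff_id),
    h.2.comp_homeomorph (Homeomorph.subLeft x)⟩

/-- integration by parts for partial derivatives. -/
lemma integral_mul_pd {N : ℕ} {φ ψ : Euc N → ℝ} (hφ : ContDiff ℝ 1 φ) (hψ : ContDiff ℝ 1 ψ)
    (hs : HasCompactSupport φ ∨ HasCompactSupport ψ) (i : Fin N) :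
    ∫ x, φ x * pd i ψ x = - ∫ x, pd i φ x * ψ x := by
  have c1 : Continuous (fun x => φ x * pd i ψ x) := by
    have := hφ.continuous
    have := hψ.continuous_fderiv (by simp)
    unfold pd; fun_prop
  have c2 : Continuous (fun x => pd i φ x * ψ x) := by
    have := hψ.continuous
    have := hφ.continuous_fderiv (by simp)
    unfold pd; fun_prop
  have c3 : Continuous (fun x => φ x * ψ x) := by
    have := hψ.continuous
    have := hφ.continuous
    fun_prop
  refine integral_mul_fderiv_eq_neg_fderiv_mul_of_integrable ?_ ?_ ?_ ?_ ?_
  · refine c2.integrable_of_hasCompactSupport ?_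
    rcases hs with hs | hs
    · exact HasCompactSupport.mul_right (hs.fderiv_apply (𝕜 := ℝ) _)
    · exact hs.mul_left
  · refine c1.integrable_of_hasCompactSupport ?_
    rcases hs with hs | hs
    · exact hs.mul_right
    · exact HasCompactSupport.mul_left (hs.fderiv_apply (𝕜 := ℝ) _)
  · refine c3.integrable_of_hasCompactSupport ?_
    rcases hs with hs | hs
    · exact hs.mul_right
    · exact hs.mul_left
  · intro x _; exact hφ.differentiable (by simp) x
  · intro x _; exact hψ.differentiable (by simp) x

/-- Radial profile `exp (-1/(1-s))`, cut off at `s = 1`. -/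
def T0 (s : ℝ) : ℝ := expNegInvGlue (1 - s)

/-- Minus the derivative of `T0`. -/
def T1 (s : ℝ) : ℝ := ((1 - s)⁻¹) ^ 2 * expNegInvGlue (1 - s)

lemma T1_eq (s : ℝ) : T1 s =
    (Polynomial.X ^ 2 : Polynomial ℝ).eval ((1 - s)⁻¹) * expNegInvGlue (1 - s) := by
  simp [T1]

lemma contDiff_T0 : ContDiff ℝ ∞ T0 :=
  expNegInvGlue.contDiff.comp (contDiff_const.sub contDiff_id)

lemma contDiff_T1 : ContDiff ℝ ∞ T1 := by
  have : T1 = (fun x : ℝ => (Polynomial.X ^ 2 : Polynomial ℝ).eval (x⁻¹) * expNegInvGlue x) ∘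
    (fun s => 1 - s) := by
    ext s; exact T1_eq s
  rw [this]
  exact (expNegInvGlue.contDiff_polynomial_eval_inv_mul _).comp (contDiff_const.sub contDiff_id)

lemma hasDerivAt_T0 (s : ℝ) : HasDerivAt T0 (- T1 s) s := by
  have h := expNegInvGlue.hasDerivAt_polynomial_eval_inv_mul 1 (1 - s)
  have h := h.comp s ((hasDerivAt_id s).const_sub 1)
  refine (h.congr_deriv ?_).congr_of_eventuallyEq ?_
  · simp [T1]
  · exact Eventually.of_forall fun x => by simp [T0]

lemma T0_nonneg (s : ℝ) : 0 ≤ T0 s := expNegInvGlue.nonneg _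
lemma T1_nonneg (s : ℝ) : 0 ≤ T1 s := mul_nonneg (sq_nonneg _) (expNegInvGlue.nonneg _)
lemma T0_zero {s : ℝ} (h : 1 ≤ s) : T0 s = 0 := expNegInvGlue.zero_of_nonpos (by linarith)
lemma T1_zero {s : ℝ} (h : 1 ≤ s) : T1 s = 0 := by
  rw [T1, expNegInvGlue.zero_of_nonpos (by linarith), mul_zero]
lemma T1_pos {s : ℝ} (h : s < 1) : 0 < T1 s := by
  have := expNegInvGlue.pos_of_pos (show 0 < 1 - s by linarith)
  have : 0 < (1 - s)⁻¹ := inv_pos.2 (by linarith)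
  unfold T1; positivity

lemma T0_le_T1 {s : ℝ} (h : 0 ≤ s) : T0 s ≤ T1 s := by
  rcases le_or_gt 1 s with h1 | h1
  · rw [T0_zero h1, T1_zero h1]
  · have : 1 ≤ (1 - s)⁻¹ := by
      rw [one_le_inv₀ (by linarith)]; linarith
    have h2 : 1 ≤ ((1 - s)⁻¹) ^ 2 := one_le_pow₀ this
    have := T0_nonneg s
    unfold T1; unfold T0 at *
    nlinarith

lemma T1_bdd : ∃ C, 0 < C ∧ ∀ s, 0 ≤ s → T1 s ≤ C := by
  obtain ⟨C, hC⟩ := (isCompact_Icc (a := (0:ℝ)) (b := 1)).exists_bound_of_continuousOn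
    contDiff_T1.continuous.continuousOn
  refine ⟨max C 1, by positivity, fun s hs => ?_⟩
  rcases le_or_gt 1 s with h1 | h1
  · rw [T1_zero h1]; positivity
  · exact (le_abs_self _).trans ((hC s ⟨hs, h1.le⟩).trans (le_max_left _ _))

/-- Unnormalised mass of the reference kernel. -/
def mass (N : ℕ) : ℝ := ∫ z : Euc N, 2 * T1 (‖z‖ ^ 2)

lemma mass_aux (N : ℕ) : Continuous (fun z : Euc N => 2 * T1 (‖z‖ ^ 2)) ∧
    HasCompactSupport (fun z : Euc N => 2 * T1 (‖z‖ ^ 2)) := by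
  refine ⟨?_, ?_⟩
  · have := contDiff_T1.continuous
    fun_prop
  · refine HasCompactSupport.of_support_subset_isCompact (isCompact_closedBall 0 1) ?_
    intro z hz
    rw [mem_closedBall_zero_iff]
    by_contra h
    apply hz
    have : 1 ≤ ‖z‖ ^ 2 := one_le_pow₀ (not_le.1 h).le
    simp [T1_zero this]

lemma mass_pos (N : ℕ) : 0 < mass N := by
  obtain ⟨h1, h2⟩ := mass_aux N
  refine h1.integral_pos_of_hasCompactSupport_nonneg_nonzero h2 ?_ (x := 0) ?_
  · intro z; have := T1_nonneg (‖z‖ ^ 2); simp; exact this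
  · have := T1_pos (s := 0) (by norm_num)
    simp; exact this.ne'

/-- The potential-type kernel. -/
def sg {N : ℕ} (ε : ℝ) (z : Euc N) : ℝ := (mass N)⁻¹ * (ε⁻¹) ^ N * T0 (‖z‖ ^ 2 * (ε⁻¹) ^ 2)

/-- The mollifier. -/
def rh {N : ℕ} (ε : ℝ) (z : Euc N) : ℝ :=
  (mass N)⁻¹ * (ε⁻¹) ^ N * (2 * T1 (‖z‖ ^ 2 * (ε⁻¹) ^ 2))

section
variable {N : ℕ} {ε : ℝ}

lemma sg_nonneg (hε : 0 < ε) (z : Euc N) : 0 ≤ sg ε z := by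
  have := mass_pos N
  have := T0_nonneg (‖z‖ ^ 2 * (ε⁻¹) ^ 2)
  unfold sg; positivity

lemma rh_nonneg (hε : 0 < ε) (z : Euc N) : 0 ≤ rh ε z := by
  have := mass_pos N
  have := T1_nonneg (‖z‖ ^ 2 * (ε⁻¹) ^ 2)
  unfold rh; positivity

lemma sg_neg (z : Euc N) : sg ε (-z) = sg ε z := by simp [sg]

lemma sg_le_rh (hε : 0 < ε) (z : Euc N) : sg ε z ≤ rh ε z / 2 := by
  have := mass_pos N
  have := T0_le_T1 (s := ‖z‖ ^ 2 * (ε⁻¹) ^ 2) (by positivity)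
  unfold sg rh
  have h2 : 0 ≤ (mass N)⁻¹ * (ε⁻¹) ^ N := by positivity
  nlinarith

lemma ker_aux (hε : 0 < ε) {z : Euc N} (h : ε ≤ ‖z‖) : 1 ≤ ‖z‖ ^ 2 * (ε⁻¹) ^ 2 := by
  rw [← mul_pow]
  refine one_le_pow₀ ?_
  rw [← div_eq_mul_inv, one_le_div hε]; exact h

lemma rh_zero (hε : 0 < ε) {z : Euc N} (h : ε ≤ ‖z‖) : rh ε z = 0 := by
  rw [rh, T1_zero (ker_aux hε h)]; simp

lemma sg_zero (hε : 0 < ε) {z : Euc N} (h : ε ≤ ‖z‖) : sg ε z = 0 := by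
  rw [sg, T0_zero (ker_aux hε h)]; simp

lemma Tst_sg (hε : 0 < ε) : Tst (sg ε : Euc N → ℝ) := by
  refine ⟨?_, HasCompactSupport.of_support_subset_isCompact (isCompact_closedBall 0 ε) ?_⟩
  · refine contDiff_const.mul (contDiff_T0.comp ((contDiff_norm_sq ℝ).mul contDiff_const))
  · intro z hz
    rw [mem_closedBall_zero_iff]
    by_contra h
    exact hz (sg_zero hε (not_le.1 h).le)

lemma Tst_rh (hε : 0 < ε) : Tst (rh ε : Euc N → ℝ) := by
  refine ⟨?_, HasCompactSupport.of_support_subset_isCompact (isCompact_closedBall 0 ε) ?_⟩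
  · refine contDiff_const.mul (contDiff_const.mul
      (contDiff_T1.comp ((contDiff_norm_sq ℝ).mul contDiff_const)))
  · intro z hz
    rw [mem_closedBall_zero_iff]
    by_contra h
    exact hz (rh_zero hε (not_le.1 h).le)

lemma integral_rh (hε : 0 < ε) : ∫ z : Euc N, rh ε z = 1 := by
  have h := Measure.integral_comp_smul (volume : Measure (Euc N))
    (fun z : Euc N => 2 * T1 (‖z‖ ^ 2)) ε⁻¹
  have e : ∀ z : Euc N, rh ε z = (mass N)⁻¹ * (ε⁻¹) ^ N * (2 * T1 (‖ε⁻¹ • z‖ ^ 2)) := by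
    intro z
    rw [norm_smul, mul_pow, norm_inv, Real.norm_of_nonneg hε.le, mul_comm (_ ^ 2)]
    rfl
  simp_rw [e]
  rw [integral_const_mul, h]
  have hm := (mass_pos N).ne'
  have : (∫ z : Euc N, 2 * T1 (‖z‖ ^ 2)) = mass N := rfl
  rw [this]
  simp
  rw [abs_of_pos hε]
  field_simp

lemma pd_radial {T T' : ℝ → ℝ} (hT : ∀ s, HasDerivAt T (T' s) s) (a b : ℝ) (i : Fin N)
    (z : Euc N) :
    pd i (fun z => a * T (‖z‖ ^ 2 * b)) z = a * (T' (‖z‖ ^ 2 * b) * (2 * z i * b)) := by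
  have h1 : HasFDerivAt (fun z : Euc N => ‖z‖ ^ 2) (2 • innerSL ℝ z) z :=
    (hasStrictFDerivAt_norm_sq z).hasFDerivAt
  have h2 := ((hT (‖z‖ ^ 2 * b)).comp_hasFDerivAt z (h1.mul_const b)).const_mul a
  unfold pd
  erw [h2.fderiv]
  have h3 : inner ℝ z (EuclideanSpace.single i (1:ℝ)) = z i := by
    simp [EuclideanSpace.inner_single_right]
  simp [h3]
  ring_nf
  simp

lemma pd_sg (i : Fin N) (z : Euc N) : pd i (sg ε) z = - (ε⁻¹) ^ 2 * (z i * rh ε z) := by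
  have := pd_radial hasDerivAt_T0 ((mass N)⁻¹ * (ε⁻¹) ^ N) ((ε⁻¹) ^ 2) i z
  refine this.trans ?_
  unfold rh; ring

lemma abs_pd_sg_le (hε : 0 < ε) (i : Fin N) (z : Euc N) : |pd i (sg ε) z| ≤ ε⁻¹ * rh ε z := by
  rw [pd_sg, abs_mul, abs_mul, abs_neg, abs_of_nonneg (rh_nonneg hε z),
    abs_of_nonneg (by positivity)]
  rcases le_or_gt ε ‖z‖ with h | h
  · rw [rh_zero hε h]; simp
  · have h1 : |z i| ≤ ε := (PiLp.norm_apply_le z i).trans h.le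
    have h2 := rh_nonneg hε z
    calc (ε⁻¹) ^ 2 * (|z i| * rh ε z) ≤ (ε⁻¹) ^ 2 * (ε * rh ε z) := by gcongr
      _ = _ := by field_simp

/-- Explicit formula for the Laplacian of `sg`. -/
lemma lap_sg (z : Euc N) : lap (sg ε) z = - (ε⁻¹) ^ 2 * (mass N)⁻¹ * (ε⁻¹) ^ N *
    (2 * N * T1 (‖z‖ ^ 2 * (ε⁻¹) ^ 2) +
      4 * (‖z‖ ^ 2 * (ε⁻¹) ^ 2) * deriv T1 (‖z‖ ^ 2 * (ε⁻¹) ^ 2)) := by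
  have h : ∀ i, pd i (pd i (sg ε)) z =
      - (ε⁻¹) ^ 2 * (rh ε z + z i * pd i (rh ε) z) := by
    intro i
    have e : pd i (sg ε) = fun z : Euc N => - (ε⁻¹) ^ 2 * (z i * rh ε z) := by
      ext z; exact pd_sg i z
    rw [e]
    have hr : DifferentiableAt ℝ (rh ε : Euc N → ℝ) z := by
      have : ContDiff ℝ ∞ (rh ε : Euc N → ℝ) := contDiff_const.mul (contDiff_const.mul
        (contDiff_T1.comp ((contDiff_norm_sq ℝ).mul contDiff_const)))
      exact this.differentiable (by simp) z
    have h1 : HasFDerivAt (fun z : Euc N => z i) (EuclideanSpace.proj i : Euc N →L[ℝ] ℝ) z :=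
      (EuclideanSpace.proj i : Euc N →L[ℝ] ℝ).hasFDerivAt
    have h2 := (h1.mul hr.hasFDerivAt).const_mul (- (ε⁻¹) ^ 2)
    unfold pd
    erw [h2.fderiv]
    simp
    ring
  have hT : ∀ s, HasDerivAt T1 (deriv T1 s) s := fun s =>
    (contDiff_T1.differentiable (by simp) s).hasDerivAt
  have h3 : ∀ i, pd i (rh ε) z = (mass N)⁻¹ * (ε⁻¹) ^ N * (2 * (deriv T1 (‖z‖ ^ 2 * (ε⁻¹) ^ 2) *
      (2 * z i * (ε⁻¹) ^ 2))) := by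
    intro i
    have := pd_radial hT ((mass N)⁻¹ * (ε⁻¹) ^ N * 2) ((ε⁻¹) ^ 2) i z
    rw [show (rh ε : Euc N → ℝ) = fun z =>
        (mass N)⁻¹ * (ε⁻¹) ^ N * 2 * T1 (‖z‖ ^ 2 * (ε⁻¹) ^ 2) from by
      ext z; unfold rh; ring]
    rw [this]; ring
  rw [lap_eq_sum_pd]
  simp_rw [h, h3]
  rw [← Finset.mul_sum, Finset.sum_add_distrib]
  have h4 : ∑ i, z i * ((mass N)⁻¹ * (ε⁻¹) ^ N * (2 * (deriv T1 (‖z‖ ^ 2 * (ε⁻¹) ^ 2) *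
      (2 * z i * (ε⁻¹) ^ 2)))) =
      (∑ i, z i ^ 2) * ((mass N)⁻¹ * (ε⁻¹) ^ N * (2 * (deriv T1 (‖z‖ ^ 2 * (ε⁻¹) ^ 2) *
      (2 * (ε⁻¹) ^ 2)))) := by
    rw [Finset.sum_mul]; refine Finset.sum_congr rfl fun i _ => by ring
  rw [h4, ← EuclideanSpace.real_norm_sq_eq]
  simp [rh]
  ring

lemma hasDerivAt_rh (hε : 0 < ε) (z : Euc N) :
    HasDerivAt (fun ε => rh ε z) (ε * lap (sg ε) z) ε := by
  have hT : ∀ s, HasDerivAt T1 (deriv T1 s) s := fun s =>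
    (contDiff_T1.differentiable (by simp) s).hasDerivAt
  have hi := hasDerivAt_inv hε.ne'
  have h1 := (hi.pow 2).const_mul (‖z‖ ^ 2)
  have h2 := ((hT _).comp ε h1).const_mul 2
  have h3 := ((hi.pow N).const_mul (mass N)⁻¹).mul h2
  have h4 : HasDerivAt (fun ε => rh ε z) _ ε := h3
  refine h4.congr_deriv ?_
  rw [lap_sg]
  rcases Nat.eq_zero_or_pos N with rfl | hN
  · simp; field_simp; try ring
  · obtain ⟨n, rfl⟩ : ∃ n, N = n + 1 := ⟨N - 1, by omega⟩
    simp [pow_succ]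
    field_simp
    ring
end

/-- Convolution `∫ u(y) k(x-y) dy`. -/
def cv {N : ℕ} (k u : Euc N → ℝ) (x : Euc N) : ℝ := ∫ y, u y * k (x - y)

section
variable {N : ℕ} {k u : Euc N → ℝ}

lemma cv_integrable (hk : Tst k) (hu : Integrable u) (x : Euc N) :
    Integrable (fun y => u y * k (x - y)) := by
  obtain ⟨C, _, hC⟩ := hk.bdd
  refine hu.mul_bdd (c := C) (hk.reflect x).continuous.aestronglyMeasurable ?_
  exact Eventually.of_forall fun y => hC _

lemma abs_cv_le {C : ℝ} (hC : ∀ z, |k z| ≤ C) (hu : Integrable u) (x : Euc N) :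
    |cv k u x| ≤ C * ∫ y, |u y| := by
  unfold cv
  rw [← integral_const_mul, ← Real.norm_eq_abs]
  refine norm_integral_le_of_norm_le (hu.abs.const_mul C) (Eventually.of_forall fun y => ?_)
  rw [Real.norm_eq_abs, abs_mul, mul_comm]
  exact mul_le_mul_of_nonneg_right (hC _) (abs_nonneg _)

lemma contDiff_cv (hk : Tst k) (hu : Integrable u) : ContDiff ℝ ∞ (cv k u) :=
  hk.2.contDiff_convolution_right (n := ⊤) (ContinuousLinearMap.mul ℝ ℝ) hu.locallyIntegrable hk.1

lemma pd_cv (hk : Tst k) (hu : Integrable u) (i : Fin N) (x : Euc N) :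
    pd i (cv k u) x = cv (pd i k) u x := by
  have h := hk.2.hasFDerivAt_convolution_right (ContinuousLinearMap.mul ℝ ℝ)
    hu.locallyIntegrable (hk.1.of_le (by simp)) x
  unfold pd
  erw [h.fderiv]
  rw [convolution_precompR_apply]
  · rfl
  · exact hu.locallyIntegrable
  · exact hk.2.fderiv (𝕜 := ℝ)
  · exact hk.1.continuous_fderiv (by simp)

lemma cv_zero_of_dist {R ε : ℝ} (hk : ∀ z, ε ≤ ‖z‖ → k z = 0) (hu : ∀ y, R < ‖y‖ → u y = 0)
    {x : Euc N} (hx : R + ε ≤ ‖x‖) : cv k u x = 0 := by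
  unfold cv
  have : ∀ y, u y * k (x - y) = 0 := by
    intro y
    rcases lt_or_ge R ‖y‖ with h | h
    · rw [hu y h, zero_mul]
    · rw [hk (x - y), mul_zero]
      have := norm_sub_norm_le x y
      linarith
  simp [this]

lemma pd_reflect (i : Fin N) (φ : Euc N → ℝ) (x y : Euc N) :
    pd i (fun y => φ (x - y)) y = - pd i φ (x - y) := by
  unfold pd
  have h := (ContinuousLinearEquiv.neg ℝ (M := Euc N)).comp_right_fderiv
    (f := fun y => φ (x + y)) (x := y)
  have e : (fun y => φ (x - y)) =
      (fun y => φ (x + y)) ∘ (ContinuousLinearEquiv.neg ℝ (M := Euc N)) := by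
    ext y; simp [sub_eq_add_neg]
  rw [e, h, fderiv_comp_add_left]; simp [sub_eq_add_neg]

lemma lap_reflect (φ : Euc N → ℝ) (x y : Euc N) :
    lap (fun y => φ (x - y)) y = lap φ (x - y) := by
  rw [lap_eq_sum_pd, lap_eq_sum_pd]
  refine Finset.sum_congr rfl fun i _ => ?_
  have : pd i (fun y => φ (x - y)) = fun y => - pd i φ (x - y) := by
    ext y; exact pd_reflect i φ x y
  rw [this]
  have h2 := pd_reflect i (pd i φ) x y
  have : pd i (fun y => - pd i φ (x - y)) y = - pd i (fun y => pd i φ (x - y)) y := by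
    simp only [pd]
    rw [fderiv_fun_neg]; simp
  rw [this, h2]; simp

/-- The `ε`-derivative of the mollifier. -/
def lk (ε : ℝ) (z : Euc N) : ℝ := ε * lap (sg ε) z

lemma lk_measurable : Measurable (fun q : ℝ × Euc N => lk q.1 q.2) := by
  have h1 := contDiff_T1.continuous
  have h2 : Continuous (deriv T1) := contDiff_T1.continuous_deriv (by simp)
  have h1 := h1.measurable
  have h2 := h2.measurable
  unfold lk
  simp_rw [lap_sg]
  fun_prop

lemma lk_zero {ε : ℝ} (hε : 0 < ε) {z : Euc N} (h : ε < ‖z‖) : lk ε z = 0 := by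
  have h1 : 1 < ‖z‖ ^ 2 * (ε⁻¹) ^ 2 := by
    rw [← mul_pow]
    refine one_lt_pow₀ ?_ two_ne_zero
    rw [← div_eq_mul_inv, one_lt_div hε]; exact h
  have h2 : deriv T1 (‖z‖ ^ 2 * (ε⁻¹) ^ 2) = 0 := by
    have : T1 =ᶠ[𝓝 (‖z‖ ^ 2 * (ε⁻¹) ^ 2)] fun _ => 0 := by
      filter_upwards [lt_mem_nhds h1] with s hs using T1_zero hs.le
    rw [this.deriv_eq]; simp
  rw [lk, lap_sg, h2, T1_zero h1.le]; simp

lemma lk_bdd {δ r : ℝ} (hδ : 0 < δ) : ∃ C, ∀ ε ∈ Icc δ r, ∀ z : Euc N, |lk ε z| ≤ C := by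
  have hc : ContinuousOn (fun q : ℝ × Euc N => lk q.1 q.2) (Icc δ r ×ˢ Metric.closedBall 0 r) := by
    have h1 := contDiff_T1.continuous
    have h2 : Continuous (deriv T1) := contDiff_T1.continuous_deriv (by simp)
    have h3 : ContinuousOn (fun q : ℝ × Euc N => q.1⁻¹) (Icc δ r ×ˢ Metric.closedBall 0 r) :=
      continuousOn_fst.inv₀ fun q hq => (hδ.trans_le hq.1.1).ne'
    have h4 : ContinuousOn (fun q : ℝ × Euc N => ‖q.2‖ ^ 2 * q.1⁻¹ ^ 2)
      (Icc δ r ×ˢ Metric.closedBall 0 r) := by fun_prop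
    have h5 := h1.comp_continuousOn h4
    have h6 := h2.comp_continuousOn h4
    unfold lk
    simp_rw [lap_sg]
    simp only [Function.comp_def] at h5 h6
    fun_prop
  obtain ⟨C, hC⟩ := (isCompact_Icc.prod (isCompact_closedBall 0 r)).exists_bound_of_continuousOn hc
  refine ⟨max C 0, fun ε hε z => ?_⟩
  rcases le_or_gt ‖z‖ r with h | h
  · exact (hC (ε, z) ⟨hε, by simpa using h⟩).trans (le_max_left _ _)
  · rw [lk_zero (hδ.trans_le hε.1) (hε.2.trans_lt h)]; simp

lemma lk_intervalIntegrable {δ r : ℝ} (hδ : 0 < δ) (hr : δ ≤ r) (z : Euc N) :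
    IntervalIntegrable (fun ε => lk ε z) volume δ r := by
  obtain ⟨C, hC⟩ := lk_bdd (N := N) (r := r) hδ
  rw [intervalIntegrable_iff_integrableOn_Ioc_of_le hr]
  refine Measure.integrableOn_of_bounded (M := C) (by simp) ?_ ?_
  · exact (lk_measurable.comp measurable_prodMk_right).aestronglyMeasurable
  · filter_upwards [ae_restrict_mem measurableSet_Ioc] with ε hε
    exact hC ε ⟨hε.1.le, hε.2⟩ z

lemma rh_sub_rh {δ r : ℝ} (hδ : 0 < δ) (hr : δ ≤ r) (z : Euc N) :
    rh r z - rh δ z = ∫ ε in δ..r, lk ε z := by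
  rw [intervalIntegral.integral_eq_sub_of_hasDerivAt (f := fun ε => rh ε z)]
  · intro ε hε
    rw [uIcc_of_le hr] at hε
    exact hasDerivAt_rh (hδ.trans_le hε.1) z
  · exact lk_intervalIntegrable hδ hr z

lemma lk_prod_integrable {δ r : ℝ} (hδ : 0 < δ) (hu : Integrable u) (x : Euc N) :
    Integrable (fun q : ℝ × Euc N => u q.2 * lk q.1 (x - q.2))
      ((volume.restrict (Ioc δ r)).prod volume) := by
  obtain ⟨C, hC⟩ := lk_bdd (N := N) (r := r) hδ
  have h1 : Integrable (fun q : ℝ × Euc N => u q.2) ((volume.restrict (Ioc δ r)).prod volume) :=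
    hu.comp_snd _
  refine h1.mul_bdd (c := C) ?_ ?_
  · exact (lk_measurable.comp (measurable_fst.prodMk
      (measurable_const.sub measurable_snd))).aestronglyMeasurable
  · have : ∀ᵐ ε ∂(volume.restrict (Ioc δ r)), ε ∈ Icc δ r := by
      filter_upwards [ae_restrict_mem measurableSet_Ioc] with ε hε using ⟨hε.1.le, hε.2⟩
    have := (Measure.quasiMeasurePreserving_fst (μ := volume.restrict (Ioc δ r))
      (ν := (volume : Measure (Euc N)))).ae this
    filter_upwards [this] with q hq
    exact hC _ hq _

/-- Representation of the increments of the mollification. -/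
lemma cv_rh_sub {δ r : ℝ} (hδ : 0 < δ) (hr : δ ≤ r) (hu : Integrable u) (x : Euc N) :
    cv (rh r) u x - cv (rh δ) u x = ∫ ε in δ..r, cv (lk ε) u x := by
  have h := integral_integral_swap (f := fun ε y => u y * lk ε (x - y))
    (lk_prod_integrable (r := r) hδ hu x)
  rw [intervalIntegral.integral_of_le hr]
  simp only [cv]
  rw [h, ← integral_sub (cv_integrable (Tst_rh (hδ.trans_le hr)) hu x)
    (cv_integrable (Tst_rh hδ) hu x)]
  refine integral_congr_ae (Eventually.of_forall fun y => ?_)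
  simp only
  rw [← mul_sub, rh_sub_rh hδ hr, integral_const_mul, intervalIntegral.integral_of_le hr]

lemma cv_lk_intervalIntegrable {δ r : ℝ} (hδ : 0 < δ) (hr : δ ≤ r) (hu : Integrable u)
    (x : Euc N) : IntervalIntegrable (fun ε => cv (lk ε) u x) volume δ r := by
  rw [intervalIntegrable_iff_integrableOn_Ioc_of_le hr]
  exact (lk_prod_integrable (r := r) hδ hu x).integral_prod_left

lemma cv_lk_eq (u : Euc N → ℝ) (ε : ℝ) (x : Euc N) :
    cv (lk ε) u x = ε * ∫ y, u y * lap (fun y => sg ε (x - y)) y := by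
  rw [← integral_const_mul]
  unfold cv lk
  refine integral_congr_ae (Eventually.of_forall fun y => ?_)
  simp only [lap_reflect]; ring
end

lemma sq_integral_mul_le {α : Type*} [MeasurableSpace α] {μ : Measure α} {h ρ : α → ℝ}
    (hρ : ∀ x, 0 ≤ ρ x) (h1 : ∫ x, ρ x ∂μ = 1) (i1 : Integrable (fun x => h x * ρ x) μ)
    (i2 : Integrable (fun x => h x ^ 2 * ρ x) μ) :
    (∫ x, h x * ρ x ∂μ) ^ 2 ≤ ∫ x, h x ^ 2 * ρ x ∂μ := by
  set c := ∫ x, h x * ρ x ∂μ with hc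
  have i0 : Integrable ρ μ := by
    by_contra hn
    rw [integral_undef hn] at h1; simp at h1
  have h3 : 0 ≤ ∫ x, (h x - c) ^ 2 * ρ x ∂μ :=
    integral_nonneg fun x => mul_nonneg (sq_nonneg _) (hρ x)
  have h4 : ∀ x, (h x - c) ^ 2 * ρ x = h x ^ 2 * ρ x - 2 * c * (h x * ρ x) + c ^ 2 * ρ x := by
    intro x; ring
  simp_rw [h4] at h3
  have e1 : Integrable (fun x => 2 * c * (h x * ρ x)) μ := i1.const_mul _
  have e2 : Integrable (fun x => c ^ 2 * ρ x) μ := i0.const_mul _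
  rw [integral_add (f := fun x => h x ^ 2 * ρ x - 2 * c * (h x * ρ x)) (i2.sub e1) e2,
    integral_sub i2 e1, integral_const_mul, integral_const_mul, h1,
    ← hc] at h3
  nlinarith

/-- The Dirichlet integral. -/
def Dir {N : ℕ} (φ : Euc N → ℝ) : ℝ := ∑ i, ∫ x, pd i φ x ^ 2

section
variable {N : ℕ} {u φ : Euc N → ℝ}

lemma fderiv_apply_eq_sum (φ : Euc N → ℝ) (x v : Euc N) :
    fderiv ℝ φ x v = ∑ i, v i * pd i φ x := by
  have : v = ∑ i, v i • EuclideanSpace.single i (1:ℝ) := by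
    ext j; simp [Finset.sum_apply, Pi.single_apply]
  conv_lhs => rw [this]
  rw [map_sum]
  simp [pd]

lemma sq_fderiv_apply_le (φ : Euc N → ℝ) (x v : Euc N) :
    (fderiv ℝ φ x v) ^ 2 ≤ ‖v‖ ^ 2 * ∑ i, pd i φ x ^ 2 := by
  rw [fderiv_apply_eq_sum, EuclideanSpace.real_norm_sq_eq]
  exact Finset.sum_mul_sq_le_sq_mul_sq _ _ _

lemma sq_sub_le (hφ : Tst φ) (x z : Euc N) :
    (φ x - φ (x - z)) ^ 2 ≤ ‖z‖ ^ 2 * ∫ s in Ioc (0:ℝ) 1, ∑ i, pd i φ (x - s • z) ^ 2 := by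
  have hd : ∀ s : ℝ, HasDerivAt (fun s : ℝ => φ (x - s • z)) (fderiv ℝ φ (x - s • z) (-z)) s := by
    intro s
    have h1 : HasDerivAt (fun s : ℝ => x - s • z) (-z) s := by
      have := ((hasDerivAt_id s).smul_const z).const_sub x
      simpa using this
    exact (hφ.differentiable (x - s • z)).hasFDerivAt.comp_hasDerivAt s h1
  have hc : Continuous (fun s : ℝ => fderiv ℝ φ (x - s • z) (-z)) := by
    have := hφ.1.continuous_fderiv (by simp)
    fun_prop
  have hc2 : Continuous (fun s : ℝ => ∑ i, pd i φ (x - s • z) ^ 2) := by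
    have := fun i => (hφ.pderiv i).continuous
    fun_prop
  have h := intervalIntegral.integral_eq_sub_of_hasDerivAt (fun s _ => hd s)
    (hc.intervalIntegrable 0 1)
  simp only [map_neg, intervalIntegral.integral_neg, one_smul, zero_smul, sub_zero] at h
  have e : (φ x - φ (x - z)) ^ 2 = (∫ s in (0:ℝ)..1, fderiv ℝ φ (x - s • z) (-z)) ^ 2 := by
    simp only [map_neg, intervalIntegral.integral_neg]; rw [h]; ring
  rw [e, intervalIntegral.integral_of_le zero_le_one]
  have h5 := sq_integral_mul_le (μ := volume.restrict (Ioc (0:ℝ) 1)) (ρ := fun _ => 1)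
    (h := fun s => fderiv ℝ φ (x - s • z) (-z)) (fun _ => by simp) (by simp)
    (by simp only [mul_one]; exact (hc.intervalIntegrable 0 1).1)
    (by simp only [mul_one]; exact ((hc.pow 2).intervalIntegrable 0 1).1)
  simp only [mul_one] at h5
  refine h5.trans ?_
  rw [← integral_const_mul]
  refine integral_mono ?_ ?_ fun s => ?_
  · exact ((hc.pow 2).intervalIntegrable 0 1).1
  · exact ((continuous_const.mul hc2).intervalIntegrable 0 1).1
  · simpa using sq_fderiv_apply_le φ (x - s • z) (-z)

lemma Tst.integral_sum_pd_sq (hφ : Tst φ) : ∫ x, ∑ i, pd i φ x ^ 2 = Dir φ := by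
  rw [integral_finsetSum]
  · rfl
  · intro i _
    have h := hφ.pderiv i
    simp_rw [pow_two]
    exact (h.mul h.1).integrable

lemma Tst.sq (hφ : Tst φ) : Tst (fun x => φ x ^ 2) := by
  simp_rw [pow_two]; exact hφ.mul hφ.1

lemma Tst.sub {ψ : Euc N → ℝ} (hφ : Tst φ) (hψ : Tst ψ) : Tst (fun x => φ x - ψ x) :=
  ⟨hφ.1.sub hψ.1, hφ.2.sub hψ.2⟩

lemma Tst.translate (hφ : Tst φ) (z : Euc N) : Tst (fun x => φ (x - z)) :=
  ⟨hφ.1.comp (contDiff_id.sub contDiff_const), hφ.2.comp_homeomorph (Homeomorph.subRight z)⟩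

lemma Dir_nonneg (φ : Euc N → ℝ) : 0 ≤ Dir φ :=
  Finset.sum_nonneg fun _ _ => integral_nonneg fun _ => sq_nonneg _

lemma Tst.sum_pd_sq (hφ : Tst φ) : Continuous (fun x => ∑ i, pd i φ x ^ 2) ∧
    HasCompactSupport (fun x => ∑ i, pd i φ x ^ 2) := by
  refine ⟨?_, ?_⟩
  · have := fun i => (hφ.pderiv i).continuous
    fun_prop
  · refine HasCompactSupport.of_support_subset_isCompact hφ.2 ?_
    intro x hx
    by_contra h
    apply hx
    refine Finset.sum_eq_zero fun i _ => ?_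
    have : fderiv ℝ φ x = 0 := by
      by_contra h0
      exact h (support_fderiv_subset ℝ h0)
    simp [pd, this]

lemma integral_sq_translate_le (hφ : Tst φ) (z : Euc N) :
    ∫ x, (φ x - φ (x - z)) ^ 2 ≤ ‖z‖ ^ 2 * Dir φ := by
  obtain ⟨hc, hs⟩ := hφ.sum_pd_sq
  obtain ⟨R, hR⟩ := hs.isCompact.isBounded.subset_closedBall (0 : Euc N)
  have h_int : Integrable (fun q : Euc N × ℝ => ∑ i, pd i φ (q.1 - q.2 • z) ^ 2)
      (volume.prod (volume.restrict (Ioc (0:ℝ) 1))) := by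
    have hm : Measurable (fun q : Euc N × ℝ => ∑ i, pd i φ (q.1 - q.2 • z) ^ 2) := by
      have : Continuous (fun q : Euc N × ℝ => ∑ i, pd i φ (q.1 - q.2 • z) ^ 2) :=
        hc.comp (f := fun q : Euc N × ℝ => q.1 - q.2 • z) (by fun_prop)
      exact this.measurable
    rw [integrable_prod_iff' hm.aestronglyMeasurable]
    have hi : ∀ s : ℝ, Integrable (fun x => ∑ i, pd i φ (x - s • z) ^ 2) := fun s =>
      (hc.integrable_of_hasCompactSupport hs).comp_sub_right (s • z)
    refine ⟨Eventually.of_forall fun s => hi s, ?_⟩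
    have : ∀ s : ℝ, ∫ x, ‖∑ i, pd i φ (x - s • z) ^ 2‖ = Dir φ := by
      intro s
      rw [integral_sub_right_eq_self (fun x => ‖∑ i, pd i φ x ^ 2‖) (s • z)]
      rw [← hφ.integral_sum_pd_sq]
      refine integral_congr_ae (Eventually.of_forall fun x => ?_)
      exact Real.norm_of_nonneg (Finset.sum_nonneg fun _ _ => sq_nonneg _)
    simp_rw [this]
    exact integrable_const _
  have h1 : ∫ x, (φ x - φ (x - z)) ^ 2 ≤
      ∫ x, ‖z‖ ^ 2 * ∫ s in Ioc (0:ℝ) 1, ∑ i, pd i φ (x - s • z) ^ 2 := by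
    refine integral_mono (hφ.sub (hφ.translate z)).sq.integrable ?_ fun x => sq_sub_le hφ x z
    exact h_int.integral_prod_left.const_mul _
  refine h1.trans (le_of_eq ?_)
  rw [integral_const_mul]
  congr 1
  rw [integral_integral_swap (f := fun x s => ∑ i, pd i φ (x - s • z) ^ 2) h_int]
  have : ∀ s : ℝ, ∫ x, ∑ i, pd i φ (x - s • z) ^ 2 = Dir φ := by
    intro s
    rw [integral_sub_right_eq_self (fun x => ∑ i, pd i φ x ^ 2) (s • z)]
    exact hφ.integral_sum_pd_sq
  simp [this]

lemma cv_eq (k u : Euc N → ℝ) (x : Euc N) : cv k u x = ∫ z, u (x - z) * k z := by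
  unfold cv
  rw [← integral_sub_left_eq_self _ volume x]
  simp

lemma Tst.cv_rh (hφ : Integrable φ) {R ε : ℝ} (hε : 0 < ε) (hR : ∀ y, R < ‖y‖ → φ y = 0) :
    Tst (cv (rh ε) φ) := by
  refine ⟨contDiff_cv (Tst_rh hε) hφ,
    HasCompactSupport.of_support_subset_isCompact (isCompact_closedBall 0 (R + ε)) ?_⟩
  intro x hx
  rw [mem_closedBall_zero_iff]
  by_contra h
  exact hx (cv_zero_of_dist (fun z hz => rh_zero hε hz) hR (not_le.1 h).le)

lemma Tst.exists_bound (hφ : Tst φ) : ∃ R, 0 < R ∧ ∀ y, R < ‖y‖ → φ y = 0 := by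
  obtain ⟨R, hR⟩ := hφ.2.isCompact.isBounded.subset_closedBall (0 : Euc N)
  refine ⟨max R 1, by positivity, fun y hy => ?_⟩
  by_contra h
  have := hR (subset_tsupport _ h)
  rw [mem_closedBall_zero_iff] at this
  exact absurd hy (not_lt.2 (this.trans (le_max_left _ _)))

/-- Mollification error in `L²`. -/
lemma integral_sub_cv_sq_le (hφ : Tst φ) {ε : ℝ} (hε : 0 < ε) :
    ∫ x, (φ x - cv (rh ε) φ x) ^ 2 ≤ ε ^ 2 * Dir φ := by
  obtain ⟨R, hR0, hR⟩ := hφ.exists_bound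
  have hrc := (Tst_rh (N := N) hε).continuous
  have hφc := hφ.continuous
  have h_int : Integrable (fun q : Euc N × Euc N => (φ q.1 - φ (q.1 - q.2)) ^ 2 * rh ε q.2)
      (volume.prod volume) := by
    have hc : Continuous (fun q : Euc N × Euc N => (φ q.1 - φ (q.1 - q.2)) ^ 2 * rh ε q.2) := by
      fun_prop
    refine hc.integrable_of_hasCompactSupport (HasCompactSupport.of_support_subset_isCompact
      ((isCompact_closedBall (0 : Euc N) (R + ε)).prod (isCompact_closedBall (0 : Euc N) ε)) ?_)
    rintro ⟨x, z⟩ hq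
    have hz : ‖z‖ ≤ ε := by
      by_contra h
      apply hq; simp [rh_zero hε (not_le.1 h).le]
    refine ⟨?_, by simpa using hz⟩
    rw [mem_closedBall_zero_iff]
    by_contra h
    simp at h
    apply hq
    have h1 : φ x = 0 := hR x (by linarith)
    have h2 : φ (x - z) = 0 := hR _ (by have := norm_sub_norm_le x z; linarith)
    simp [h1, h2]
  have hpt : ∀ x, (φ x - cv (rh ε) φ x) ^ 2 ≤ ∫ z, (φ x - φ (x - z)) ^ 2 * rh ε z := by
    intro x
    have i0 : Integrable (fun z => φ x * rh ε z) := (Tst_rh (N := N) hε).integrable.const_mul _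
    have i1 : Integrable (fun z => φ (x - z) * rh ε z) := by
      have := ((Tst_rh (N := N) hε).mul (hφ.reflect x).1).integrable
      simpa [mul_comm] using this
    have e : φ x - cv (rh ε) φ x = ∫ z, (φ x - φ (x - z)) * rh ε z := by
      simp_rw [sub_mul]
      rw [integral_sub i0 i1, integral_const_mul, integral_rh hε, mul_one, cv_eq]
    rw [e]
    refine sq_integral_mul_le (fun z => rh_nonneg hε z) (integral_rh hε) ?_ ?_
    · simp_rw [sub_mul]; exact i0.sub i1
    · have hh : ContDiff ℝ ∞ (fun z => (φ x - φ (x - z)) ^ 2) :=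
        (contDiff_const.sub (hφ.reflect x).1).pow 2
      have := ((Tst_rh (N := N) hε).mul hh).integrable
      simpa [mul_comm] using this
  calc ∫ x, (φ x - cv (rh ε) φ x) ^ 2 ≤ ∫ x, ∫ z, (φ x - φ (x - z)) ^ 2 * rh ε z := by
        refine integral_mono ?_ h_int.integral_prod_left hpt
        exact (hφ.sub (Tst.cv_rh hφ.integrable hε hR)).sq.integrable
    _ = ∫ z, ∫ x, (φ x - φ (x - z)) ^ 2 * rh ε z :=
        integral_integral_swap (f := fun x z => (φ x - φ (x - z)) ^ 2 * rh ε z) h_int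
    _ ≤ ∫ z, ε ^ 2 * Dir φ * rh ε z := by
        refine integral_mono h_int.integral_prod_right
          ((Tst_rh (N := N) hε).integrable.const_mul _) fun z => ?_
        simp only
        rw [integral_mul_const]
        rcases le_or_gt ε ‖z‖ with h | h
        · rw [rh_zero hε h]; simp
        · refine mul_le_mul_of_nonneg_right ?_ (rh_nonneg hε z)
          refine (integral_sq_translate_le hφ z).trans ?_
          have := Dir_nonneg φ
          gcongr
    _ = _ := by rw [integral_const_mul, integral_rh hε, mul_one]

lemma rh_bdd (N : ℕ) : ∃ C, 0 < C ∧ ∀ ε, 0 < ε → ∀ z : Euc N, rh ε z ≤ C * (ε⁻¹) ^ N := by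
  obtain ⟨C, hC0, hC⟩ := T1_bdd
  have := mass_pos N
  refine ⟨(mass N)⁻¹ * (2 * C), by positivity, fun ε hε z => ?_⟩
  have := hC (‖z‖ ^ 2 * (ε⁻¹) ^ 2) (by positivity)
  unfold rh
  calc (mass N)⁻¹ * (ε⁻¹) ^ N * (2 * T1 (‖z‖ ^ 2 * (ε⁻¹) ^ 2))
      ≤ (mass N)⁻¹ * (ε⁻¹) ^ N * (2 * C) := by gcongr
    _ = _ := by ring

/-- Lebesgue differentiation for the mollifier. -/
lemma ae_tendsto_cv_rh (hu : Integrable u) :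
    ∀ᵐ x, Tendsto (fun ε => cv (rh ε) u x) (𝓝[>] 0) (𝓝 (u x)) := by
  obtain ⟨C, hC0, hC⟩ := rh_bdd N
  filter_upwards [(Besicovitch.vitaliFamily volume).ae_tendsto_average_norm_sub
    hu.locallyIntegrable] with x h₀
  have h1 := h₀.comp (Besicovitch.tendsto_filterAt volume x)
  have h2 := tendsto_integral_smul_of_tendsto_average_norm_sub
    (C * (volume : Measure (Euc N)).real (Metric.ball 0 1)) (g := fun ε y => rh ε (x - y)) h1
    (Eventually.of_forall fun _ => hu.integrableOn) ?_ ?_ ?_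
  · refine h2.congr fun ε => ?_
    unfold cv
    refine integral_congr_ae (Eventually.of_forall fun y => ?_)
    simp [mul_comm]
  · refine tendsto_const_nhds.congr' ?_
    filter_upwards [self_mem_nhdsWithin] with ε hε
    rw [integral_sub_left_eq_self (fun y => rh ε y), integral_rh hε]
  · filter_upwards [self_mem_nhdsWithin] with ε hε y hy
    rw [mem_closedBall_iff_norm']
    by_contra h
    exact hy (rh_zero hε (not_le.1 h).le)
  · filter_upwards [self_mem_nhdsWithin] with ε (hε : 0 < ε) y
    rw [abs_of_nonneg (rh_nonneg hε _), Measure.addHaar_real_closedBall _ _ hε.le]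
    refine (hC ε hε _).trans (le_of_eq ?_)
    have : 0 < (volume : Measure (Euc N)).real (Metric.ball 0 1) :=
      ENNReal.toReal_pos (Metric.measure_ball_pos _ _ one_pos).ne' measure_ball_lt_top.ne
    simp
    field_simp
end

section
variable {α : Type*} [MeasurableSpace α] {μ : Measure α} {f g h : α → ℝ}

lemma MemLp.integrable_mul_two (hf : MemLp f 2 μ) (hg : MemLp g 2 μ) :
    Integrable (fun x => f x * g x) μ := MemLp.integrable_mul (p := 2) (q := 2) hf hg

lemma sq_integral_mul_le_mul (hf : MemLp f 2 μ) (hg : MemLp g 2 μ) :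
    (∫ x, f x * g x ∂μ) ^ 2 ≤ (∫ x, f x ^ 2 ∂μ) * ∫ x, g x ^ 2 ∂μ := by
  have hfg := MemLp.integrable_mul_two hf hg
  have h1 : ∀ t : ℝ, 0 ≤ (∫ x, g x ^ 2 ∂μ) * (t * t) + (2 * ∫ x, f x * g x ∂μ) * t +
      ∫ x, f x ^ 2 ∂μ := by
    intro t
    have : 0 ≤ ∫ x, (f x + t * g x) ^ 2 ∂μ := integral_nonneg fun x => sq_nonneg _
    have e : ∀ x, (f x + t * g x) ^ 2 = f x ^ 2 + (2 * t * (f x * g x) + t ^ 2 * g x ^ 2) := by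
      intro x; ring
    simp_rw [e] at this
    have i1 : Integrable (fun x => 2 * t * (f x * g x)) μ := hfg.const_mul _
    have i2 : Integrable (fun x => t ^ 2 * g x ^ 2) μ := hg.integrable_sq.const_mul _
    rw [integral_add hf.integrable_sq 
      (g := fun x => 2 * t * (f x * g x) + t ^ 2 * g x ^ 2) (i1.add i2), integral_add i1 i2,
    integral_const_mul,
      integral_const_mul] at this
    nlinarith
  have := discrim_le_zero h1
  unfold discrim at this
  nlinarith

lemma abs_integral_mul_le (hf : MemLp f 2 μ) (hg : MemLp g 2 μ) :
    |∫ x, f x * g x ∂μ| ≤ √(∫ x, f x ^ 2 ∂μ) * √(∫ x, g x ^ 2 ∂μ) := by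
  rw [← Real.sqrt_mul (integral_nonneg fun x => sq_nonneg _)]
  exact Real.abs_le_sqrt (sq_integral_mul_le_mul hf hg)

lemma integral_sub_sq_le (hf : MemLp f 2 μ) (hg : MemLp g 2 μ) (hh : MemLp h 2 μ) :
    ∫ x, (f x - h x) ^ 2 ∂μ ≤ 2 * ∫ x, (f x - g x) ^ 2 ∂μ + 2 * ∫ x, (g x - h x) ^ 2 ∂μ := by
  rw [← integral_const_mul, ← integral_const_mul, ← integral_add]
  · refine integral_mono (hf.sub hh).integrable_sq ?_ fun x => ?_
    · exact ((hf.sub hg).integrable_sq.const_mul 2).add ((hg.sub hh).integrable_sq.const_mul 2)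
    · simp only
      nlinarith [sq_nonneg (f x - g x - (g x - h x))]
  · exact (hf.sub hg).integrable_sq.const_mul 2
  · exact (hg.sub hh).integrable_sq.const_mul 2

lemma eLpNorm_two_eq (hf : MemLp f 2 μ) :
    eLpNorm f 2 μ = ENNReal.ofReal (√(∫ x, f x ^ 2 ∂μ)) := by
  rw [hf.eLpNorm_eq_integral_rpow_norm (by simp) (by simp)]
  congr 1
  rw [Real.sqrt_eq_rpow]
  simp

lemma exists_subseq_tendsto_ae {F : ℕ → α → ℝ} (hf : MemLp f 2 μ) (hF : ∀ n, MemLp (F n) 2 μ)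
    (hl : Tendsto (fun n => ∫ x, (f x - F n x) ^ 2 ∂μ) atTop (𝓝 0)) :
    ∃ ns : ℕ → ℕ, StrictMono ns ∧ ∀ᵐ x ∂μ, Tendsto (fun i => F (ns i) x) atTop (𝓝 (f x)) := by
  refine TendstoInMeasure.exists_seq_tendsto_ae (tendstoInMeasure_of_tendsto_eLpNorm (p := 2)
    (by simp) (fun n => (hF n).1) hf.1 ?_)
  have : ∀ n, eLpNorm (F n - f) 2 μ = ENNReal.ofReal (√(∫ x, (f x - F n x) ^ 2 ∂μ)) := by
    intro n
    rw [eLpNorm_sub_comm, eLpNorm_two_eq (hf.sub (hF n))]; rfl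
  simp_rw [this]
  have h2 := ENNReal.tendsto_ofReal ((Real.continuous_sqrt.tendsto 0).comp hl)
  simpa using h2
end

section
variable {N : ℕ} {u φ ψ : Euc N → ℝ} {R K : ℝ}

lemma Tst.memLp (h : Tst φ) (q : ENNReal) : MemLp φ q volume :=
  h.continuous.memLp_of_hasCompactSupport h.2

/-- `u` is an `L²` limit of test functions supported in the ball of radius `R`, with Dirichlet
integral asymptotically at most `K`. -/
def En (R : ℝ) (u : Euc N → ℝ) (K : ℝ) : Prop :=
  MemLp u 2 volume ∧ ∀ ε : ℝ, 0 < ε → ∃ φ : Euc N → ℝ, Tst φ ∧ (∀ x, R < ‖x‖ → φ x = 0) ∧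
    ∫ x, (u x - φ x) ^ 2 < ε ∧ Dir φ < K + ε

lemma En.of_Tst (h : Tst φ) (hR : ∀ x, R < ‖x‖ → φ x = 0) : En R φ (Dir φ) :=
  ⟨h.memLp 2, fun ε hε => ⟨φ, h, hR, by simpa using hε, by linarith⟩⟩

lemma En.nonneg (h : En R u K) : 0 ≤ K := by
  refine le_of_forall_pos_lt_add fun ε hε => ?_
  obtain ⟨φ, _, _, _, h4⟩ := h.2 ε hε
  exact (Dir_nonneg φ).trans_lt h4

lemma En.lim (hu : MemLp u 2 volume) (h : ∀ δ : ℝ, 0 < δ → ∃ u' K', En R u' K' ∧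
    ∫ x, (u x - u' x) ^ 2 < δ ∧ K' < K + δ) : En R u K := by
  refine ⟨hu, fun ε hε => ?_⟩
  obtain ⟨u', K', h1, h2, h3⟩ := h (ε / 4) (by positivity)
  obtain ⟨φ, h4, h5, h6, h7⟩ := h1.2 (ε / 4) (by positivity)
  refine ⟨φ, h4, h5, ?_, by linarith⟩
  have := integral_sub_sq_le hu h1.1 (h4.memLp 2)
  linarith

lemma Dir_const_mul (h : Tst φ) (t : ℝ) : Dir (fun x => t * φ x) = t ^ 2 * Dir φ := by
  unfold Dir
  rw [Finset.mul_sum]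
  refine Finset.sum_congr rfl fun i _ => ?_
  rw [← integral_const_mul]
  refine integral_congr_ae (Eventually.of_forall fun x => ?_)
  simp only [pd]
  rw [fderiv_const_mul (h.differentiable x)]; simp; ring

lemma En.const_mul (h : En R u K) (t : ℝ) : En R (fun x => t * u x) (t ^ 2 * K) := by
  refine En.lim (h.1.const_mul t) fun δ hδ => ?_
  obtain ⟨φ, h1, h2, h3, h4⟩ := h.2 (δ / (t ^ 2 + 1)) (by positivity)
  refine ⟨fun x => t * φ x, _, En.of_Tst (h1.const_mul t) (fun x hx => by simp [h2 x hx]), ?_, ?_⟩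
  · have : ∀ x, (t * u x - t * φ x) ^ 2 = t ^ 2 * (u x - φ x) ^ 2 := fun x => by ring
    simp_rw [this]
    rw [integral_const_mul]
    rw [lt_div_iff₀ (by positivity)] at h3
    have : 0 ≤ ∫ x, (u x - φ x) ^ 2 := integral_nonneg fun x => sq_nonneg _
    rcases eq_or_ne (∫ x, (u x - φ x) ^ 2) 0 with h0 | h0
    · rw [h0]; simpa
    · have : 0 < ∫ x, (u x - φ x) ^ 2 := lt_of_le_of_ne this h0.symm
      nlinarith
  · rw [Dir_const_mul h1]
    have h5 : δ / (t ^ 2 + 1) * (t ^ 2 + 1) = δ := by field_simp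
    have h6 : 0 < δ / (t ^ 2 + 1) := by positivity
    nlinarith [sq_nonneg t]

lemma integral_pd_mul_pd (h : Tst φ) (h' : Tst ψ) :
    ∑ i, ∫ x, pd i φ x * pd i ψ x = - ∫ x, φ x * lap ψ x := by
  have : ∀ x, φ x * lap ψ x = ∑ i, φ x * pd i (pd i ψ) x := by
    intro x; rw [lap_eq_sum_pd, Finset.mul_sum]
  simp_rw [this]
  rw [integral_finsetSum]
  · rw [← Finset.sum_neg_distrib]
    refine Finset.sum_congr rfl fun i _ => ?_
    rw [integral_mul_pd (h.1.of_le (by simp)) ((h'.pderiv i).1.of_le (by simp)) (Or.inl h.2)]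
    simp
  · intro i _
    exact (h.mul ((h'.pderiv i).pderiv i).1).integrable

lemma Dir_add_smul (h : Tst φ) (h' : Tst ψ) (s : ℝ) :
    Dir (fun x => φ x + s * ψ x) = Dir φ - 2 * s * (∫ x, φ x * lap ψ x) + s ^ 2 * Dir ψ := by
  have e : - (2 * s * (∫ x, φ x * lap ψ x)) = 2 * s * (- ∫ x, φ x * lap ψ x) := by ring
  rw [sub_eq_add_neg, e, ← integral_pd_mul_pd h h']
  unfold Dir
  rw [Finset.mul_sum, Finset.mul_sum, ← Finset.sum_add_distrib, ← Finset.sum_add_distrib]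
  refine Finset.sum_congr rfl fun i _ => ?_
  have h1 := (h.pderiv i).memLp 2
  have h2 := (h'.pderiv i).memLp 2
  have i1 : Integrable (fun x => 2 * s * (pd i φ x * pd i ψ x)) :=
    (MemLp.integrable_mul_two h1 h2).const_mul _
  rw [← integral_const_mul, ← integral_const_mul, ← integral_add h1.integrable_sq i1,
    ← integral_add (f := fun x => pd i φ x ^ 2 + 2 * s * (pd i φ x * pd i ψ x))
      (h1.integrable_sq.add i1)]
  · refine integral_congr_ae (Eventually.of_forall fun x => ?_)
    simp only [pd]
    rw [fderiv_fun_add (h.differentiable x) ((h'.differentiable x).const_mul s),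
      fderiv_const_mul (h'.differentiable x)]
    simp; ring
  · exact h2.integrable_sq.const_mul _

lemma En.add_smul (h : En R u K) (h' : Tst ψ) (hR : ∀ x, R < ‖x‖ → ψ x = 0) (s : ℝ) :
    En R (fun x => u x + s * ψ x) (K - 2 * s * (∫ x, u x * lap ψ x) + s ^ 2 * Dir ψ) := by
  have hm := h'.laplace.memLp 2
  refine En.lim (h.1.add ((h'.memLp 2).const_mul s)) fun δ hδ => ?_
  set A := √(∫ x, lap ψ x ^ 2) with hA
  have hA0 : 0 ≤ A := Real.sqrt_nonneg _
  set e := δ / (2 + 2 * |s| * A) with he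
  have he0 : 0 < e := by positivity
  have hee : e * (2 + 2 * |s| * A) = δ := by rw [he]; field_simp
  have h0 : 0 ≤ |s| * A := by positivity
  obtain ⟨φ, h1, h2, h3, h4⟩ := h.2 (min e (e ^ 2)) (by positivity)
  refine ⟨fun x => φ x + s * ψ x, _, En.of_Tst (h1.add (h'.const_mul s))
    (fun x hx => by simp [h2 x hx, hR x hx]), ?_, ?_⟩
  · have : ∀ x, (u x + s * ψ x - (φ x + s * ψ x)) ^ 2 = (u x - φ x) ^ 2 := fun x => by ring
    simp_rw [this]
    have := h3.trans_le (min_le_left _ _)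
    nlinarith
  · rw [Dir_add_smul h1 h']
    have h5 : |∫ x, (u x - φ x) * lap ψ x| ≤ e * A := by
      refine (abs_integral_mul_le (h.1.sub (h1.memLp 2)) hm).trans ?_
      refine mul_le_mul_of_nonneg_right ?_ hA0
      refine Real.sqrt_le_iff.2 ⟨he0.le, (h3.trans_le (min_le_right _ _)).le⟩
    have h6 : ∫ x, (u x - φ x) * lap ψ x = (∫ x, u x * lap ψ x) - ∫ x, φ x * lap ψ x := by
      simp_rw [sub_mul]
      exact integral_sub (MemLp.integrable_mul_two h.1 hm)
        (MemLp.integrable_mul_two (h1.memLp 2) hm)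
    rw [h6] at h5
    have h7 : |s * ((∫ x, u x * lap ψ x) - ∫ x, φ x * lap ψ x)| ≤ |s| * (e * A) := by
      rw [abs_mul]; gcongr
    have h8 := (abs_le.1 h7).2
    have h9 := h4.trans_le (add_le_add_right (min_le_left e (e ^ 2)) K)
    nlinarith
end

/-- A smooth approximation of the positive part. -/
def smoothPos (δ t : ℝ) : ℝ := (√(t ^ 2 + δ ^ 2) - δ + t) / 2

lemma contDiff_smoothPos {δ : ℝ} (hδ : 0 < δ) : ContDiff ℝ ∞ (smoothPos δ) := by
  unfold smoothPos
  refine ContDiff.div_const (ContDiff.add (ContDiff.sub (ContDiff.sqrt ?_ ?_) contDiff_const)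
    contDiff_id) 2
  · exact (contDiff_id.pow 2).add contDiff_const
  · intro x; positivity

lemma hasDerivAt_smoothPos {δ : ℝ} (hδ : 0 < δ) (t : ℝ) :
    HasDerivAt (smoothPos δ) ((t / √(t ^ 2 + δ ^ 2) + 1) / 2) t := by
  have h1 : HasDerivAt (fun t : ℝ => t ^ 2 + δ ^ 2) (2 * t) t := by
    simpa using ((hasDerivAt_id t).pow 2).add_const (δ ^ 2)
  have h2 := h1.sqrt (by positivity)
  have h3 := (((h2.sub_const δ).add (hasDerivAt_id t)).div_const 2)
  refine h3.congr_deriv ?_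
  have : 0 < √(t ^ 2 + δ ^ 2) := Real.sqrt_pos.2 (by positivity)
  field_simp

lemma smoothPos_deriv_sq_le (δ t : ℝ) :
    ((t / √(t ^ 2 + δ ^ 2) + 1) / 2) ^ 2 ≤ 1 := by
  have h1 : |t / √(t ^ 2 + δ ^ 2)| ≤ 1 := by
    rw [abs_div, abs_of_nonneg (Real.sqrt_nonneg _)]
    refine div_le_one_of_le₀ ?_ (Real.sqrt_nonneg _)
    refine Real.abs_le_sqrt ?_
    nlinarith
  obtain ⟨h2, h3⟩ := abs_le.1 h1
  nlinarith

lemma abs_max_sub_smoothPos_le {δ : ℝ} (hδ : 0 < δ) (t : ℝ) :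
    |max t 0 - smoothPos δ t| ≤ δ := by
  have h1 : |t| ≤ √(t ^ 2 + δ ^ 2) := Real.abs_le_sqrt (by nlinarith)
  have h2 : √(t ^ 2 + δ ^ 2) ≤ |t| + δ := by
    refine Real.sqrt_le_iff.2 ⟨by positivity, ?_⟩
    have := abs_nonneg t
    nlinarith [sq_abs t]
  have h3 : max t 0 = (|t| + t) / 2 := by
    rcases le_total 0 t with h | h
    · rw [max_eq_left h, abs_of_nonneg h]; ring
    · rw [max_eq_right h, abs_of_nonpos h]; ring
  rw [h3, smoothPos, abs_le]
  constructor <;> linarith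

lemma smoothPos_zero {δ : ℝ} (hδ : 0 < δ) : smoothPos δ 0 = 0 := by
  simp [smoothPos, Real.sqrt_sq hδ.le]

section
variable {N : ℕ} {u φ ψ : Euc N → ℝ} {R K : ℝ}

lemma Tst.smoothPos_comp (h : Tst φ) {δ : ℝ} (hδ : 0 < δ) : Tst (fun x => smoothPos δ (φ x)) :=
  ⟨(contDiff_smoothPos hδ).comp h.1, h.2.comp_left (g := smoothPos δ) (smoothPos_zero hδ)⟩

lemma Dir_smoothPos_le (h : Tst φ) {δ : ℝ} (hδ : 0 < δ) :
    Dir (fun x => smoothPos δ (φ x)) ≤ Dir φ := by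
  refine Finset.sum_le_sum fun i _ => ?_
  refine integral_mono (((h.smoothPos_comp hδ).pderiv i).memLp 2).integrable_sq
    ((h.pderiv i).memLp 2).integrable_sq fun x => ?_
  have h1 := (hasDerivAt_smoothPos hδ (φ x)).comp_hasFDerivAt x (h.differentiable x).hasFDerivAt
  have h2 : pd i (fun x => smoothPos δ (φ x)) x =
      ((φ x / √(φ x ^ 2 + δ ^ 2) + 1) / 2) * pd i φ x := by
    unfold pd
    erw [h1.fderiv]
    simp
  simp only
  rw [h2, mul_pow]
  exact mul_le_of_le_one_left (sq_nonneg _) (smoothPos_deriv_sq_le δ _)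

lemma _root_.MeasureTheory.MemLp.max_zero {α : Type*} [MeasurableSpace α]
    {μ : Measure α} {f : α → ℝ}
    (hf : MemLp f 2 μ) : MemLp (fun x => max (f x) 0) 2 μ := hf.pos_part

lemma max_sub_max_sq_le (a b : ℝ) : (max a 0 - max b 0) ^ 2 ≤ (a - b) ^ 2 :=
  sq_le_sq.2 (abs_max_sub_max_le_abs a b 0)

lemma En.pos_part (h : En R u K) : En R (fun x => max (u x) 0) K := by
  refine En.lim h.1.max_zero fun δ hδ => ?_
  obtain ⟨φ, h1, h2, h3, h4⟩ := h.2 (δ / 4) (by positivity)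
  set V := (volume : Measure (Euc N)).real (Metric.closedBall 0 R) with hV
  set e := min 1 (δ / (4 * (V + 1))) with he
  have hV0 : 0 ≤ V := measureReal_nonneg
  have he0 : 0 < e := by positivity
  refine ⟨fun x => smoothPos e (φ x), _, En.of_Tst (h1.smoothPos_comp he0)
    (fun x hx => by simp [h2 x hx, smoothPos_zero he0]), ?_, ?_⟩
  · have i1 := integral_sub_sq_le h.1.max_zero (h1.memLp 2).max_zero
      ((h1.smoothPos_comp he0).memLp 2)
    have i2 : ∫ x, (max (u x) 0 - max (φ x) 0) ^ 2 ≤ ∫ x, (u x - φ x) ^ 2 :=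
      integral_mono (h.1.max_zero.sub (h1.memLp 2).max_zero).integrable_sq
        (h.1.sub (h1.memLp 2)).integrable_sq fun x => max_sub_max_sq_le _ _
    have i3 : ∫ x, (max (φ x) 0 - smoothPos e (φ x)) ^ 2 ≤ e * V := by
      have : ∫ x, (max (φ x) 0 - smoothPos e (φ x)) ^ 2 ≤
          ∫ x, (Metric.closedBall (0 : Euc N) R).indicator (fun _ => e) x := by
        refine integral_mono ((h1.memLp 2).max_zero.sub
          ((h1.smoothPos_comp he0).memLp 2)).integrable_sq ?_ fun x => ?_
        · exact (integrable_indicator_iff measurableSet_closedBall).2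
            (integrableOn_const measure_closedBall_lt_top.ne)
        · by_cases hx : x ∈ Metric.closedBall (0 : Euc N) R
          · simp only [indicator_of_mem hx]
            have := abs_max_sub_smoothPos_le he0 (φ x)
            have he1 : e ≤ 1 := min_le_left _ _
            rw [← sq_abs]
            nlinarith [abs_nonneg (max (φ x) 0 - smoothPos e (φ x))]
          · simp only [indicator_of_notMem hx]
            rw [mem_closedBall_zero_iff, not_le] at hx
            simp [h2 x hx, smoothPos_zero he0]
      rw [integral_indicator measurableSet_closedBall] at this
      simpa [mul_comm, hV] using this
    have i4 : e * V ≤ δ / 4 := by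
      have : e * (4 * (V + 1)) ≤ δ := by
        have := min_le_right 1 (δ / (4 * (V + 1)))
        rwa [le_div_iff₀ (by positivity), ← he] at this
      nlinarith
    nlinarith
  · have := Dir_smoothPos_le h1 he0
    linarith

lemma dist_toLp_eq {α : Type*} [MeasurableSpace α] {μ : Measure α} {f g : α → ℝ}
    (hf : MemLp f 2 μ) (hg : MemLp g 2 μ) :
    dist (hf.toLp f) (hg.toLp g) = √(∫ x, (f x - g x) ^ 2 ∂μ) := by
  rw [dist_eq_norm, ← MemLp.toLp_sub, Lp.norm_toLp, eLpNorm_two_eq (hf.sub hg),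
    ENNReal.toReal_ofReal (Real.sqrt_nonneg _)]
  rfl
end

section
variable {N : ℕ}

lemma exists_weak_subseq {f : ℕ → Lp ℝ 2 (volume : Measure (Euc N))} {B : ℝ}
    (hf : ∀ n, ‖f n‖ ≤ B) : ∃ ns : ℕ → ℕ, StrictMono ns ∧
      ∀ g : Lp ℝ 2 (volume : Measure (Euc N)), ∃ l : ℝ,
        Tendsto (fun n => inner ℝ (f (ns n)) g) atTop (𝓝 l) := by
  have : Fact ((2 : ENNReal) ≠ ⊤) := ⟨ENNReal.ofNat_ne_top⟩
  have hc := WeakDual.isSeqCompact_closedBall ℝ (Lp ℝ 2 (volume : Measure (Euc N))) 0 B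
  obtain ⟨L, -, ns, hns, hL⟩ := hc
    (x := fun n => StrongDual.toWeakDual (InnerProductSpace.toDual ℝ _ (f n)))
    (fun n => by
      rw [mem_preimage, mem_closedBall_zero_iff]
      exact ((InnerProductSpace.toDual ℝ (Lp ℝ 2 (volume : Measure (Euc N)))).norm_map (f n)).trans_le
        (hf n))
  refine ⟨ns, hns, fun g => ⟨L g, ?_⟩⟩
  have := (tendsto_iff_forall_eval_tendsto_topDualPairing.1 hL) g
  exact this

lemma MemLp.inner_toLp {α : Type*} [MeasurableSpace α] {μ : Measure α} {f g : α → ℝ}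
    (hf : MemLp f 2 μ) (hg : MemLp g 2 μ) :
    inner ℝ (hf.toLp f) (hg.toLp g) = ∫ x, f x * g x ∂μ := by
  rw [L2.inner_def]
  refine integral_congr_ae ?_
  filter_upwards [hf.coeFn_toLp, hg.coeFn_toLp] with x h1 h2
  rw [h1, h2]
  simp [mul_comm]

lemma integral_abs_le_of_support {u : Euc N → ℝ} {R : ℝ} (hu : MemLp u 2 volume)
    (hR : ∀ x, R < ‖x‖ → u x = 0) :
    ∫ x, |u x| ≤ √((volume : Measure (Euc N)).real (Metric.closedBall 0 R)) * √(∫ x, u x ^ 2) := by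
  have h1 : MemLp ((Metric.closedBall (0 : Euc N) R).indicator (fun _ => (1 : ℝ))) 2 volume :=
    memLp_indicator_const 2 measurableSet_closedBall 1 (Or.inr measure_closedBall_lt_top.ne)
  have h2 := abs_integral_mul_le h1 hu.abs
  have h3 : ∀ x,
      (Metric.closedBall (0 : Euc N) R).indicator (fun _ => (1 : ℝ)) x * |u x| = |u x| := by
    intro x
    by_cases hx : x ∈ Metric.closedBall (0 : Euc N) R
    · simp [hx]
    · rw [mem_closedBall_zero_iff, not_le] at hx
      simp [hR x hx]
  have h4 : ∀ x, (Metric.closedBall (0 : Euc N) R).indicator (fun _ => (1 : ℝ)) x ^ 2 =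
      (Metric.closedBall (0 : Euc N) R).indicator (fun _ => (1 : ℝ)) x := by
    intro x
    by_cases hx : x ∈ Metric.closedBall (0 : Euc N) R <;> simp [hx]
  have h5 : ∀ x, (|u| : Euc N → ℝ) x = |u x| := fun x => rfl
  simp only [h5, h3, h4, sq_abs] at h2
  rw [integral_indicator measurableSet_closedBall] at h2
  simpa using (le_abs_self _).trans h2

lemma Tst.exists_subseq {φ : ℕ → Euc N → ℝ} {R K B : ℝ} (hφ : ∀ n, Tst (φ n))
    (hR : ∀ n x, R < ‖x‖ → φ n x = 0) (hK : ∀ n, Dir (φ n) ≤ K) (hB : ∀ n, ∫ x, φ n x ^ 2 ≤ B) :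
    ∃ u, MemLp u 2 (volume : Measure (Euc N)) ∧ ∃ ns : ℕ → ℕ, StrictMono ns ∧
      Tendsto (fun n => ∫ x, (u x - φ (ns n) x) ^ 2) atTop (𝓝 0) := by
  have hm : ∀ n, MemLp (φ n) 2 volume := fun n => (hφ n).memLp 2
  have hB0 : 0 ≤ B := (integral_nonneg fun x => sq_nonneg _).trans (hB 0)
  have hK0 : 0 ≤ K := (Dir_nonneg _).trans (hK 0)
  obtain ⟨ns, hns, hl⟩ := exists_weak_subseq (f := fun n => (hm n).toLp (φ n)) (B := √B)
    (fun n => by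
      rw [Lp.norm_toLp, eLpNorm_two_eq (hm n), ENNReal.toReal_ofReal (Real.sqrt_nonneg _)]
      exact Real.sqrt_le_sqrt (hB n))
  set V := (volume : Measure (Euc N)).real (Metric.closedBall 0 R) with hV
  have hL1 : ∀ n, ∫ x, |φ n x| ≤ √V * √B := fun n =>
    (integral_abs_le_of_support (hm n) (hR n)).trans
      (mul_le_mul_of_nonneg_left (Real.sqrt_le_sqrt (hB n)) (Real.sqrt_nonneg _))
  -- the mollified functions converge in the mean
  have hmol : ∀ ε : ℝ, 0 < ε → ∃ w, MemLp w 2 (volume : Measure (Euc N)) ∧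
      Tendsto (fun n => ∫ x, (cv (rh ε) (φ (ns n)) x - w x) ^ 2) atTop (𝓝 0) := by
    intro ε hε
    have hkt : ∀ x, Tst (fun y : Euc N => rh ε (x - y)) := fun x => (Tst_rh hε).reflect x
    have hpt : ∀ x, ∃ l : ℝ, Tendsto (fun n => cv (rh ε) (φ (ns n)) x) atTop (𝓝 l) := by
      intro x
      obtain ⟨l, hl⟩ := hl (((hkt x).memLp 2).toLp _)
      refine ⟨l, hl.congr fun n => ?_⟩
      rw [MemLp.inner_toLp]
      rfl
    choose w hw using hpt
    obtain ⟨C, hC0, hC⟩ := (Tst_rh (N := N) hε).bdd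
    have hcb : ∀ n x, |cv (rh ε) (φ n) x| ≤ C * (√V * √B) := fun n x =>
      (abs_cv_le hC (hφ n).integrable x).trans (mul_le_mul_of_nonneg_left (hL1 n) hC0)
    have hwb : ∀ x, |w x| ≤ C * (√V * √B) := fun x =>
      le_of_tendsto (hw x).abs (Eventually.of_forall fun n => hcb _ x)
    have hc0 : ∀ n x, R + ε ≤ ‖x‖ → cv (rh ε) (φ n) x = 0 := fun n x hx =>
      cv_zero_of_dist (fun z hz => rh_zero hε hz) (hR n) hx
    have hw0 : ∀ x, R + ε ≤ ‖x‖ → w x = 0 := fun x hx =>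
      tendsto_nhds_unique (hw x) (tendsto_const_nhds.congr fun n => (hc0 _ x hx).symm)
    have hcm : ∀ n, Tst (cv (rh ε) (φ n)) := fun n =>
      Tst.cv_rh (hφ n).integrable hε (hR n)
    have hwm : AEStronglyMeasurable w (volume : Measure (Euc N)) :=
      aestronglyMeasurable_of_tendsto_ae atTop
        (fun n => (hcm (ns n)).continuous.aestronglyMeasurable) (Eventually.of_forall hw)
    set D := C * (√V * √B) with hD
    have hwL : MemLp w 2 (volume : Measure (Euc N)) := by
      refine (memLp_indicator_const (μ := (volume : Measure (Euc N))) 2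
        (measurableSet_closedBall (x := 0) (ε := R + ε)) D
        (Or.inr measure_closedBall_lt_top.ne)).mono hwm (Eventually.of_forall fun x => ?_)
      by_cases hx : x ∈ Metric.closedBall (0 : Euc N) (R + ε)
      · rw [indicator_of_mem hx]
        exact (hwb x).trans (le_abs_self _)
      · rw [mem_closedBall_zero_iff, not_le] at hx
        simp [hw0 x hx.le]
    refine ⟨w, hwL, ?_⟩
    have := tendsto_integral_of_dominated_convergence
      (μ := (volume : Measure (Euc N)))
      (F := fun n x => (cv (rh ε) (φ (ns n)) x - w x) ^ 2) (f := fun _ => 0)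
      ((Metric.closedBall (0 : Euc N) (R + ε)).indicator (fun _ => (2 * D) ^ 2))
      (fun n => (((hcm (ns n)).continuous.aestronglyMeasurable).sub hwm).pow 2)
      ((integrable_indicator_iff measurableSet_closedBall).2
            (integrableOn_const measure_closedBall_lt_top.ne))
      (fun n => Eventually.of_forall fun x => ?_) (Eventually.of_forall fun x => ?_)
    · simpa using this
    · by_cases hx : x ∈ Metric.closedBall (0 : Euc N) (R + ε)
      · rw [indicator_of_mem hx, Real.norm_eq_abs, abs_pow]
        refine pow_le_pow_left₀ (abs_nonneg _) ?_ 2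
        have := abs_sub (cv (rh ε) (φ (ns n)) x) (w x)
        linarith [hcb (ns n) x, hwb x]
      · rw [mem_closedBall_zero_iff, not_le] at hx
        simp only [hw0 x hx.le, hc0 _ x hx.le, indicator_of_notMem, mem_closedBall_zero_iff, not_le,
          hx]
        simp
    · have := ((hw x).sub_const (w x)).pow 2
      simpa using this
  have hcau : CauchySeq fun n => (hm (ns n)).toLp (φ (ns n)) := by
    refine Metric.cauchySeq_iff'.2 fun δ hδ => ?_
    have hK1 : 0 ≤ √K := Real.sqrt_nonneg K
    obtain ⟨w, hw, hlim⟩ := hmol (δ / (8 * (√K + 1))) (by positivity)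
    set ε := δ / (8 * (√K + 1)) with hε
    have hε0 : 0 < ε := by positivity
    have hεK : ε ^ 2 * K ≤ δ ^ 2 / 64 := by
      have h1 : ε * (8 * (√K + 1)) = δ := by rw [hε]; field_simp
      have h2 : ε * √K ≤ δ / 8 := by nlinarith
      have h3 : ε ^ 2 * K = (ε * √K) ^ 2 := by rw [mul_pow, Real.sq_sqrt hK0]
      rw [h3]
      nlinarith [mul_nonneg hε0.le hK1]
    obtain ⟨n₀, hn₀⟩ := eventually_atTop.1 (hlim.eventually (gt_mem_nhds
      (show (0 : ℝ) < δ ^ 2 / 64 by positivity)))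
    have hcl : ∀ n, n₀ ≤ n → ∫ x, (φ (ns n) x - w x) ^ 2 ≤ δ ^ 2 / 16 := by
      intro n hn
      have i1 := integral_sub_sq_le (hm (ns n))
        ((Tst.cv_rh (hφ (ns n)).integrable hε0 (hR (ns n))).memLp 2) hw
      have i2 := integral_sub_cv_sq_le (hφ (ns n)) hε0
      have i3 := mul_le_mul_of_nonneg_left (hK (ns n)) (sq_nonneg ε)
      linarith [hn₀ n hn]
    refine ⟨n₀, fun n hn => ?_⟩
    rw [dist_toLp_eq, Real.sqrt_lt' hδ]
    have i1 := integral_sub_sq_le (hm (ns n)) hw (hm (ns n₀))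
    have i2 : ∫ x, (w x - φ (ns n₀) x) ^ 2 = ∫ x, (φ (ns n₀) x - w x) ^ 2 := by
      simp only [sub_sq_comm]
    have := hcl n hn
    have := hcl n₀ le_rfl
    nlinarith
  obtain ⟨U, hU⟩ := cauchySeq_tendsto_of_complete hcau
  refine ⟨U, Lp.memLp U, ns, hns, ?_⟩
  have h1 := (tendsto_iff_dist_tendsto_zero.1 hU).pow 2
  rw [zero_pow two_ne_zero] at h1
  refine h1.congr fun n => ?_
  rw [dist_comm]
  conv_lhs => rw [← Lp.toLp_coeFn U (Lp.memLp U)]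
  rw [dist_toLp_eq, Real.sq_sqrt (integral_nonneg fun x => sq_nonneg _)]

lemma En.exists_subseq {u : ℕ → Euc N → ℝ} {R K B : ℝ} {K' : ℕ → ℝ} (hu : ∀ n, En R (u n) (K' n))
    (hK : ∀ n, K' n ≤ K) (hB : ∀ n, ∫ x, u n x ^ 2 ≤ B) :
    ∃ v, MemLp v 2 (volume : Measure (Euc N)) ∧ ∃ ns : ℕ → ℕ, StrictMono ns ∧
      Tendsto (fun n => ∫ x, (v x - u (ns n) x) ^ 2) atTop (𝓝 0) := by
  have hpos : ∀ n : ℕ, 0 < 1 / ((n : ℝ) + 1) := fun n => Nat.one_div_pos_of_nat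
  have hle : ∀ n : ℕ, 1 / ((n : ℝ) + 1) ≤ 1 := fun n => by
    rw [div_le_one (by positivity)]; linarith [(Nat.cast_nonneg n : (0 : ℝ) ≤ n)]
  choose φ h1 h2 h3 h4 using fun n : ℕ => (hu n).2 (1 / ((n : ℝ) + 1)) (hpos n)
  have hm : ∀ n, MemLp (φ n) 2 volume := fun n => (h1 n).memLp 2
  obtain ⟨v, hv, ns, hns, hl⟩ := Tst.exists_subseq (K := K + 1) (B := 2 * B + 2) h1 h2
    (fun n => by linarith [h4 n, hle n, hK n]) (fun n => by
      have := integral_sub_sq_le (hm n) (hu n).1 (MemLp.zero' (p := 2))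
      have h5 : ∫ x, (φ n x - u n x) ^ 2 = ∫ x, (u n x - φ n x) ^ 2 := by simp only [sub_sq_comm]
      simp only [sub_zero] at this
      linarith [hB n, h3 n, hle n])
  refine ⟨v, hv, ns, hns, ?_⟩
  have hl2 := (hl.const_mul 2).add ((tendsto_one_div_add_atTop_nhds_zero_nat.comp
    hns.tendsto_atTop).const_mul (2 : ℝ))
  simp only [mul_zero, add_zero] at hl2
  refine squeeze_zero (fun n => integral_nonneg fun x => sq_nonneg _) (fun n => ?_) hl2
  have := integral_sub_sq_le hv (hm (ns n)) (hu (ns n)).1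
  have h5 : ∫ x, (φ (ns n) x - u (ns n) x) ^ 2 = ∫ x, (u (ns n) x - φ (ns n) x) ^ 2 := by
    simp only [sub_sq_comm]
  have h6 := h3 (ns n)
  simp only [Function.comp_apply]
  linarith
end

section
variable {N : ℕ}
open scoped NNReal

lemma norm_fderiv_le {φ : Euc N → ℝ} (x : Euc N) :
    ‖fderiv ℝ φ x‖ ≤ √(∑ i, pd i φ x ^ 2) := by
  refine ContinuousLinearMap.opNorm_le_bound _ (Real.sqrt_nonneg _) fun v => ?_
  rw [Real.norm_eq_abs]
  refine Real.abs_le_sqrt (sq_fderiv_apply_le φ x v) |>.trans ?_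
  rw [Real.sqrt_mul (sq_nonneg _), Real.sqrt_sq (norm_nonneg _), mul_comm]

lemma Tst.eLpNorm_fderiv_le {φ : Euc N → ℝ} (h : Tst φ) :
    eLpNorm (fderiv ℝ φ) 2 volume ≤ ENNReal.ofReal √(Dir φ) := by
  have hc := h.sum_pd_sq
  have h1 : MemLp (fun x => √(∑ i, pd i φ x ^ 2)) 2 volume :=
    (Real.continuous_sqrt.comp hc.1).memLp_of_hasCompactSupport
      (hc.2.comp_left (g := Real.sqrt) Real.sqrt_zero)
  have h2 : ∫ x, √(∑ i, pd i φ x ^ 2) ^ 2 = Dir φ := by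
    rw [← h.integral_sum_pd_sq]
    exact integral_congr_ae (Eventually.of_forall fun x =>
      Real.sq_sqrt (Finset.sum_nonneg fun i _ => sq_nonneg _))
  rw [← h2, ← eLpNorm_two_eq h1]
  exact eLpNorm_mono_real fun x => norm_fderiv_le x

lemma Tst.sobolev (hN : 2 ≤ N) {q : ℝ≥0} (hq : 2 ≤ q)
    (hqN : (1 : ℝ) / 2 - 1 / N < 1 / q) (R : ℝ) :
    ∃ C : ℝ≥0, 0 < C ∧ ∀ φ : Euc N → ℝ, Tst φ → (∀ x, R < ‖x‖ → φ x = 0) →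
      eLpNorm φ q volume ≤ C * ENNReal.ofReal √(Dir φ) := by
  have hN0 : (0 : ℝ) < N := by positivity
  have hN2 : (2 : ℝ) ≤ N := by exact_mod_cast hN
  have hq0 : (0 : ℝ) < q := by have : (2 : ℝ) ≤ q := by exact_mod_cast hq
                               linarith
  set m : ℝ := min 1 (1 / q + 1 / N) with hm
  have hm0 : 0 < m := by positivity
  have hm2 : 1 / 2 ≤ m := le_min (by norm_num) (by linarith)
  set P : ℝ≥0 := (m⁻¹).toNNReal with hP
  have hPc : (P : ℝ) = m⁻¹ := Real.coe_toNNReal _ (by positivity)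
  have hP1 : 1 ≤ P := by
    rw [← NNReal.coe_le_coe, hPc]
    exact one_le_inv_iff₀.2 ⟨hm0, min_le_left _ _⟩
  have hP2 : P ≤ 2 := by
    rw [← NNReal.coe_le_coe, hPc]
    exact inv_le_of_inv_le₀ (by norm_num) (by norm_num at hm2 ⊢; linarith)
  have hPN : P < N := by
    rw [← NNReal.coe_lt_coe, hPc]
    have : (1 : ℝ) / N < m := by
      refine lt_min ?_ (by have : 0 < (1 : ℝ) / q := by positivity
                           linarith)
      rw [div_lt_one hN0]; linarith
    have h1 : m⁻¹ < N := by
      rw [inv_lt_comm₀ hm0 hN0]; simpa using this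
    simpa using h1
  set s : Set (Euc N) := Metric.closedBall 0 R with hs
  set A := eLpNormLESNormFDerivOfLeConst ℝ (volume : Measure (Euc N)) s P q with hA
  set B := (volume s) ^ (1 / (P : ENNReal).toReal - 1 / (2 : ENNReal).toReal) with hB
  have hBt : B ≠ ⊤ := by
    refine ENNReal.rpow_ne_top_of_nonneg ?_ measure_closedBall_lt_top.ne
    have : (P : ℝ) ≤ 2 := by exact_mod_cast hP2
    have h1 : (1 : ℝ) ≤ P := by exact_mod_cast hP1
    simp only [ENNReal.coe_toReal, ENNReal.toReal_ofNat, sub_nonneg]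
    exact one_div_le_one_div_of_le (by linarith) this
  refine ⟨A * B.toNNReal + 1, by positivity, fun φ hφ hR => ?_⟩
  have hsup : ∀ x, x ∉ s → φ x = 0 := fun x hx => hR x (by
    rwa [hs, mem_closedBall_zero_iff, not_le] at hx)
  have h1 := eLpNorm_le_eLpNorm_fderiv_of_le (volume : Measure (Euc N)) (u := φ) (s := s)
    (p := P) (q := q) (hφ.1.of_le (by exact_mod_cast le_top))
    (fun x hx => by by_contra h; exact hx (hsup x h)) hP1
    (by rw [finrank_euclideanSpace_fin]; exact hPN)
    (by
      rw [finrank_euclideanSpace_fin, NNReal.coe_inv, hPc, inv_inv]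
      have := min_le_right 1 (1 / (q : ℝ) + 1 / N)
      simp only [one_div] at this hm
      linarith) Metric.isBounded_closedBall
  have hfs : Function.support (fderiv ℝ φ) ⊆ s := by
    refine (support_fderiv_subset ℝ).trans ?_
    refine closure_minimal ?_ Metric.isClosed_closedBall
    intro x hx; by_contra h; exact hx (hsup x h)
  have h2 : eLpNorm (fderiv ℝ φ) P volume ≤ eLpNorm (fderiv ℝ φ) 2 volume * B := by
    rw [← eLpNorm_restrict_eq_of_support_subset (f := fderiv ℝ φ) (p := P) hfs,
      ← eLpNorm_restrict_eq_of_support_subset (f := fderiv ℝ φ) (p := 2) hfs]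
    have := eLpNorm_le_eLpNorm_mul_rpow_measure_univ (μ := volume.restrict s) (p := P) (q := 2)
      (f := fderiv ℝ φ) (by exact_mod_cast hP2)
      (hφ.1.continuous_fderiv (by simp)).aestronglyMeasurable
    simpa [hB] using this
  calc eLpNorm φ q volume ≤ A * eLpNorm (fderiv ℝ φ) P volume := h1
    _ ≤ A * (ENNReal.ofReal √(Dir φ) * B) := by
      gcongr
      refine h2.trans ?_
      gcongr
      exact hφ.eLpNorm_fderiv_le
    _ = (A * B.toNNReal : ℝ≥0) * ENNReal.ofReal √(Dir φ) := by
      rw [ENNReal.coe_mul, ENNReal.coe_toNNReal hBt]; ring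
    _ ≤ _ := by gcongr; exact le_self_add

lemma En.sobolev (hN : 2 ≤ N) {q : ℝ} (hq : 2 ≤ q) (hqN : (1 : ℝ) / 2 - 1 / N < 1 / q) (R : ℝ) :
    ∃ C : ℝ, 0 < C ∧ ∀ u K, En (N := N) R u K →
      eLpNorm u (ENNReal.ofReal q) volume ≤ ENNReal.ofReal (C * √K) := by
  obtain ⟨C, hC, h⟩ := Tst.sobolev hN (q := q.toNNReal) (by
    rw [← NNReal.coe_le_coe, Real.coe_toNNReal _ (by linarith)]; exact hq) (by
    rwa [Real.coe_toNNReal _ (by linarith)]) R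
  refine ⟨C, hC, fun u K hu => ?_⟩
  have hpos : ∀ n : ℕ, 0 < 1 / ((n : ℝ) + 1) := fun n => Nat.one_div_pos_of_nat
  choose φ h1 h2 h3 h4 using fun n : ℕ => hu.2 (1 / ((n : ℝ) + 1)) (hpos n)
  obtain ⟨ns, hns, hl⟩ := exists_subseq_tendsto_ae hu.1 (fun n => (h1 n).memLp 2)
    (squeeze_zero (fun n => integral_nonneg fun x => sq_nonneg _) (fun n => (h3 n).le)
      tendsto_one_div_add_atTop_nhds_zero_nat)
  have hfat := Lp.eLpNorm_lim_le_liminf_eLpNorm (p := ENNReal.ofReal q) (μ := volume)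
    (f := fun n => φ (ns n))
    (fun n => (h1 (ns n)).continuous.aestronglyMeasurable) u hl
  refine hfat.trans ?_
  have hlim : Tendsto (fun n => ENNReal.ofReal (C * √(K + 1 / ((ns n : ℝ) + 1)))) atTop
      (𝓝 (ENNReal.ofReal (C * √K))) := by
    have hz : Tendsto (fun n => 1 / ((ns n : ℝ) + 1)) atTop (𝓝 0) :=
      tendsto_one_div_add_atTop_nhds_zero_nat.comp hns.tendsto_atTop
    refine ENNReal.tendsto_ofReal (Tendsto.const_mul _ ?_)
    have := (Real.continuous_sqrt.tendsto (K + 0)).comp (hz.const_add K)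
    simpa [Function.comp_def] using this
  rw [← hlim.liminf_eq]
  refine liminf_le_liminf (Eventually.of_forall fun n => ?_)
  refine (h _ (h1 (ns n)) (h2 (ns n))).trans ?_
  rw [ENNReal.ofReal_mul C.coe_nonneg, ENNReal.ofReal_coe_nnreal]
  gcongr
  exact (h4 (ns n)).le
end

/-- The control function `t² + |t|ᵇ`. -/
def pw (b t : ℝ) : ℝ := t ^ 2 + |t| ^ b

lemma pw_nonneg (b t : ℝ) : 0 ≤ pw b t := by unfold pw; positivity

lemma pw_neg (b t : ℝ) : pw b (-t) = pw b t := by simp [pw]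

lemma pw_zero {b : ℝ} (hb : 2 < b) : pw b 0 = 0 := by
  simp [pw, Real.zero_rpow (by linarith : b ≠ 0)]

lemma continuous_pw {b : ℝ} (hb : 2 < b) : Continuous (pw b) :=
  (continuous_pow 2).add (continuous_abs.rpow_const fun _ => Or.inr (by linarith))

lemma pw_mono {b s t : ℝ} (hb : 2 < b) (h : |s| ≤ |t|) : pw b s ≤ pw b t :=
  add_le_add (sq_le_sq.2 h) (Real.rpow_le_rpow (abs_nonneg _) h (by linarith))

lemma pw_mul_le (b s t : ℝ) : pw b (s * t) ≤ pw b s * pw b t := by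
  simp only [pw, abs_mul, Real.mul_rpow (abs_nonneg s) (abs_nonneg t)]
  have h1 : 0 ≤ s ^ 2 * |t| ^ b := by positivity
  have h2 : 0 ≤ |s| ^ b * t ^ 2 := by positivity
  nlinarith

lemma pw_add_le {b : ℝ} (hb : 2 < b) (s t : ℝ) : pw b (s + t) ≤ pw b 2 * (pw b s + pw b t) := by
  have key : ∀ s t : ℝ, |s| ≤ |t| → pw b (s + t) ≤ pw b 2 * (pw b s + pw b t) := by
    intro s t h
    calc pw b (s + t) ≤ pw b (2 * t) := pw_mono hb (by
          rw [abs_mul, abs_two]; linarith [abs_add_le s t])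
      _ ≤ pw b 2 * pw b t := pw_mul_le _ _ _
      _ ≤ _ := mul_le_mul_of_nonneg_left (by linarith [pw_nonneg b s]) (pw_nonneg _ _)
  rcases le_total |s| |t| with h | h
  · exact key s t h
  · rw [add_comm s t, add_comm (pw b s)]; exact key t s h

/-- Structural assumptions on a nonnegative superlinear subcritical nonlinearity. -/
structure Nonlin (N : ℕ) (Ω : Set (Euc N)) (k : Euc N → ℝ → ℝ) (a b M : ℝ) : Prop where
  two_lt : 2 < a
  le_b : a ≤ b
  sub : (1 : ℝ) / 2 - 1 / N < 1 / b
  dim : 2 ≤ N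
  meas : Measurable (Function.uncurry k)
  cont : ∀ x, Continuous (k x)
  nonneg : ∀ x t, 0 ≤ k x t
  nonpos : ∀ x t, t ≤ 0 → k x t = 0
  off : ∀ x t, x ∉ Ω → k x t = 0
  le_b' : ∀ x t, 1 ≤ t → k x t ≤ M * t ^ (b - 1)
  le_a' : ∀ x t, 0 ≤ t → t ≤ 1 → k x t ≤ M * t ^ (a - 1)
  scale : ∀ x s t, 1 ≤ s → 0 < t → s ^ (a - 1) * k x t ≤ k x (s * t)

/-- The primitive of the nonlinearity. -/
def prim {N : ℕ} (k : Euc N → ℝ → ℝ) (x : Euc N) (t : ℝ) : ℝ := ∫ s in (0 : ℝ)..t, k x s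

lemma prim_zero {N : ℕ} (k : Euc N → ℝ → ℝ) (x : Euc N) : prim k x 0 = 0 := by simp [prim]

namespace Nonlin
variable {N : ℕ} {Ω : Set (Euc N)} {k : Euc N → ℝ → ℝ} {a b M : ℝ} (H : Nonlin N Ω k a b M)
include H

lemma two_lt_b : 2 < b := H.two_lt.trans_le H.le_b

lemma M_nonneg : 0 ≤ M := by
  have := (H.nonneg 0 1).trans (H.le_b' 0 1 le_rfl)
  simpa using this

lemma mono (x : Euc N) : Monotone (k x) := by
  intro s t hst
  rcases le_or_gt s 0 with h | h
  · rw [H.nonpos x s h]; exact H.nonneg _ _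
  · have h1 : 1 ≤ t / s := (one_le_div h).2 hst
    have h2 := H.scale x (t / s) s h1 h
    rw [div_mul_cancel₀ _ h.ne'] at h2
    refine le_trans ?_ h2
    exact le_mul_of_one_le_left (H.nonneg _ _) (Real.one_le_rpow h1 (by linarith [H.two_lt]))

lemma le_growth (x : Euc N) {t : ℝ} (ht : 0 ≤ t) : k x t ≤ M * (t + t ^ (b - 1)) := by
  have h0 : 0 ≤ t ^ (b - 1) := by positivity
  rcases le_total t 1 with h | h
  · refine (H.le_a' x t ht h).trans (mul_le_mul_of_nonneg_left ?_ H.M_nonneg)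
    have h1 : t ^ (a - 1) ≤ t := Real.rpow_le_self_of_le_one ht h (by linarith [H.two_lt])
    linarith
  · exact (H.le_b' x t h).trans (mul_le_mul_of_nonneg_left (by linarith) H.M_nonneg)

lemma mul_abs_le (x : Euc N) (s w : ℝ) {δ : ℝ} (hδ : 0 < δ) (hδ1 : δ ≤ 1) :
    k x s * |w| ≤ M * (δ * pw b s + δ ^ (1 - b) * pw b w) := by
  have hb := H.two_lt_b
  have hδb : 1 / δ ≤ δ ^ (1 - b) := by
    rw [one_div, ← Real.rpow_neg_one]
    exact Real.rpow_le_rpow_of_exponent_ge hδ hδ1 (by linarith)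
  have hd0 : 0 < δ ^ (1 - b) := by positivity
  rcases le_or_gt s 0 with hs | hs
  · rw [H.nonpos x s hs, zero_mul]
    exact mul_nonneg H.M_nonneg (add_nonneg (mul_nonneg hδ.le (pw_nonneg _ _))
      (mul_nonneg hd0.le (pw_nonneg _ _)))
  · refine (mul_le_mul_of_nonneg_right (H.le_growth x hs.le) (abs_nonneg w)).trans ?_
    rw [mul_assoc]
    refine mul_le_mul_of_nonneg_left ?_ H.M_nonneg
    have hw := abs_nonneg w
    have e1 : s * |w| ≤ δ * s ^ 2 + δ ^ (1 - b) * w ^ 2 := by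
      have h2 : s * |w| ≤ δ * s ^ 2 + 1 / δ * w ^ 2 := by
        rcases le_total |w| (δ * s) with h | h
        · have : 0 ≤ 1 / δ * w ^ 2 := by positivity
          nlinarith
        · have h1 : s ≤ 1 / δ * |w| := by
            rw [one_div, ← div_eq_inv_mul, le_div_iff₀ hδ]; linarith
          have : 0 ≤ δ * s ^ 2 := by positivity
          rw [← sq_abs w]
          nlinarith
      have h3 := mul_le_mul_of_nonneg_right hδb (sq_nonneg w)
      linarith
    have e2 : s ^ (b - 1) * |w| ≤ δ * s ^ b + δ ^ (1 - b) * |w| ^ b := by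
      have hsb : s ^ b = s ^ (b - 1) * s := by
        rw [← Real.rpow_add_one hs.ne']; ring_nf
      have hp : 0 < s ^ (b - 1) := by positivity
      rcases le_total |w| (δ * s) with h | h
      · have h1 : 0 ≤ δ ^ (1 - b) * |w| ^ b := by positivity
        rw [hsb]
        nlinarith
      · have hw0 : 0 < |w| := (mul_pos hδ hs).trans_le h
        have hwb : |w| ^ b = |w| ^ (b - 1) * |w| := by
          rw [← Real.rpow_add_one hw0.ne']; ring_nf
        have h1 : s ≤ δ⁻¹ * |w| := by
            rw [← div_eq_inv_mul, le_div_iff₀ hδ]; linarith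
        have h2 : s ^ (b - 1) ≤ δ ^ (1 - b) * |w| ^ (b - 1) := by
          refine (Real.rpow_le_rpow hs.le h1 (by linarith)).trans_eq ?_
          rw [Real.mul_rpow (by positivity) hw, Real.inv_rpow hδ.le, ← Real.rpow_neg hδ.le,
            neg_sub]
        have h3 : 0 ≤ δ * s ^ b := by positivity
        have h4 := mul_le_mul_of_nonneg_right h2 hw
        rw [hwb]; linarith
    unfold pw
    rw [abs_of_pos hs]
    nlinarith

lemma mul_abs_le_one (x : Euc N) (s w : ℝ) : k x s * |w| ≤ M * (pw b s + pw b w) := by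
  simpa using H.mul_abs_le x s w one_pos le_rfl

lemma hasDerivAt_prim (x : Euc N) (t : ℝ) : HasDerivAt (prim k x) (k x t) t :=
  intervalIntegral.integral_hasDerivAt_right ((H.cont x).intervalIntegrable _ _)
    (H.cont x).stronglyMeasurable.stronglyMeasurableAtFilter (H.cont x).continuousAt

lemma continuous_prim (x : Euc N) : Continuous (prim k x) :=
  continuous_iff_continuousAt.2 fun t => (H.hasDerivAt_prim x t).continuousAt

lemma prim_convex (x : Euc N) (s t : ℝ) : prim k x t + k x t * (s - t) ≤ prim k x s := by
  have h1 : prim k x s - prim k x t = ∫ r in t..s, k x r :=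
    intervalIntegral.integral_interval_sub_left ((H.cont x).intervalIntegrable _ _)
      ((H.cont x).intervalIntegrable _ _)
  rcases le_total t s with h | h
  · have h2 : ∫ r in t..s, k x t ≤ ∫ r in t..s, k x r :=
      intervalIntegral.integral_mono_on h (by simp) ((H.cont x).intervalIntegrable _ _)
        fun r hr => H.mono x hr.1
    rw [intervalIntegral.integral_const, smul_eq_mul] at h2
    linarith
  · have h2 : ∫ r in s..t, k x r ≤ ∫ r in s..t, k x t :=
      intervalIntegral.integral_mono_on h ((H.cont x).intervalIntegrable _ _) (by simp)
        fun r hr => H.mono x hr.2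
    rw [intervalIntegral.integral_const, smul_eq_mul] at h2
    rw [intervalIntegral.integral_symm] at h1
    linarith

lemma prim_nonneg (x : Euc N) (t : ℝ) : 0 ≤ prim k x t := by
  have := H.prim_convex x t 0
  rw [prim_zero, H.nonpos x 0 le_rfl] at this
  simpa using this

lemma prim_of_nonpos (x : Euc N) {t : ℝ} (ht : t ≤ 0) : prim k x t = 0 := by
  refine le_antisymm ?_ (H.prim_nonneg x t)
  have := H.prim_convex x 0 t
  rw [prim_zero, H.nonpos x t ht] at this
  linarith

lemma prim_mul_ge (x : Euc N) {t v : ℝ} (ht : 0 ≤ t) (hv : 0 ≤ v) :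
    prim k x v + k x v * v * ((t ^ a - 1) / a) ≤ prim k x (t * v) := by
  have ha := H.two_lt
  rcases hv.eq_or_lt with rfl | hv
  · simp
  set h : ℝ → ℝ := fun t => prim k x (t * v) - k x v * v * (t ^ a / a) with hh
  have hc : Continuous h := by
    refine ((H.continuous_prim x).comp (continuous_mul_const v)).sub (continuous_const.mul ?_)
    exact (continuous_id.rpow_const fun _ => Or.inr (by linarith)).div_const a
  have hd : ∀ t, 0 < t → HasDerivAt h (v * (k x (t * v) - t ^ (a - 1) * k x v)) t := by
    intro t ht
    have h1 := (H.hasDerivAt_prim x (t * v)).comp t ((hasDerivAt_id t).mul_const v)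
    have h2 := ((Real.hasDerivAt_rpow_const (p := a) (Or.inl ht.ne')).div_const a).const_mul
      (k x v * v)
    refine (h1.sub h2).congr_deriv ?_
    field_simp
  have key : h 1 ≤ h t := by
    rcases le_total 1 t with h1 | h1
    · refine monotoneOn_of_deriv_nonneg (convex_Ici 1) hc.continuousOn ?_ ?_
        self_mem_Ici h1 h1
      · intro s hs
        rw [interior_Ici] at hs
        exact (hd s (one_pos.trans hs)).differentiableAt.differentiableWithinAt
      · intro s hs
        rw [interior_Ici] at hs
        rw [(hd s (one_pos.trans hs)).deriv]
        exact mul_nonneg hv.le (sub_nonneg.2 (H.scale x s v (le_of_lt hs) hv))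
    · refine antitoneOn_of_deriv_nonpos (convex_Icc 0 1) hc.continuousOn ?_ ?_
        ⟨ht, h1⟩ (right_mem_Icc.2 zero_le_one) h1
      · intro s hs
        rw [interior_Icc] at hs
        exact (hd s hs.1).differentiableAt.differentiableWithinAt
      · intro s hs
        rw [interior_Icc] at hs
        rw [(hd s hs.1).deriv]
        refine mul_nonpos_of_nonneg_of_nonpos hv.le (sub_nonpos.2 ?_)
        have h2 := H.scale x (1 / s) (s * v) (by rw [le_div_iff₀ hs.1]; linarith [hs.2])
          (mul_pos hs.1 hv)
        have h3 : 1 / s * (s * v) = v := by have := hs.1.ne'; field_simp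
        have h4 : s ^ (a - 1) * (1 / s) ^ (a - 1) = 1 := by
          rw [← Real.mul_rpow hs.1.le (by have := hs.1; positivity), mul_one_div_cancel hs.1.ne',
            Real.one_rpow]
        rw [h3] at h2
        calc k x (s * v) = s ^ (a - 1) * ((1 / s) ^ (a - 1) * k x (s * v)) := by
              rw [← mul_assoc, h4, one_mul]
          _ ≤ _ := mul_le_mul_of_nonneg_left h2 (Real.rpow_nonneg hs.1.le _)
  simp only [hh, one_mul, Real.one_rpow] at key
  have : k x v * v * ((t ^ a - 1) / a) = k x v * v * (t ^ a / a) - k x v * v * (1 / a) := by ring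
  linarith

lemma prim_le (x : Euc N) {v : ℝ} (hv : 0 ≤ v) : prim k x v ≤ k x v * v / a := by
  have ha := H.two_lt
  have := H.prim_mul_ge x le_rfl hv
  rw [zero_mul, prim_zero, Real.zero_rpow (by linarith)] at this
  have h2 : k x v * v * ((0 - 1) / a) = -(k x v * v / a) := by ring
  linarith

lemma rpow_mul_prim_le (x : Euc N) {t v : ℝ} (ht : 1 ≤ t) (hv : 0 ≤ v) :
    t ^ a * prim k x v ≤ prim k x (t * v) := by
  have ha := H.two_lt
  have h1 := H.prim_mul_ge x (zero_le_one.trans ht) hv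
  have h2 := H.prim_le x hv
  have h3 : 0 ≤ t ^ a - 1 := sub_nonneg.2 (Real.one_le_rpow ht (by linarith))
  have h4 : k x v * v * ((t ^ a - 1) / a) = k x v * v / a * (t ^ a - 1) := by ring
  nlinarith

lemma prim_mul_le (x : Euc N) {t v : ℝ} (ht0 : 0 ≤ t) (ht : t ≤ 1) (hv : 0 ≤ v) :
    prim k x (t * v) ≤ t ^ a * prim k x v := by
  have ha := H.two_lt
  rcases ht0.eq_or_lt with rfl | ht0
  · rw [zero_mul, prim_zero, Real.zero_rpow (by linarith), zero_mul]
  have h1 := H.rpow_mul_prim_le x (t := 1 / t) (v := t * v)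
    (by rw [le_div_iff₀ ht0]; linarith) (by positivity)
  have h3 : 1 / t * (t * v) = v := by field_simp
  have h4 : t ^ a * (1 / t) ^ a = 1 := by
    rw [← Real.mul_rpow ht0.le (by positivity), mul_one_div_cancel ht0.ne', Real.one_rpow]
  rw [h3] at h1
  calc prim k x (t * v) = t ^ a * ((1 / t) ^ a * prim k x (t * v)) := by
        rw [← mul_assoc, h4, one_mul]
    _ ≤ _ := mul_le_mul_of_nonneg_left h1 (by positivity)

lemma mul_self_le (x : Euc N) (v : ℝ) : k x v * |v| ≤ 2 * M * pw b v := by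
  have := H.mul_abs_le_one x v v
  linarith

lemma prim_le_pw (x : Euc N) (v : ℝ) : prim k x v ≤ 2 * M * pw b v := by
  rcases le_total v 0 with h | h
  · rw [H.prim_of_nonpos x h]
    exact mul_nonneg (mul_nonneg zero_le_two H.M_nonneg) (pw_nonneg _ _)
  · have h1 := H.mul_self_le x v
    rw [abs_of_nonneg h] at h1
    have h2 := H.prim_convex x 0 v
    rw [prim_zero] at h2
    linarith

lemma prim_le_add (x : Euc N) (s t : ℝ) {δ : ℝ} (hδ : 0 < δ) (hδ1 : δ ≤ 1) :
    prim k x s ≤ prim k x t + M * (δ * pw b s + δ ^ (1 - b) * pw b (s - t)) := by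
  have h1 := H.prim_convex x t s
  have h2 := H.mul_abs_le x s (s - t) hδ hδ1
  have h3 := mul_le_mul_of_nonneg_left (le_abs_self (s - t)) (H.nonneg x s)
  nlinarith
end Nonlin

/-- Functions with integrable control function. -/
def Fp {N : ℕ} (b : ℝ) (u : Euc N → ℝ) : Prop :=
  AEStronglyMeasurable u volume ∧ Integrable (fun x => pw b (u x)) volume

section
variable {N : ℕ} {b : ℝ} {u v w : Euc N → ℝ}

lemma Fp.of_le (hb : 2 < b) (hu : AEStronglyMeasurable u volume) {F : Euc N → ℝ}
    (hF : Integrable F volume) (h : ∀ x, pw b (u x) ≤ F x) : Fp b u :=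
  ⟨hu, hF.mono' ((continuous_pw hb).comp_aestronglyMeasurable hu) (Eventually.of_forall fun x => by
    rw [Real.norm_eq_abs, abs_of_nonneg (pw_nonneg _ _)]; exact h x)⟩

lemma Fp.add (hb : 2 < b) (hu : Fp b u) (hv : Fp b v) : Fp b (fun x => u x + v x) :=
  Fp.of_le hb (hu.1.add hv.1) ((hu.2.add hv.2).const_mul (pw b 2)) fun _ => pw_add_le hb _ _

lemma Fp.const_mul (hb : 2 < b) (hu : Fp b u) (t : ℝ) : Fp b (fun x => t * u x) :=
  Fp.of_le hb (hu.1.const_mul t) (hu.2.const_mul (pw b t)) fun _ => pw_mul_le _ _ _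

lemma Fp.sub (hb : 2 < b) (hu : Fp b u) (hv : Fp b v) : Fp b (fun x => u x - v x) := by
  simpa [sub_eq_add_neg] using hu.add hb (hv.const_mul hb (-1))

lemma Fp.memLp (hu : Fp b u) : MemLp u 2 volume := by
  rw [memLp_two_iff_integrable_sq hu.1]
  refine hu.2.mono' (hu.1.pow 2) (Eventually.of_forall fun x => ?_)
  have : 0 ≤ |u x| ^ b := by positivity
  rw [Real.norm_eq_abs, abs_of_nonneg (sq_nonneg _)]
  unfold pw; linarith

lemma Fp.congr (hu : Fp b u) (h : u =ᵐ[volume] v) : Fp b v :=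
  ⟨hu.1.congr h, hu.2.congr (h.mono fun x hx => by simp only [hx])⟩

lemma Tst.fp (hb : 2 < b) (h : Tst u) : Fp b u :=
  ⟨h.continuous.aestronglyMeasurable,
    ((continuous_pw hb).comp h.continuous).integrable_of_hasCompactSupport
      (h.2.comp_left (g := pw b) (pw_zero hb))⟩

lemma integrable_rpow_of_eLpNorm {q D : ℝ} (hq : 0 < q) (hD : 0 ≤ D)
    (hu : AEStronglyMeasurable u volume)
    (h : eLpNorm u (ENNReal.ofReal q) volume ≤ ENNReal.ofReal D) :
    Integrable (fun x => |u x| ^ q) volume ∧ ∫ x, |u x| ^ q ≤ D ^ q := by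
  have hm : MemLp u (ENNReal.ofReal q) volume := ⟨hu, h.trans_lt ENNReal.ofReal_lt_top⟩
  have hi := hm.integrable_norm_rpow (by simpa using hq) (by simp)
  rw [ENNReal.toReal_ofReal hq.le] at hi
  refine ⟨hi, ?_⟩
  rw [hm.eLpNorm_eq_integral_rpow_norm (by simpa using hq) (by simp), ENNReal.toReal_ofReal hq.le,
    ENNReal.ofReal_le_ofReal_iff hD] at h
  have h0 : 0 ≤ ∫ x, ‖u x‖ ^ q := integral_nonneg fun x => by positivity
  have := Real.rpow_le_rpow (by positivity) h hq.le
  rwa [← Real.rpow_mul h0, inv_mul_cancel₀ hq.ne', Real.rpow_one] at this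

lemma En.fp (hN : 2 ≤ N) (hb : 2 < b) (hbN : (1 : ℝ) / 2 - 1 / N < 1 / b) {R K : ℝ}
    (hu : En R u K) : Fp b u := by
  obtain ⟨C, hC, h⟩ := En.sobolev hN hb.le hbN R
  have h1 := (integrable_rpow_of_eLpNorm (by linarith) (by positivity) hu.1.1 (h u K hu)).1
  exact ⟨hu.1.1, hu.1.integrable_sq.add h1⟩

lemma pw_split {q L : ℝ} (hb : 2 < b) (hq : b ≤ q) (hL : 0 < L) (t : ℝ) :
    pw b t ≤ (1 + L ^ (b - 2)) * t ^ 2 + L ^ (b - q) * |t| ^ q := by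
  have ht := abs_nonneg t
  have h2 : 0 ≤ L ^ (b - q) * |t| ^ q := by positivity
  have h3 : 0 ≤ L ^ (b - 2) * t ^ 2 := by positivity
  have key : |t| ^ b ≤ L ^ (b - 2) * t ^ 2 + L ^ (b - q) * |t| ^ q := by
    rcases ht.eq_or_lt with h0 | h0
    · rw [← h0, Real.zero_rpow (by linarith)]; rw [← h0] at h2; positivity
    rcases le_total |t| L with h | h
    · have h1 : |t| ^ b = |t| ^ (b - 2) * t ^ 2 := by
        rw [← sq_abs t, ← Real.rpow_add_natCast h0.ne']; norm_num
      have h4 : |t| ^ (b - 2) ≤ L ^ (b - 2) := Real.rpow_le_rpow ht h (by linarith)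
      have := mul_le_mul_of_nonneg_right h4 (sq_nonneg t)
      linarith
    · have h1 : |t| ^ b = |t| ^ (b - q) * |t| ^ q := by
        rw [← Real.rpow_add h0]; norm_num
      have h4 : |t| ^ (b - q) ≤ L ^ (b - q) := Real.rpow_le_rpow_of_nonpos hL h (by linarith)
      have := mul_le_mul_of_nonneg_right h4 (Real.rpow_nonneg ht q)
      linarith
  unfold pw
  linarith

/-- Convergence in the mean and a bound on a higher norm give convergence of the control. -/
lemma tendsto_integral_pw {ι : Type*} {l : Filter ι} {f : ι → Euc N → ℝ} {q B : ℝ} (hb : 2 < b)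
    (hq : b < q) (hf : ∀ i, MemLp (f i) 2 volume)
    (hfq : ∀ i, Integrable (fun x => |f i x| ^ q) volume) (hB : ∀ i, ∫ x, |f i x| ^ q ≤ B)
    (hl : Tendsto (fun i => ∫ x, f i x ^ 2) l (𝓝 0)) :
    Tendsto (fun i => ∫ x, pw b (f i x)) l (𝓝 0) := by
  have hle : ∀ L : ℝ, 0 < L → ∀ i, ∫ x, pw b (f i x) ≤
      (1 + L ^ (b - 2)) * (∫ x, f i x ^ 2) + L ^ (b - q) * B := by
    intro L hL i
    have i1 := (hf i).integrable_sq.const_mul (1 + L ^ (b - 2))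
    have i2 := (hfq i).const_mul (L ^ (b - q))
    have h1 : ∫ x, pw b (f i x) ≤
        ∫ x, ((1 + L ^ (b - 2)) * f i x ^ 2 + L ^ (b - q) * |f i x| ^ q) :=
      integral_mono_of_nonneg (Eventually.of_forall fun x => pw_nonneg _ _) (i1.add i2)
        (Eventually.of_forall fun x => pw_split hb hq.le hL _)
    rw [integral_add i1 i2, integral_const_mul, integral_const_mul] at h1
    have := mul_le_mul_of_nonneg_left (hB i) (Real.rpow_nonneg hL.le (b - q))
    linarith
  have hz : Tendsto (fun L : ℝ => L ^ (b - q) * B) atTop (𝓝 0) := by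
    have := (tendsto_rpow_neg_atTop (y := q - b) (by linarith)).mul_const B
    simpa using this
  rw [Metric.tendsto_nhds]
  intro δ hδ
  obtain ⟨L, hL1, hL⟩ := ((hz.eventually (gt_mem_nhds (half_pos hδ))).and
    (eventually_gt_atTop 0)).exists
  have h2 := (hl.const_mul (1 + L ^ (b - 2)))
  rw [mul_zero] at h2
  filter_upwards [h2.eventually (gt_mem_nhds (half_pos hδ))] with i hi
  have h0 : 0 ≤ ∫ x, pw b (f i x) := integral_nonneg fun x => pw_nonneg _ _
  rw [Real.dist_0_eq_abs, abs_of_nonneg h0]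
  linarith [hle L hL i]
end

namespace Nonlin
variable {N : ℕ} {Ω : Set (Euc N)} {k : Euc N → ℝ → ℝ} {a b M : ℝ} (H : Nonlin N Ω k a b M)
  {u v w : Euc N → ℝ}
include H

lemma aesm (hu : AEStronglyMeasurable u volume) :
    AEStronglyMeasurable (fun x => k x (u x)) volume :=
  (H.meas.comp_aemeasurable (aemeasurable_id.prodMk hu.aemeasurable)).aestronglyMeasurable

lemma integrable_mul (hu : Fp b u) (hw : Fp b w) :
    Integrable (fun x => k x (u x) * w x) volume :=
  ((hu.2.add hw.2).const_mul M).mono' ((H.aesm hu.1).mul hw.1) (Eventually.of_forall fun x => by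
    rw [Real.norm_eq_abs, abs_mul, abs_of_nonneg (H.nonneg _ _)]
    exact H.mul_abs_le_one x _ _)

lemma measurable_prim : Measurable (Function.uncurry (prim k)) := by
  have h : Measurable (Function.uncurry fun (t : ℝ) (x : Euc N) => prim k x t) := by
    refine (stronglyMeasurable_uncurry_of_continuous_of_stronglyMeasurable
      (u := fun (t : ℝ) (x : Euc N) => prim k x t)
      (fun x => H.continuous_prim x) fun t => ?_).measurable
    have hs : StronglyMeasurable (Function.uncurry k) := H.meas.stronglyMeasurable
    exact (hs.integral_prod_right (ν := volume.restrict (Ioc 0 t))).sub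
      (hs.integral_prod_right (ν := volume.restrict (Ioc t 0)))
  exact h.comp measurable_swap

lemma integrable_prim (hu : Fp b u) : Integrable (fun x => prim k x (u x)) volume :=
  (hu.2.const_mul (2 * M)).mono'
    (H.measurable_prim.comp_aemeasurable
      (aemeasurable_id.prodMk hu.1.aemeasurable)).aestronglyMeasurable
    (Eventually.of_forall fun x => by
      rw [Real.norm_eq_abs, abs_of_nonneg (H.prim_nonneg _ _)]
      exact H.prim_le_pw x _)

lemma integral_prim_le_add (hu : Fp b u) (hv : Fp b v) {δ : ℝ} (hδ : 0 < δ) (hδ1 : δ ≤ 1) :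
    ∫ x, prim k x (u x) ≤ (∫ x, prim k x (v x)) +
      M * (δ * (∫ x, pw b (u x)) + δ ^ (1 - b) * ∫ x, pw b (u x - v x)) := by
  have hb := H.two_lt_b
  have i1 := hu.2.const_mul δ
  have i2 := (hu.sub hb hv).2.const_mul (δ ^ (1 - b))
  rw [← integral_const_mul, ← integral_const_mul, ← integral_add i1 i2, ← integral_const_mul,
    ← integral_add (H.integrable_prim hv) (g := fun x => M * (δ * pw b (u x) +
      δ ^ (1 - b) * pw b (u x - v x))) ((i1.add i2).const_mul M)]
  exact integral_mono (H.integrable_prim hu) ((H.integrable_prim hv).add ((i1.add i2).const_mul M))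
    fun x => H.prim_le_add x _ _ hδ hδ1

lemma tendsto_integral_prim {ι : Type*} {l : Filter ι} {f : ι → Euc N → ℝ} (hu : Fp b u)
    (hf : ∀ i, Fp b (f i)) (hl : Tendsto (fun i => ∫ x, pw b (f i x - u x)) l (𝓝 0)) :
    Tendsto (fun i => ∫ x, prim k x (f i x)) l (𝓝 (∫ x, prim k x (u x))) := by
  have hb := H.two_lt_b
  have hM := H.M_nonneg
  set P := ∫ x, pw b (u x) with hP
  have hP0 : 0 ≤ P := integral_nonneg fun x => pw_nonneg _ _
  set c := pw b 2 with hc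
  have hc1 : 1 ≤ c := by
    have : (0 : ℝ) ≤ |2| ^ b := by positivity
    rw [hc, pw]; linarith
  have hfP : ∀ i, ∫ x, pw b (f i x) ≤ c * ((∫ x, pw b (f i x - u x)) + P) := by
    intro i
    rw [← integral_add ((hf i).sub hb hu).2 hu.2, ← integral_const_mul]
    refine integral_mono (hf i).2 ((((hf i).sub hb hu).2.add hu.2).const_mul c) fun x => ?_
    simpa using pw_add_le hb (f i x - u x) (u x)
  have hE : ∀ δ : ℝ, 0 < δ → δ ≤ 1 → ∀ i, |(∫ x, prim k x (f i x)) - ∫ x, prim k x (u x)| ≤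
      M * c * P * δ + (M * (δ * c + δ ^ (1 - b))) * ∫ x, pw b (f i x - u x) := by
    intro δ hδ hδ1 i
    have h1 := H.integral_prim_le_add (hf i) hu hδ hδ1
    have h2 := H.integral_prim_le_add hu (hf i) hδ hδ1
    have h3 : ∫ x, pw b (u x - f i x) = ∫ x, pw b (f i x - u x) := by
      refine integral_congr_ae (Eventually.of_forall fun x => ?_)
      simp only
      rw [← pw_neg, neg_sub]
    have h0 : 0 ≤ ∫ x, pw b (f i x - u x) := integral_nonneg fun x => pw_nonneg _ _
    have h4 := mul_le_mul_of_nonneg_left (hfP i) (mul_nonneg hM hδ.le)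
    have h5 : 0 ≤ M * δ := mul_nonneg hM hδ.le
    have h6 : M * δ * P ≤ M * δ * (c * P) :=
      mul_le_mul_of_nonneg_left (le_mul_of_one_le_left hP0 hc1) h5
    have h7 : 0 ≤ M * δ * c * ∫ x, pw b (f i x - u x) := by positivity
    rw [h3, ← hP] at h2
    rw [abs_le]
    constructor <;> nlinarith
  rw [Metric.tendsto_nhds]
  intro η hη
  set δ := min 1 (η / (2 * (M * c * P + 1))) with hδ
  have hMcP : 0 ≤ M * c * P := by positivity
  have hδ0 : 0 < δ := by positivity
  have h2 : M * c * P * δ ≤ η / 2 := by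
    have h2 : δ * (2 * (M * c * P + 1)) ≤ η := by
      have := min_le_right 1 (η / (2 * (M * c * P + 1)))
      rwa [← hδ, le_div_iff₀ (by positivity)] at this
    nlinarith
  have h3 := hl.const_mul (M * (δ * c + δ ^ (1 - b)))
  rw [mul_zero] at h3
  filter_upwards [h3.eventually (gt_mem_nhds (half_pos hη))] with i hi
  rw [Real.dist_eq]
  linarith [hE δ hδ0 (min_le_left _ _) i]

lemma tendsto_integral_mul {ι : Type*} {l : Filter ι} [l.IsCountablyGenerated] {t : ι → ℝ} {t₀ : ℝ}
    (hv : Fp b v) (hw : Fp b w) (ht : Tendsto t l (𝓝 t₀)) :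
    Tendsto (fun i => ∫ x, k x (t i * v x) * w x) l (𝓝 (∫ x, k x (t₀ * v x) * w x)) := by
  have hb := H.two_lt_b
  refine tendsto_integral_filter_of_dominated_convergence
    (fun x => M * (pw b (|t₀| + 1) * pw b (v x) + pw b (w x))) ?_ ?_ ?_ ?_
  · exact Eventually.of_forall fun i => (H.integrable_mul (hv.const_mul hb _) hw).1
  · have h1 : ∀ᶠ i in l, |t i| < |t₀| + 1 := ht.abs.eventually (gt_mem_nhds (lt_add_one _))
    filter_upwards [h1] with i hi
    refine Eventually.of_forall fun x => ?_
    rw [Real.norm_eq_abs, abs_mul, abs_of_nonneg (H.nonneg _ _)]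
    refine (H.mul_abs_le_one x _ _).trans (mul_le_mul_of_nonneg_left ?_ H.M_nonneg)
    have h2 : pw b (t i * v x) ≤ pw b (|t₀| + 1) * pw b (v x) :=
      (pw_mul_le _ _ _).trans (mul_le_mul_of_nonneg_right
        (pw_mono hb (hi.le.trans (le_abs_self _))) (pw_nonneg _ _))
    linarith
  · exact ((hv.2.const_mul _).add hw.2).const_mul M
  · refine Eventually.of_forall fun x => ?_
    exact (((H.cont x).tendsto _).comp (ht.mul_const (v x))).mul_const (w x)
end Nonlin

section
variable {N : ℕ} {b : ℝ} {u : Euc N → ℝ}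

lemma integral_pw_nonneg (b : ℝ) (u : Euc N → ℝ) : 0 ≤ ∫ x, pw b (u x) :=
  integral_nonneg fun _ => pw_nonneg _ _

lemma tendsto_integral_pw_mul {ι : Type*} {l : Filter ι} {f : ι → Euc N → ℝ} {t : ι → ℝ} {t₀ : ℝ}
    (hb : 2 < b) (hu : Fp b u) (hf : ∀ i, Fp b (f i))
    (hl : Tendsto (fun i => ∫ x, pw b (f i x - u x)) l (𝓝 0)) (ht : Tendsto t l (𝓝 t₀)) :
    Tendsto (fun i => ∫ x, pw b (t i * f i x - t₀ * u x)) l (𝓝 0) := by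
  have hle : ∀ i, ∫ x, pw b (t i * f i x - t₀ * u x) ≤
      pw b 2 * (pw b (t i) * (∫ x, pw b (f i x - u x)) + pw b (t i - t₀) * ∫ x, pw b (u x)) := by
    intro i
    have i1 := ((hf i).sub hb hu).2.const_mul (pw b (t i))
    have i2 := hu.2.const_mul (pw b (t i - t₀))
    rw [← integral_const_mul, ← integral_const_mul, ← integral_add i1 i2, ← integral_const_mul]
    refine integral_mono (((hf i).const_mul hb _).sub hb (hu.const_mul hb _)).2
      ((i1.add i2).const_mul _) fun x => ?_
    have h1 : t i * f i x - t₀ * u x = t i * (f i x - u x) + (t i - t₀) * u x := by ring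
    simp only [h1]
    refine (pw_add_le hb _ _).trans (mul_le_mul_of_nonneg_left ?_ (pw_nonneg _ _))
    exact add_le_add (pw_mul_le _ _ _) (pw_mul_le _ _ _)
  refine squeeze_zero (fun i => integral_pw_nonneg _ _) hle ?_
  have h1 := ((continuous_pw hb).tendsto t₀).comp ht
  have h2 := ((continuous_pw hb).tendsto (t₀ - t₀)).comp (ht.sub_const t₀)
  have := ((h1.mul hl).add (h2.mul_const (∫ x, pw b (u x)))).const_mul (pw b 2)
  simpa [pw_zero hb, Function.comp_def] using this

lemma half_sq_sub_rpow_lt {a t : ℝ} (ha : 2 < a) (ht : 0 ≤ t) (h : t ≠ 1) :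
    (t ^ 2 - 1) / 2 < (t ^ a - 1) / a := by
  have h1 := one_add_mul_self_lt_rpow_one_add (s := t ^ 2 - 1) (p := a / 2)
    (by nlinarith [sq_nonneg t]) (by
      intro h2
      have : (t - 1) * (t + 1) = 0 := by linarith
      rcases mul_eq_zero.1 this with h3 | h3
      · exact h (by linarith)
      · linarith) (by linarith)
  have h2 : (1 + (t ^ 2 - 1)) ^ (a / 2) = t ^ a := by
    rw [add_sub_cancel, ← Real.rpow_natCast, ← Real.rpow_mul ht]
    congr 1
    push_cast; ring
  rw [h2] at h1
  rw [lt_div_iff₀ (by linarith)]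
  linarith
end

/-- Nonnegative nonzero functions vanishing off `Ω` for which the fibre maximum is at most `ℓ`. -/
structure Adm {N : ℕ} (Ω : Set (Euc N)) (k : Euc N → ℝ → ℝ) (R lam : ℝ) (u : Euc N → ℝ) (K ℓ : ℝ) :
    Prop where
  nonneg : ∀ x, 0 ≤ u x
  off : ∀ x, x ∉ Ω → u x = 0
  ne : ¬ u =ᵐ[volume] 0
  en : En R u K
  le : ∀ t : ℝ, 0 ≤ t → t ^ 2 / 2 * (K + lam * ∫ x, u x ^ 2) - (∫ x, prim k x (t * u x)) ≤ ℓ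

section
variable {N : ℕ} {Ω : Set (Euc N)} {k : Euc N → ℝ → ℝ} {a b M R lam K ℓ : ℝ} {u : Euc N → ℝ}

lemma Adm.scale (h : Adm Ω k R lam u K ℓ) {τ : ℝ} (hτ : 0 < τ) :
    Adm Ω k R lam (fun x => τ * u x) (τ ^ 2 * K) ℓ where
  nonneg x := mul_nonneg hτ.le (h.nonneg x)
  off x hx := by rw [h.off x hx, mul_zero]
  ne h0 := h.ne (h0.mono fun x hx => by
    simpa [hτ.ne'] using hx)
  en := h.en.const_mul τ
  le t ht := by
    have := h.le (t * τ) (by positivity)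
    simp only [mul_pow, integral_const_mul, ← mul_assoc] at this ⊢
    refine le_trans (le_of_eq ?_) this
    ring

lemma Adm.level_nonneg (h : Adm Ω k R lam u K ℓ) : 0 ≤ ℓ := by
  simpa [prim_zero] using h.le 0 le_rfl

lemma Adm.integral_sq_pos (h : Adm Ω k R lam u K ℓ) : 0 < ∫ x, u x ^ 2 := by
  refine (integral_nonneg fun x => sq_nonneg (u x)).lt_of_ne' fun h0 => h.ne ?_
  rw [integral_eq_zero_iff_of_nonneg (fun x => sq_nonneg _) h.en.1.integrable_sq] at h0
  exact h0.mono fun x hx => by simpa using hx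

namespace Nonlin
variable (H : Nonlin N Ω k a b M)
include H

lemma fp (h : En R u K) : Fp b u := h.fp H.dim H.two_lt_b H.sub

lemma exists_subseq_max {f : ℕ → Euc N → ℝ} {v : Euc N → ℝ} {Qs t e : ℕ → ℝ} {Q τ c : ℝ}
    (hv : Fp b v) (hf : ∀ n, Fp b (f n)) (hf0 : ∀ n x, 0 ≤ f n x)
    (hl : Tendsto (fun n => ∫ x, pw b (f n x - v x)) atTop (𝓝 0))
    (hQ : Tendsto Qs atTop (𝓝 Q)) (hτ : 0 < τ) (hτv : 0 < ∫ x, prim k x (τ * v x))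
    (ht : ∀ n, 0 ≤ t n) (he : Tendsto e atTop (𝓝 0))
    (hc : ∀ n, c - e n ≤ t n ^ 2 / 2 * Qs n - ∫ x, prim k x (t n * f n x)) :
    ∃ t₀, 0 ≤ t₀ ∧ c ≤ t₀ ^ 2 / 2 * Q - (∫ x, prim k x (t₀ * v x)) ∧ ∃ ns : ℕ → ℕ, StrictMono ns ∧
      Tendsto (fun n => t (ns n)) atTop (𝓝 t₀) := by
  have hb := H.two_lt_b
  have ha := H.two_lt
  set m := ∫ x, prim k x (τ * v x) with hm
  have hlτ := H.tendsto_integral_prim (hv.const_mul hb τ) (fun n => (hf n).const_mul hb τ)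
    (tendsto_integral_pw_mul hb hv hf hl (tendsto_const_nhds (x := τ)))
  have hbig : Tendsto (fun s : ℝ => s ^ 2 * ((m / 2 * (1 / τ) ^ a) * s ^ (a - 2) - (Q + 1) / 2))
      atTop atTop := by
    refine (tendsto_pow_atTop two_ne_zero).atTop_mul_atTop₀ ?_
    refine tendsto_atTop_add_const_right _ _ ?_
    exact (tendsto_rpow_atTop (by linarith)).const_mul_atTop (by positivity)
  obtain ⟨T, hT⟩ := eventually_atTop.1 (hbig.eventually (eventually_gt_atTop (1 - c)))
  have hev : ∀ᶠ n in atTop, t n ∈ Icc 0 (max T τ) := by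
    filter_upwards [hlτ.eventually (lt_mem_nhds (half_lt_self hτv)),
      hQ.eventually (gt_mem_nhds (lt_add_one Q)), he.eventually (gt_mem_nhds one_pos)]
      with n h1 h2 h3
    refine ⟨ht n, le_of_not_gt fun h4 => ?_⟩
    obtain ⟨h5, h6⟩ := max_lt_iff.1 h4
    have h7 := hT (t n) h5.le
    have h8 : (t n / τ) ^ a * (∫ x, prim k x (τ * f n x)) ≤ ∫ x, prim k x (t n * f n x) := by
      rw [← integral_const_mul]
      refine integral_mono ((H.integrable_prim ((hf n).const_mul hb τ)).const_mul _)
        (H.integrable_prim ((hf n).const_mul hb _)) fun x => ?_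
      have := H.rpow_mul_prim_le x (t := t n / τ) (v := τ * f n x) ((one_le_div hτ).2 h6.le)
        (mul_nonneg hτ.le (hf0 n x))
      rwa [← mul_assoc, div_mul_cancel₀ _ hτ.ne'] at this
    have htn : 0 < t n := hτ.trans h6
    have h9 : (t n / τ) ^ a = t n ^ 2 * ((1 / τ) ^ a * t n ^ (a - 2)) := by
      rw [div_eq_mul_one_div, Real.mul_rpow htn.le (by positivity)]
      have : t n ^ a = t n ^ 2 * t n ^ (a - 2) := by
        rw [← Real.rpow_natCast (t n) 2, ← Real.rpow_add htn]; norm_num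
      rw [this]; ring
    have h10 : 0 ≤ (t n / τ) ^ a := by positivity
    have h11 : (t n / τ) ^ a * (m / 2) ≤ (t n / τ) ^ a * (∫ x, prim k x (τ * f n x)) :=
      mul_le_mul_of_nonneg_left h1.le h10
    rw [h9] at h8 h11
    have h12 : t n ^ 2 / 2 * Qs n ≤ t n ^ 2 / 2 * (Q + 1) :=
      mul_le_mul_of_nonneg_left h2.le (by positivity)
    have := hc n
    nlinarith
  obtain ⟨t₀, h0, ns, hns, hlim⟩ := isCompact_Icc.tendsto_subseq' hev.frequently
  refine ⟨t₀, h0.1, ?_, ns, hns, hlim⟩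
  have hP := H.tendsto_integral_prim (hv.const_mul hb t₀)
    (fun n => (hf (ns n)).const_mul hb (t (ns n)))
    (tendsto_integral_pw_mul hb hv (fun n => hf (ns n)) (hl.comp hns.tendsto_atTop) hlim)
  have h2 := (((hlim.pow 2).div_const 2).mul (hQ.comp hns.tendsto_atTop)).sub hP
  refine le_of_tendsto_of_tendsto ((he.comp hns.tendsto_atTop).const_sub c |>.trans_eq ?_) h2
    (Eventually.of_forall fun n => hc (ns n))
  rw [sub_zero]
end Nonlin
end

section
variable {N : ℕ} {Ω : Set (Euc N)} {k : Euc N → ℝ → ℝ} {a b M R lam : ℝ}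

namespace Nonlin
variable (H : Nonlin N Ω k a b M)
include H

lemma exists_subcritical : ∃ q, b < q ∧ (1 : ℝ) / 2 - 1 / N < 1 / q := by
  have hb : 0 < b := by linarith [H.two_lt_b]
  have hc : Tendsto (fun q : ℝ => 1 / q) (𝓝[>] b) (𝓝 (1 / b)) :=
    ((continuousAt_const.div continuousAt_id hb.ne').tendsto).mono_left nhdsWithin_le_nhds
  obtain ⟨q, h1, h2⟩ := ((hc.eventually (lt_mem_nhds H.sub)).and self_mem_nhdsWithin).exists
  exact ⟨q, h2, h1⟩

/-- The infimum of the admissible levels is attained. -/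
lemma exists_adm_min (hlam : 0 < lam) {u₀ : Euc N → ℝ} {K₀ ℓ₀ : ℝ}
    (h₀ : Adm Ω k R lam u₀ K₀ ℓ₀) :
    ∃ c ≤ ℓ₀, (∀ u K ℓ, Adm Ω k R lam u K ℓ → c ≤ ℓ) ∧
      ∃ u K, Adm Ω k R lam u K c ∧ K + lam * (∫ x, u x ^ 2) = 1 := by
  have hb := H.two_lt_b
  set S : Set ℝ := {ℓ | ∃ u K, Adm Ω k R lam u K ℓ} with hS
  have hbdd : BddBelow S := ⟨0, fun ℓ hℓ => by
    obtain ⟨u, K, h⟩ := hℓ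
    exact h.level_nonneg⟩
  have hne : S.Nonempty := ⟨ℓ₀, u₀, K₀, h₀⟩
  refine ⟨sInf S, csInf_le hbdd ⟨u₀, K₀, h₀⟩, fun u K ℓ h => csInf_le hbdd ⟨u, K, h⟩, ?_⟩
  set c := sInf S with hc
  obtain ⟨ℓ, -, hℓ, hℓS⟩ := exists_seq_tendsto_sInf hne hbdd
  have hnorm : ∀ n, ∃ u K, Adm Ω k R lam u K (ℓ n) ∧ K + lam * (∫ x, u x ^ 2) = 1 := by
    intro n
    obtain ⟨u, K, h⟩ := hℓS n
    have hQ : 0 < K + lam * ∫ x, u x ^ 2 :=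
      add_pos_of_nonneg_of_pos h.en.nonneg (mul_pos hlam h.integral_sq_pos)
    refine ⟨_, _, h.scale (τ := 1 / √(K + lam * ∫ x, u x ^ 2)) (by positivity), ?_⟩
    simp only [mul_pow, integral_const_mul, div_pow, Real.sq_sqrt hQ.le]
    have := hQ.ne'
    field_simp
  choose u K hA hQ1 using hnorm
  have hK1 : ∀ n, K n ≤ 1 := fun n => by
    have := mul_pos hlam (hA n).integral_sq_pos
    linarith [hQ1 n]
  obtain ⟨v, hv, ns, hns, hlim⟩ := En.exists_subseq (fun n => (hA n).en) hK1 (B := 1 / lam)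
    (fun n => by
      rw [le_div_iff₀ hlam]
      linarith [hQ1 n, (hA n).en.nonneg])
  set w : Euc N → ℝ := {x | 0 ≤ v x ∧ (x ∈ Ω ∨ v x = 0)}.indicator v with hw
  have hwv : v =ᵐ[volume] w := by
    obtain ⟨ms, hms, hae⟩ := exists_subseq_tendsto_ae hv (fun n => (hA (ns n)).en.1) hlim
    filter_upwards [hae] with x hx
    rw [hw, indicator_of_mem]
    refine ⟨ge_of_tendsto' hx fun n => (hA _).nonneg x, ?_⟩
    by_cases hxΩ : x ∈ Ω
    · exact Or.inl hxΩ
    · refine Or.inr (tendsto_nhds_unique hx ?_)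
      exact tendsto_const_nhds.congr fun n => ((hA _).off x hxΩ).symm
  have hw2 : MemLp w 2 volume := hv.ae_eq hwv
  have hlimw : Tendsto (fun n => ∫ x, (w x - u (ns n) x) ^ 2) atTop (𝓝 0) := by
    refine hlim.congr fun n => integral_congr_ae (hwv.mono fun x hx => ?_)
    simp only [hx]
  set I := ∫ x, w x ^ 2 with hI
  have hwEn : En R w (1 - lam * I) := by
    refine En.lim hw2 fun δ hδ => ?_
    have h1 := (Real.continuous_sqrt.tendsto 0).comp hlimw
    rw [Real.sqrt_zero] at h1
    have h2 := (h1.const_mul (2 * lam * √I))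
    rw [mul_zero] at h2
    obtain ⟨n, h3, h4⟩ := ((hlimw.eventually (gt_mem_nhds hδ)).and
      (h2.eventually (gt_mem_nhds hδ))).exists
    refine ⟨u (ns n), K (ns n), (hA _).en, h3, ?_⟩
    have h5 := abs_integral_mul_le hw2 (hw2.sub (hA (ns n)).en.1)
    have h6 : I ≤ (∫ x, u (ns n) x ^ 2) + 2 * ∫ x, w x * (w x - u (ns n) x) := by
      have i1 := (hA (ns n)).en.1.integrable_sq
      have i2 := (MemLp.integrable_mul_two hw2 (hw2.sub (hA (ns n)).en.1)).const_mul 2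
      rw [← integral_const_mul]
      refine (integral_mono hw2.integrable_sq (i1.add i2) fun x => ?_).trans_eq
        (integral_add i1 i2)
      simp only [Pi.add_apply, Pi.sub_apply]
      nlinarith [sq_nonneg (w x - u (ns n) x)]
    have h7 := (le_abs_self _).trans h5
    simp only [Pi.sub_apply] at h7
    simp only [Function.comp_apply] at h4
    have h8 := hQ1 (ns n)
    have h9 := mul_le_mul_of_nonneg_left h7 hlam.le
    have h10 := mul_le_mul_of_nonneg_left h6 hlam.le
    nlinarith
  have hI0 : 0 ≤ I := integral_nonneg fun x => sq_nonneg _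
  obtain ⟨q, hbq, hq⟩ := H.exists_subcritical
  obtain ⟨C, hC, hSob⟩ := En.sobolev H.dim (by linarith : 2 ≤ q) hq R
  have hq0 : 0 < q := by linarith
  have hSob1 : ∀ u K, En (N := N) R u K → K ≤ 1 →
      eLpNorm u (ENNReal.ofReal q) volume ≤ ENNReal.ofReal C := fun u K h h1 => by
    refine (hSob u K h).trans (ENNReal.ofReal_le_ofReal ?_)
    exact mul_le_of_le_one_right hC.le (Real.sqrt_le_one.2 h1)
  have hdiff : ∀ n, eLpNorm (fun x => u (ns n) x - w x) (ENNReal.ofReal q) volume ≤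
      ENNReal.ofReal (C + C) := fun n => by
    refine (eLpNorm_sub_le (hA (ns n)).en.1.1 hw2.1 ?_).trans ?_
    · rw [← ENNReal.ofReal_one]
      exact ENNReal.ofReal_le_ofReal (by linarith)
    · rw [ENNReal.ofReal_add hC.le hC.le]
      exact add_le_add (hSob1 _ _ (hA _).en (hK1 _))
        (hSob1 _ _ hwEn (by linarith [mul_nonneg hlam.le hI0]))
  have hP : Tendsto (fun n => ∫ x, pw b (u (ns n) x - w x)) atTop (𝓝 0) := by
    refine tendsto_integral_pw hb hbq (fun n => (hA (ns n)).en.1.sub hw2)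
      (fun n => (integrable_rpow_of_eLpNorm hq0 (by linarith)
        ((hA (ns n)).en.1.1.sub hw2.1) (hdiff n)).1)
      (fun n => (integrable_rpow_of_eLpNorm hq0 (by linarith)
        ((hA (ns n)).en.1.1.sub hw2.1) (hdiff n)).2) ?_
    refine hlimw.congr fun n => ?_
    simp only [sub_sq_comm]
  have hwF : Fp b w := H.fp hwEn
  have hle : ∀ t : ℝ, 0 ≤ t → t ^ 2 / 2 - (∫ x, prim k x (t * w x)) ≤ c := by
    intro t ht
    have h1 := H.tendsto_integral_prim (hwF.const_mul hb t)
      (fun n => (H.fp (hA (ns n)).en).const_mul hb t)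
      (tendsto_integral_pw_mul hb hwF (fun n => H.fp (hA (ns n)).en) hP
        (tendsto_const_nhds (x := t)))
    refine le_of_tendsto_of_tendsto (h1.const_sub (t ^ 2 / 2)) (hℓ.comp hns.tendsto_atTop)
      (Eventually.of_forall fun n => ?_)
    have := (hA (ns n)).le t ht
    rw [hQ1, mul_one] at this
    exact this
  refine ⟨w, 1 - lam * I, ⟨fun x => ?_, fun x hx => ?_, fun h0 => ?_, hwEn, fun t ht => ?_⟩, ?_⟩
  · exact indicator_apply_nonneg fun h => h.1
  · by_cases h : x ∈ {x | 0 ≤ v x ∧ (x ∈ Ω ∨ v x = 0)}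
    · rw [hw, indicator_of_mem h]
      exact h.2.resolve_left hx
    · rw [hw, indicator_of_notMem h]
  · have h1 := hle (|c| + 2) (by positivity)
    have h2 : ∫ x, prim k x ((|c| + 2) * w x) = 0 := by
      rw [integral_eq_zero_of_ae]
      filter_upwards [h0] with x hx
      rw [hx]
      simp [prim_zero]
    rw [h2] at h1
    nlinarith [le_abs_self c, abs_nonneg c]
  · rw [sub_add_cancel, mul_one]
    exact hle t ht
  · rw [← hI]; ring
end Nonlin
end

section
variable {N : ℕ} {Ω : Set (Euc N)} {k : Euc N → ℝ → ℝ} {a b M R lam K c : ℝ} {u v : Euc N → ℝ}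

/-- If no admissible level is below `c`, every competitor has fibre maximum at least `c`. -/
lemma Adm.exists_fibre (hc : ∀ u K ℓ, Adm Ω k R lam u K ℓ → c ≤ ℓ) (h0 : ∀ x, 0 ≤ u x)
    (hoff : ∀ x, x ∉ Ω → u x = 0) (hne : ¬ u =ᵐ[volume] 0) (hen : En R u K) {e : ℝ} (he : 0 < e) :
    ∃ t : ℝ, 0 ≤ t ∧
      c - e ≤ t ^ 2 / 2 * (K + lam * ∫ x, u x ^ 2) - ∫ x, prim k x (t * u x) := by
  by_contra! hcon
  have := hc u K (c - e) ⟨h0, hoff, hne, hen, fun t ht => (hcon t ht).le⟩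
  linarith

lemma Adm.exists_pos (h : Adm Ω k R lam u K c) (hQ : 0 < K + lam * ∫ x, u x ^ 2) :
    ∃ τ : ℝ, 0 < τ ∧ 0 < ∫ x, prim k x (τ * u x) := by
  have hev : ∀ᶠ t : ℝ in atTop, c < t ^ 2 * ((K + lam * ∫ x, u x ^ 2) / 2) :=
    ((tendsto_pow_atTop two_ne_zero).atTop_mul_const (by positivity)).eventually
      (eventually_gt_atTop c)
  obtain ⟨τ, h1, h2⟩ := (hev.and (eventually_gt_atTop 0)).exists
  exact ⟨τ, h2, by linarith [h.le τ h2.le]⟩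

namespace Nonlin
variable (H : Nonlin N Ω k a b M)
include H

lemma Adm_level_pos (h : Adm Ω k R lam u K c) (hQ : 0 < K + lam * ∫ x, u x ^ 2) : 0 < c := by
  have ha := H.two_lt
  have hb := H.two_lt_b
  have hu := H.fp h.en
  set Q := K + lam * ∫ x, u x ^ 2 with hQd
  set P := ∫ x, prim k x (u x) with hP
  have hlim : Tendsto (fun t : ℝ => t ^ (a - 2) * P) (𝓝[>] 0) (𝓝 0) := by
    have : Tendsto (fun t : ℝ => t ^ (a - 2)) (𝓝[>] 0) (𝓝 0) := by
      have := (Real.continuousAt_rpow_const 0 (a - 2) (Or.inr (by linarith))).tendsto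
      rw [Real.zero_rpow (by linarith)] at this
      exact this.mono_left nhdsWithin_le_nhds
    simpa using this.mul_const P
  obtain ⟨t, h1, h2⟩ := ((hlim.eventually (gt_mem_nhds (half_pos hQ))).and
    (Ioo_mem_nhdsGT (one_pos : (0 : ℝ) < 1))).exists
  have h3 := h2.1
  have h4 : ∫ x, prim k x (t * u x) ≤ t ^ a * P := by
    rw [hP, ← integral_const_mul]
    exact integral_mono (H.integrable_prim (hu.const_mul hb t)) ((H.integrable_prim hu).const_mul _)
      fun x => H.prim_mul_le x h3.le h2.2.le (h.nonneg x)
  have h5 : t ^ a = t ^ 2 * t ^ (a - 2) := by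
    rw [← Real.rpow_natCast t 2, ← Real.rpow_add h3]; norm_num
  have h6 := h.le t h3.le
  rw [h5] at h4
  have h7 : 0 < t ^ 2 * (Q / 2 - t ^ (a - 2) * P) := mul_pos (by positivity) (by linarith)
  rw [← hQd] at h6
  nlinarith

/-- At the least level the fibre maximum is attained. -/
lemma Adm_exists_max (h : Adm Ω k R lam u K c) (hQ : 0 < K + lam * ∫ x, u x ^ 2)
    (hc : ∀ u K ℓ, Adm Ω k R lam u K ℓ → c ≤ ℓ) :
    ∃ v K', Adm Ω k R lam v K' c ∧ 0 < K' + lam * (∫ x, v x ^ 2) ∧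
      c = (K' + lam * ∫ x, v x ^ 2) / 2 - ∫ x, prim k x (v x) := by
  have hb := H.two_lt_b
  have hu := H.fp h.en
  obtain ⟨τ, hτ, hτu⟩ := h.exists_pos hQ
  have hfib := fun n : ℕ => Adm.exists_fibre hc h.nonneg h.off h.ne h.en
    (e := 1 / ((n : ℝ) + 1)) Nat.one_div_pos_of_nat
  choose t ht0 ht using hfib
  obtain ⟨t₀, h0, h1, -⟩ := H.exists_subseq_max hu (fun _ => hu) (fun _ => h.nonneg)
    (by simp [pw_zero hb]) tendsto_const_nhds hτ hτu ht0
    tendsto_one_div_add_atTop_nhds_zero_nat ht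
  have hcpos := H.Adm_level_pos h hQ
  have ht₀ : 0 < t₀ := by
    refine h0.lt_of_ne fun h2 => ?_
    subst h2
    simp [prim_zero] at h1
    linarith
  have hle := h.le t₀ h0
  have hI : ∫ x, (t₀ * u x) ^ 2 = t₀ ^ 2 * ∫ x, u x ^ 2 := by
    simp only [mul_pow, integral_const_mul]
  refine ⟨fun x => t₀ * u x, t₀ ^ 2 * K, h.scale ht₀, ?_, ?_⟩
  · rw [hI]
    have : 0 < t₀ ^ 2 * (K + lam * ∫ x, u x ^ 2) := by positivity
    linarith
  · rw [hI]
    linarith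

/-- A fibre maximum satisfies the Nehari identity. -/
lemma Adm_nehari (h : Adm Ω k R lam v K c)
    (hc : c = (K + lam * ∫ x, v x ^ 2) / 2 - ∫ x, prim k x (v x)) :
    ∫ x, k x (v x) * v x = K + lam * ∫ x, v x ^ 2 := by
  have hb := H.two_lt_b
  have hv := H.fp h.en
  set Q := K + lam * ∫ x, v x ^ 2 with hQ
  have key : ∀ t : ℝ, 0 ≤ t → (t - 1) * ((t + 1) / 2 * Q) ≤ (t - 1) * ∫ x, k x (t * v x) * v x := by
    intro t ht
    have i1 := H.integrable_prim (hv.const_mul hb t)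
    have i2 := H.integrable_mul (hv.const_mul hb t) hv
    have h1 : (∫ x, prim k x (t * v x)) ≤ (∫ x, prim k x (v x)) +
        (t - 1) * ∫ x, k x (t * v x) * v x := by
      rw [← integral_const_mul, ← integral_add (H.integrable_prim hv) (i2.const_mul _)]
      refine integral_mono i1 ((H.integrable_prim hv).add (i2.const_mul _)) fun x => ?_
      have := H.prim_convex x (v x) (t * v x)
      linarith
    have h2 := h.le t ht
    rw [← hQ] at h2
    nlinarith
  have hlim : ∀ s : Set ℝ, Tendsto (fun t : ℝ => (t + 1) / 2 * Q) (𝓝[s] 1) (𝓝 Q) ∧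
      Tendsto (fun t : ℝ => ∫ x, k x (t * v x) * v x) (𝓝[s] 1) (𝓝 (∫ x, k x (v x) * v x)) := by
    intro s
    constructor
    · have : Tendsto (fun t : ℝ => (t + 1) / 2 * Q) (𝓝 1) (𝓝 ((1 + 1) / 2 * Q)) :=
        Continuous.tendsto (by fun_prop) 1
      rw [show ((1 : ℝ) + 1) / 2 * Q = Q by ring] at this
      exact this.mono_left nhdsWithin_le_nhds
    · simpa using H.tendsto_integral_mul hv hv
        ((tendsto_id (x := 𝓝 (1 : ℝ))).mono_left (nhdsWithin_le_nhds (s := s)))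
  apply le_antisymm
  · refine le_of_tendsto_of_tendsto (hlim (Iio 1)).2 (hlim (Iio 1)).1 ?_
    filter_upwards [Ioo_mem_nhdsLT (show (0 : ℝ) < 1 from one_pos)] with t ht
    have := key t ht.1.le
    have h1 := ht.2
    exact le_of_mul_le_mul_left (by linarith : (1 - t) * _ ≤ (1 - t) * _) (by linarith)
  · refine le_of_tendsto_of_tendsto (hlim (Ioi 1)).1 (hlim (Ioi 1)).2 ?_
    filter_upwards [self_mem_nhdsWithin] with t ht
    have ht' : 1 < t := ht
    exact le_of_mul_le_mul_left (key t (by linarith)) (by linarith)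

lemma Adm_fibre_lt (h : Adm Ω k R lam v K c) (hQ : 0 < K + lam * ∫ x, v x ^ 2)
    (hc : c = (K + lam * ∫ x, v x ^ 2) / 2 - ∫ x, prim k x (v x)) {t : ℝ} (ht : 0 ≤ t)
    (ht1 : t ≠ 1) :
    t ^ 2 / 2 * (K + lam * ∫ x, v x ^ 2) - (∫ x, prim k x (t * v x)) < c := by
  have hb := H.two_lt_b
  have hv := H.fp h.en
  have hN := H.Adm_nehari h hc
  set Q := K + lam * ∫ x, v x ^ 2 with hQd
  have h1 : (∫ x, prim k x (v x)) + ((t ^ a - 1) / a) * Q ≤ ∫ x, prim k x (t * v x) := by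
    have i2 := (H.integrable_mul hv hv).const_mul ((t ^ a - 1) / a)
    rw [← hN, ← integral_const_mul, ← integral_add (H.integrable_prim hv) i2]
    refine integral_mono ((H.integrable_prim hv).add i2) (H.integrable_prim (hv.const_mul hb t))
      fun x => ?_
    have := H.prim_mul_ge x ht (h.nonneg x)
    linarith
  have h2 := half_sq_sub_rpow_lt H.two_lt ht ht1
  nlinarith

lemma Adm_sq_le (h : Adm Ω k R lam v K c)
    (hc : c = (K + lam * ∫ x, v x ^ 2) / 2 - ∫ x, prim k x (v x)) :
    lam * (1 / 2 - 1 / a) * (∫ x, v x ^ 2) ≤ c := by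
  have hv := H.fp h.en
  have ha := H.two_lt
  have hN := H.Adm_nehari h hc
  have h1 : (∫ x, prim k x (v x)) ≤ (∫ x, k x (v x) * v x) / a := by
    rw [← integral_div]
    exact integral_mono (H.integrable_prim hv) ((H.integrable_mul hv hv).div_const _)
      fun x => H.prim_le x (h.nonneg x)
  rw [hN] at h1
  have h2 : 0 ≤ (1 / 2 - 1 / a) * K :=
    mul_nonneg (sub_nonneg.2 (one_div_le_one_div_of_le two_pos ha.le)) h.en.nonneg
  have h3 : (K + lam * ∫ x, v x ^ 2) / a = 1 / a * (K + lam * ∫ x, v x ^ 2) := by ring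
  nlinarith

/-- Weak supersolution property of a minimizer, against test functions that are nonpositive
outside `Ω`. -/
lemma Adm_weak (h : Adm Ω k R lam v K c) (hlam : 0 < lam) (hQ : 0 < K + lam * ∫ x, v x ^ 2)
    (hmin : ∀ u K ℓ, Adm Ω k R lam u K ℓ → c ≤ ℓ)
    (hc : c = (K + lam * ∫ x, v x ^ 2) / 2 - ∫ x, prim k x (v x)) {φ : Euc N → ℝ} (hφ : Tst φ)
    (hΩ : ∀ x, x ∉ Ω → φ x ≤ 0) (hR : ∀ x, R < ‖x‖ → φ x = 0) :
    ∫ x, k x (v x) * φ x ≤ -(∫ x, v x * lap φ x) + lam * ∫ x, v x * φ x := by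
  have hb := H.two_lt_b
  have hv := H.fp h.en
  have hφF := hφ.fp hb
  obtain ⟨τ, hτ, hτv⟩ := h.exists_pos hQ
  set Q := K + lam * ∫ x, v x ^ 2 with hQd
  set B := -(∫ x, v x * lap φ x) + lam * ∫ x, v x * φ x with hB
  set G := Dir φ + lam * ∫ x, φ x ^ 2 with hG
  have hFen : ∀ s : ℝ, En R (fun x => max (v x + s * φ x) 0)
      (K - 2 * s * (∫ x, v x * lap φ x) + s ^ 2 * Dir φ) := fun s =>
    (h.en.add_smul hφ hR s).pos_part
  have hFp : ∀ s : ℝ, Fp b (fun x => max (v x + s * φ x) 0) := fun s => H.fp (hFen s)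
  have hdist : ∀ s : ℝ, ∫ x, pw b (max (v x + s * φ x) 0 - v x) ≤ pw b s * ∫ x, pw b (φ x) := by
    intro s
    rw [← integral_const_mul]
    refine integral_mono ((hFp s).sub hb hv).2 (hφF.2.const_mul _) fun x => ?_
    refine (pw_mono hb ?_).trans (pw_mul_le b s (φ x))
    have h1 := abs_max_sub_max_le_abs (v x + s * φ x) (v x) 0
    rw [max_eq_left (h.nonneg x)] at h1
    simpa using h1
  have hlim : ∀ s : ℕ → ℝ, Tendsto s atTop (𝓝 0) →
      Tendsto (fun n => ∫ x, pw b (max (v x + s n * φ x) 0 - v x)) atTop (𝓝 0) := by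
    intro s hs
    refine squeeze_zero (fun n => integral_pw_nonneg _ _) (fun n => hdist (s n)) ?_
    have := (((continuous_pw hb).tendsto 0).comp hs).mul_const (∫ x, pw b (φ x))
    simpa [pw_zero hb] using this
  have hev : ∀ᶠ n : ℕ in atTop,
      0 < ∫ x, prim k x (τ * max (v x + 1 / ((n : ℝ) + 1) * φ x) 0) := by
    have := H.tendsto_integral_prim (hv.const_mul hb τ) (fun n : ℕ =>
      (hFp (1 / ((n : ℝ) + 1))).const_mul hb τ) (tendsto_integral_pw_mul hb hv
      (fun n : ℕ => hFp (1 / ((n : ℝ) + 1)))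
      (hlim _ tendsto_one_div_add_atTop_nhds_zero_nat) (tendsto_const_nhds (x := τ)))
    exact this.eventually (lt_mem_nhds hτv)
  obtain ⟨n₀, hn₀⟩ := eventually_atTop.1 hev
  set s : ℕ → ℝ := fun n => 1 / (((n + n₀ : ℕ) : ℝ) + 1) with hs
  have hs0 : ∀ n, 0 < s n := fun n => Nat.one_div_pos_of_nat
  have hslim : Tendsto s atTop (𝓝 0) :=
    tendsto_one_div_add_atTop_nhds_zero_nat.comp (tendsto_add_atTop_nat n₀)
  have hfib := fun n : ℕ => Adm.exists_fibre hmin (u := fun x => max (v x + s n * φ x) 0)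
    (K := K - 2 * s n * (∫ x, v x * lap φ x) + s n ^ 2 * Dir φ) (e := s n ^ 2)
    (fun x => le_max_right _ _)
    (fun x hx => by
      rw [h.off x hx, zero_add]
      exact max_eq_right (mul_nonpos_of_nonneg_of_nonpos (hs0 n).le (hΩ x hx)))
    (fun h0 => by
      refine (hn₀ (n + n₀) (Nat.le_add_left _ _)).ne' (integral_eq_zero_of_ae ?_)
      filter_upwards [h0] with x hx
      simp only [Pi.zero_apply] at hx ⊢
      rw [show max (v x + 1 / (((n + n₀ : ℕ) : ℝ) + 1) * φ x) 0 = 0 from hx, mul_zero, prim_zero])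
    (hFen _) (by have := hs0 n; positivity)
  choose t ht0 ht using hfib
  have hvφ : Integrable (fun x => v x * φ x) volume :=
    MemLp.integrable_mul_two h.en.1 (hφ.memLp 2)
  have hQs : ∀ n, (K - 2 * s n * (∫ x, v x * lap φ x) + s n ^ 2 * Dir φ) +
      lam * (∫ x, (max (v x + s n * φ x) 0) ^ 2) ≤ Q + 2 * s n * B + s n ^ 2 * G := by
    intro n
    have i1 := h.en.1.integrable_sq
    have i2 := hvφ.const_mul (2 * s n)
    have i3 := (hφ.memLp 2).integrable_sq.const_mul (s n ^ 2)
    have h1 : ∫ x, (max (v x + s n * φ x) 0) ^ 2 ≤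
        (∫ x, v x ^ 2) + 2 * s n * (∫ x, v x * φ x) + s n ^ 2 * ∫ x, φ x ^ 2 := by
      rw [← integral_const_mul, ← integral_const_mul, ← integral_add i1 i2,
        ← integral_add (f := fun x => v x ^ 2 + 2 * s n * (v x * φ x)) (i1.add i2) i3]
      refine integral_mono (hFen (s n)).1.integrable_sq ((i1.add i2).add i3) fun x => ?_
      have h2 : max (v x + s n * φ x) 0 ^ 2 ≤ (v x + s n * φ x) ^ 2 := by
        rcases le_total (v x + s n * φ x) 0 with h3 | h3
        · rw [max_eq_right h3]; nlinarith
        · rw [max_eq_left h3]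
      linarith
    have := mul_le_mul_of_nonneg_left h1 hlam.le
    rw [hQd, hB, hG]
    linarith
  have ht' : ∀ n, c - s n ^ 2 ≤ t n ^ 2 / 2 * (Q + 2 * s n * B + s n ^ 2 * G) -
      ∫ x, prim k x (t n * max (v x + s n * φ x) 0) := fun n => by
    have := mul_le_mul_of_nonneg_left (hQs n) (by positivity : 0 ≤ t n ^ 2 / 2)
    linarith [ht n]
  have hQlim : Tendsto (fun n => Q + 2 * s n * B + s n ^ 2 * G) atTop (𝓝 Q) := by
    have := (((hslim.const_mul 2).mul_const B).const_add Q).add ((hslim.pow 2).mul_const G)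
    simpa using this
  obtain ⟨t₀, h0, h1, ns, hns, htlim⟩ := H.exists_subseq_max hv (fun n => hFp (s n))
    (fun n x => le_max_right _ _) (hlim s hslim) hQlim hτ hτv ht0
    (by simpa using hslim.pow 2) ht'
  have ht₀ : t₀ = 1 := by
    by_contra hne
    exact absurd (H.Adm_fibre_lt h hQ hc h0 hne) (not_lt.2 h1)
  subst ht₀
  have hkey : ∀ n, t n * (∫ x, k x (t n * v x) * φ x) ≤
      t n ^ 2 * B + t n ^ 2 / 2 * (s n * G) + s n := by
    intro n
    have i1 := H.integrable_mul (hv.const_mul hb (t n)) hφF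
    have h2 : (∫ x, prim k x (t n * v x)) + t n * s n * (∫ x, k x (t n * v x) * φ x) ≤
        ∫ x, prim k x (t n * max (v x + s n * φ x) 0) := by
      have i2 := H.integrable_prim (hv.const_mul hb (t n))
      rw [← integral_const_mul, ← integral_add i2 (i1.const_mul _)]
      refine integral_mono (i2.add (i1.const_mul _))
        (H.integrable_prim ((hFp (s n)).const_mul hb (t n))) fun x => ?_
      have h3 := H.prim_convex x (t n * max (v x + s n * φ x) 0) (t n * v x)
      have h4 : k x (t n * v x) * (t n * (v x + s n * φ x) - t n * v x) ≤
          k x (t n * v x) * (t n * max (v x + s n * φ x) 0 - t n * v x) := by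
        refine mul_le_mul_of_nonneg_left ?_ (H.nonneg _ _)
        have := mul_le_mul_of_nonneg_left (le_max_left (v x + s n * φ x) 0) (ht0 n)
        linarith
      nlinarith
    have h5 := h.le (t n) (ht0 n)
    have h6 := ht' n
    refine le_of_mul_le_mul_left ?_ (hs0 n)
    rw [← hQd] at h5
    nlinarith
  have hsl := hslim.comp hns.tendsto_atTop
  have l1 := htlim.mul (H.tendsto_integral_mul hv hφF htlim)
  have l2 := (((htlim.pow 2).mul_const B).add
    (((htlim.pow 2).div_const 2).mul (hsl.mul_const G))).add hsl
  have := le_of_tendsto_of_tendsto l1 l2 (Eventually.of_forall fun n => hkey (ns n))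
  simpa using this

/-- Existence of a minimizer below a given admissible level. -/
lemma exists_weak_solution (hlam : 0 < lam) {u₀ : Euc N → ℝ} {K₀ ℓ₀ : ℝ}
    (h₀ : Adm Ω k R lam u₀ K₀ ℓ₀) :
    ∃ v K, (∀ x, 0 ≤ v x) ∧ (∀ x, x ∉ Ω → v x = 0) ∧ (¬ v =ᵐ[volume] 0) ∧ En R v K ∧
      lam * (1 / 2 - 1 / a) * (∫ x, v x ^ 2) ≤ ℓ₀ ∧
      ∀ φ : Euc N → ℝ, Tst φ → (∀ x, x ∉ Ω → φ x ≤ 0) → (∀ x, R < ‖x‖ → φ x = 0) →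
        ∫ x, k x (v x) * φ x ≤ -(∫ x, v x * lap φ x) + lam * ∫ x, v x * φ x := by
  obtain ⟨c, hcℓ, hmin, u, K, hu, hQ⟩ := H.exists_adm_min hlam h₀
  obtain ⟨v, K', hv, hQ', hc⟩ := H.Adm_exists_max hu (hQ ▸ one_pos) hmin
  exact ⟨v, K', hv.nonneg, hv.off, hv.ne, hv.en, (H.Adm_sq_le hv hc).trans hcℓ,
    fun φ hφ h1 h2 => H.Adm_weak hv hlam hQ' hmin hc hφ h1 h2⟩
end Nonlin
end

section
variable {N : ℕ}

/-- A bootstrap for integral inequalities with a small kernel. -/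
lemma ae_le_of_le_add_lintegral {G V U : Euc N → ENNReal} {A : ENNReal} (hG : Measurable G)
    (hGs : ∀ z, G (-z) = G z) (hV : Measurable V) (hU : Measurable U)
    (h : ∀ᵐ x, U x ≤ A + ∫⁻ y, G (x - y) * (V y * U y))
    (hK : ∀ x, ∫⁻ y, G (x - y) * V y ≤ 1 / 2) (hfin : ∫⁻ x, V x * U x ≠ ⊤) :
    ∀ᵐ x, U x ≤ 2 * A := by
  set e : Euc N → ENNReal := fun x => U x - 2 * A with he
  have hem : Measurable e := hU.sub_const _
  have hGx : ∀ x, Measurable fun y => G (x - y) := fun x =>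
    hG.comp (measurable_const.sub measurable_id)
  have hVe : Measurable fun y => V y * e y := hV.mul hem
  have hGV : ∀ x, Measurable fun y => G (x - y) * V y := fun x => (hGx x).mul hV
  have hGVe : ∀ x, Measurable fun y => G (x - y) * (V y * e y) := fun x => (hGx x).mul hVe
  have hle : ∀ᵐ x, e x ≤ ∫⁻ y, G (x - y) * (V y * e y) := by
    filter_upwards [h] with x hx
    have h1 : ∫⁻ y, G (x - y) * (V y * U y) ≤ A + ∫⁻ y, G (x - y) * (V y * e y) := by
      calc ∫⁻ y, G (x - y) * (V y * U y)
          ≤ ∫⁻ y, (G (x - y) * V y * (2 * A) + G (x - y) * (V y * e y)) := by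
            refine lintegral_mono fun y => ?_
            rw [mul_assoc, ← mul_add, ← mul_add]
            gcongr
            exact le_add_tsub
        _ = (∫⁻ y, G (x - y) * V y) * (2 * A) + ∫⁻ y, G (x - y) * (V y * e y) := by
            rw [lintegral_add_left ((hGV x).mul_const _), lintegral_mul_const _ (hGV x)]
        _ ≤ 1 / 2 * (2 * A) + ∫⁻ y, G (x - y) * (V y * e y) := by
            gcongr
            exact hK x
        _ = _ := by
            rw [← mul_assoc, ENNReal.div_mul_cancel (by simp) (by simp), one_mul]
    refine tsub_le_iff_left.2 (hx.trans ?_)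
    rw [two_mul, add_assoc]
    gcongr
  have hswap : ∫⁻ x, V x * e x ≤ (∫⁻ x, V x * e x) / 2 := by
    calc ∫⁻ x, V x * e x ≤ ∫⁻ x, ∫⁻ y, V x * (G (x - y) * (V y * e y)) := by
          refine lintegral_mono_ae (hle.mono fun x hx => ?_)
          rw [lintegral_const_mul _ (hGVe x)]
          gcongr
      _ = ∫⁻ y, ∫⁻ x, V x * (G (x - y) * (V y * e y)) := by
          refine lintegral_lintegral_swap (Measurable.aemeasurable ?_)
          have h1 : Measurable fun q : Euc N × Euc N => G (q.1 - q.2) :=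
            hG.comp (measurable_fst.sub measurable_snd)
          exact (hV.comp measurable_fst).mul (h1.mul (hVe.comp measurable_snd))
      _ ≤ ∫⁻ y, (V y * e y) * (1 / 2) := by
          refine lintegral_mono fun y => ?_
          have h1 : ∀ x, V x * (G (x - y) * (V y * e y)) = (V y * e y) * (G (y - x) * V x) := by
            intro x
            rw [← neg_sub, hGs]; ring
          simp only [h1]
          rw [lintegral_const_mul _ (hGV y)]
          gcongr
          exact hK y
      _ = _ := by
          rw [lintegral_mul_const _ hVe, ENNReal.div_eq_inv_mul, mul_one, mul_comm,
            ENNReal.div_eq_inv_mul]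
  have hfin' : ∫⁻ x, V x * e x ≠ ⊤ := by
    refine ne_top_of_le_ne_top hfin (lintegral_mono fun x => ?_)
    gcongr
    exact tsub_le_self
  have h0 : ∫⁻ x, V x * e x = 0 := by
    by_contra hne
    exact absurd hswap (not_le.2 (ENNReal.half_lt_self hne hfin'))
  rw [lintegral_eq_zero_iff hVe] at h0
  filter_upwards [hle] with x hx
  have : ∫⁻ y, G (x - y) * (V y * e y) = 0 := by
    rw [lintegral_eq_zero_iff (hGVe x)]
    filter_upwards [h0] with y hy
    simp only [Pi.zero_apply] at hy ⊢
    rw [hy, mul_zero]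
  rw [this] at hx
  exact tsub_eq_zero_iff_le.1 (le_antisymm hx zero_le)

/-- The truncated potential kernel. -/
def gk (r : ℝ) (z : Euc N) : ENNReal := ∫⁻ ε in Ioc 0 r, ENNReal.ofReal (ε * sg ε z)

lemma sg_measurable : Measurable fun q : ℝ × Euc N => sg q.1 q.2 := by
  have := contDiff_T0.continuous.measurable
  unfold sg
  fun_prop

lemma gk_measurable (r : ℝ) : Measurable (gk r : Euc N → ENNReal) := by
  refine Measurable.lintegral_prod_right'
    (f := fun q : Euc N × ℝ => ENNReal.ofReal (q.2 * sg q.2 q.1)) ?_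
  exact (measurable_snd.mul (sg_measurable.comp measurable_swap)).ennreal_ofReal

lemma gk_neg (r : ℝ) (z : Euc N) : gk r (-z) = gk r z := by
  simp only [gk, sg_neg]

lemma lintegral_gk_mul (r : ℝ) {W : Euc N → ENNReal} (hW : Measurable W) (x : Euc N) :
    ∫⁻ y, gk r (x - y) * W y =
      ∫⁻ ε in Ioc 0 r, ∫⁻ y, ENNReal.ofReal (ε * sg ε (x - y)) * W y := by
  have hm : Measurable fun q : ℝ × Euc N =>
      ENNReal.ofReal (q.1 * sg q.1 (x - q.2)) * W q.2 := by
    refine Measurable.mul ?_ (hW.comp measurable_snd)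
    refine (measurable_fst.mul ?_).ennreal_ofReal
    exact sg_measurable.comp (measurable_fst.prodMk (measurable_const.sub measurable_snd))
  rw [lintegral_lintegral_swap hm.aemeasurable]
  refine lintegral_congr fun y => ?_
  rw [lintegral_mul_const]
  · rfl
  · exact (measurable_id.mul (sg_measurable.comp
      (measurable_id.prodMk measurable_const))).ennreal_ofReal

lemma ofReal_integral_le {α : Type*} [MeasurableSpace α] {μ : Measure α} {f : α → ℝ}
    (hf : Integrable f μ) : ENNReal.ofReal (∫ x, f x ∂μ) ≤ ∫⁻ x, ENNReal.ofReal (f x) ∂μ := by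
  have h1 : Integrable (fun x => max (f x) 0) μ := hf.pos_part
  calc ENNReal.ofReal (∫ x, f x ∂μ) ≤ ENNReal.ofReal (∫ x, max (f x) 0 ∂μ) :=
        ENNReal.ofReal_le_ofReal (integral_mono hf h1 fun x => le_max_left _ _)
    _ = ∫⁻ x, ENNReal.ofReal (max (f x) 0) ∂μ :=
        ofReal_integral_eq_lintegral_ofReal h1 (Eventually.of_forall fun x => le_max_right _ _)
    _ = _ := by simp

/-- Representation inequality for weak subsolutions. -/
lemma ofReal_cv_rh_le {u h : Euc N → ℝ} (hu : Integrable u) (hh : Integrable h) (hhm : Measurable h)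
    {x : Euc N} {δ r : ℝ} (hδ : 0 < δ) (hr : δ ≤ r)
    (hsub : ∀ ε, 0 < ε → ε ≤ r → -(∫ y, u y * lap (fun y => sg ε (x - y)) y) ≤ cv (sg ε) h x) :
    ENNReal.ofReal (cv (rh δ) u x) ≤ ENNReal.ofReal (cv (rh r) u x) +
      ∫⁻ y, gk r (x - y) * ENNReal.ofReal (h y) := by
  have h1 := cv_rh_sub hδ hr hu x
  have hI := cv_lk_intervalIntegrable hδ hr hu x
  rw [intervalIntegral.integral_of_le hr] at h1
  rw [intervalIntegrable_iff_integrableOn_Ioc_of_le hr] at hI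
  have h2 : cv (rh δ) u x = cv (rh r) u x + ∫ ε in Ioc δ r, -cv (lk ε) u x := by
    rw [integral_neg, ← h1]; ring
  rw [h2]
  refine ENNReal.ofReal_add_le.trans ?_
  gcongr
  refine (ofReal_integral_le hI.neg).trans ?_
  rw [lintegral_gk_mul r hhm.ennreal_ofReal]
  refine (lintegral_mono_set (Ioc_subset_Ioc_left hδ.le)).trans ?_
  refine setLIntegral_mono' measurableSet_Ioc fun ε hε => ?_
  have hε0 := hε.1
  have hs0 : ∀ y, 0 ≤ ε * sg ε (x - y) := fun y => mul_nonneg hε0.le (sg_nonneg hε0 _)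
  have h3 : -cv (lk ε) u x ≤ ∫ y, ε * sg ε (x - y) * h y := by
    rw [cv_lk_eq]
    have := mul_le_mul_of_nonneg_left (hsub ε hε0 hε.2) hε0.le
    unfold cv at this
    rw [← integral_const_mul] at this
    refine le_trans (by linarith) (this.trans_eq ?_)
    exact integral_congr_ae (Eventually.of_forall fun y => by ring)
  refine (ENNReal.ofReal_le_ofReal h3).trans ?_
  refine (ofReal_integral_le ?_).trans_eq ?_
  · exact ((cv_integrable (Tst_sg hε0) hh x).const_mul ε).congr
      (Eventually.of_forall fun y => by ring)
  · exact lintegral_congr fun y => ENNReal.ofReal_mul (hs0 y)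
end

section
variable {N : ℕ} {Ω : Set (Euc N)} {k : Euc N → ℝ → ℝ} {a b M : ℝ} {u : Euc N → ℝ}

lemma rpow_sub_two_le (hb : 2 < b) {t η : ℝ} (ht : 0 ≤ t) (hη : 0 < η) :
    t ^ (b - 2) ≤ η + η ^ (1 - b / (b - 2)) * t ^ b := by
  have hb2 : b - 2 ≠ 0 := by linarith
  have h0 : 0 ≤ t ^ (b - 2) := by positivity
  rcases le_or_gt (t ^ (b - 2)) η with h | h
  · have : 0 ≤ η ^ (1 - b / (b - 2)) * t ^ b := by positivity
    linarith
  · have h1 : (t ^ (b - 2)) ^ (1 - b / (b - 2)) ≤ η ^ (1 - b / (b - 2)) := by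
      refine Real.rpow_le_rpow_of_nonpos hη h.le ?_
      rw [sub_nonpos, one_le_div (by linarith)]
      linarith
    have h2 : t ^ (b - 2) = (t ^ (b - 2)) ^ (1 - b / (b - 2)) * t ^ b := by
      have ht0 : 0 < t := ht.lt_of_ne fun h3 => by
        rw [← h3, Real.zero_rpow hb2] at h
        linarith
      rw [← Real.rpow_mul ht, ← Real.rpow_add ht0]
      congr 1
      field_simp
      ring
    have h3 : 0 ≤ t ^ b := by positivity
    nlinarith

lemma exists_gk_small (hb : 2 < b) (hN : 2 ≤ N) (hbN : (1 : ℝ) / 2 - 1 / N < 1 / b) (hM : 0 ≤ M)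
    (hu : Integrable (fun x => |u x| ^ b)) (hum : Measurable u) :
    ∃ r : ℝ, 0 < r ∧ r ≤ 1 ∧
      ∀ x, ∫⁻ y, gk r (x - y) * ENNReal.ofReal (M * (1 + |u y| ^ (b - 2))) ≤ 1 / 2 := by
  have hN0 : (0 : ℝ) < N := by
    have : 0 < N := by omega
    exact_mod_cast this
  obtain ⟨C, hC0, hC⟩ := rh_bdd N
  set θ : ℝ := N * (b - 2) / b with hθ
  set I := ∫ x, |u x| ^ b with hI
  have hI0 : 0 ≤ I := integral_nonneg fun x => by positivity
  set D := M * (1 + C / 2 * I) with hD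
  have hD0 : 0 ≤ D := by positivity
  have hθ0 : 0 < θ := div_pos (mul_pos hN0 (by linarith)) (by linarith)
  have hθ2 : θ < 2 := by
    rw [hθ, div_lt_iff₀ (by linarith)]
    have h1 : (N : ℝ) * b * ((1 : ℝ) / 2 - 1 / N) < N * b * (1 / b) :=
      mul_lt_mul_of_pos_left hbN (mul_pos hN0 (by linarith))
    have hb0 : b ≠ 0 := by linarith
    field_simp at h1
    linarith
  have hlim : Tendsto (fun r : ℝ => D * (r ^ (2 - θ) / (2 - θ))) (𝓝[>] 0) (𝓝 0) := by
    have := (Real.continuousAt_rpow_const 0 (2 - θ) (Or.inr (by linarith))).tendsto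
    rw [Real.zero_rpow (by linarith)] at this
    simpa using ((this.mono_left nhdsWithin_le_nhds).div_const (2 - θ)).const_mul D
  obtain ⟨r, hr1, hr2⟩ := ((hlim.eventually (gt_mem_nhds (by norm_num : (0 : ℝ) < 1 / 2))).and
    (Ioc_mem_nhdsGT (one_pos : (0 : ℝ) < 1))).exists
  refine ⟨r, hr2.1, hr2.2, fun x => ?_⟩
  rw [lintegral_gk_mul r (by fun_prop)]
  have hinner : ∀ ε ∈ Ioc 0 r, ∫⁻ y, ENNReal.ofReal (ε * sg ε (x - y)) *
      ENNReal.ofReal (M * (1 + |u y| ^ (b - 2))) ≤ ENNReal.ofReal (D * ε ^ (1 - θ)) := by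
    intro ε hε
    have hε0 := hε.1
    have hi : Integrable (fun y => M * ε ^ (1 - θ) * (rh ε (x - y) + C / 2 * |u y| ^ b)) :=
      (((Tst_rh hε0).reflect x).integrable.add (hu.const_mul _)).const_mul _
    have hval : ∫ y, M * ε ^ (1 - θ) * (rh ε (x - y) + C / 2 * |u y| ^ b) = D * ε ^ (1 - θ) := by
      rw [integral_const_mul, integral_add ((Tst_rh hε0).reflect x).integrable (hu.const_mul _),
        integral_const_mul, integral_sub_left_eq_self (rh ε) volume x, integral_rh hε0, hD]
      ring
    rw [← hval, ofReal_integral_eq_lintegral_ofReal hi (Eventually.of_forall fun y => ?_)]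
    · refine lintegral_mono fun y => ?_
      rw [← ENNReal.ofReal_mul (mul_nonneg hε0.le (sg_nonneg hε0 _))]
      refine ENNReal.ofReal_le_ofReal ?_
      have h1 := rpow_sub_two_le hb (abs_nonneg (u y)) (Real.rpow_pos_of_pos hε0 (-θ))
      have h2 : (ε ^ (-θ)) ^ (1 - b / (b - 2)) = ε ^ (-θ) * ε ^ N := by
        rw [← Real.rpow_natCast ε N, ← Real.rpow_add hε0, ← Real.rpow_mul hε0.le, hθ]
        congr 1
        have : b - 2 ≠ 0 := by linarith
        have : b ≠ 0 := by linarith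
        field_simp
        ring
      rw [h2] at h1
      have h3 : 1 ≤ ε ^ (-θ) :=
        Real.one_le_rpow_of_pos_of_le_one_of_nonpos hε0 (hε.2.trans hr2.2) (by linarith)
      have h4 : ε ^ (1 - θ) = ε * ε ^ (-θ) := by
        rw [sub_eq_add_neg, Real.rpow_add hε0, Real.rpow_one]
      have h5 := sg_le_rh hε0 (x - y)
      have h6 : ε ^ N * sg ε (x - y) ≤ C / 2 := by
        have h7 := hC ε hε0 (x - y)
        have h8 : ε ^ N * (ε⁻¹) ^ N = 1 := by
          rw [← mul_pow, mul_inv_cancel₀ hε0.ne', one_pow]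
        have h9 : ε ^ N * sg ε (x - y) ≤ ε ^ N * (C * (ε⁻¹) ^ N / 2) :=
          mul_le_mul_of_nonneg_left (by linarith) (by positivity)
        have h10 : ε ^ N * (C * (ε⁻¹) ^ N / 2) = C / 2 * (ε ^ N * (ε⁻¹) ^ N) := by ring
        rw [h10, h8, mul_one] at h9
        exact h9
      have hs := sg_nonneg hε0 (x - y)
      have hU : 0 ≤ |u y| ^ b := by positivity
      have hA : (1 + |u y| ^ (b - 2)) * sg ε (x - y) ≤
          ε ^ (-θ) * (rh ε (x - y) + C / 2 * |u y| ^ b) := by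
        have e1 : (1 + |u y| ^ (b - 2)) * sg ε (x - y) ≤
            (2 * ε ^ (-θ) + ε ^ (-θ) * ε ^ N * |u y| ^ b) * sg ε (x - y) :=
          mul_le_mul_of_nonneg_right (by linarith) hs
        have e2 : ε ^ (-θ) * |u y| ^ b * (ε ^ N * sg ε (x - y)) ≤
            ε ^ (-θ) * |u y| ^ b * (C / 2) := mul_le_mul_of_nonneg_left h6 (by positivity)
        have e3 : ε ^ (-θ) * (2 * sg ε (x - y)) ≤ ε ^ (-θ) * rh ε (x - y) :=
          mul_le_mul_of_nonneg_left (by linarith) (by positivity)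
        linarith
      have := mul_le_mul_of_nonneg_left hA (by positivity : 0 ≤ M * ε)
      rw [h4]
      linarith
    · have := rh_nonneg hε0 (x - y)
      positivity
  refine (setLIntegral_mono' measurableSet_Ioc hinner).trans ?_
  have h_int : IntervalIntegrable (fun ε : ℝ => D * ε ^ (1 - θ)) volume 0 r :=
    (intervalIntegral.intervalIntegrable_rpow' (by linarith)).const_mul D
  rw [intervalIntegrable_iff_integrableOn_Ioc_of_le hr2.1.le] at h_int
  rw [← ofReal_integral_eq_lintegral_ofReal h_int]
  · rw [← intervalIntegral.integral_of_le hr2.1.le, intervalIntegral.integral_const_mul,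
      integral_rpow (Or.inl (by linarith)), show 1 - θ + 1 = 2 - θ by ring,
      Real.zero_rpow (by linarith), sub_zero]
    refine (ENNReal.ofReal_le_ofReal hr1.le).trans_eq ?_
    rw [ENNReal.ofReal_div_of_pos two_pos]; simp
  · refine (ae_restrict_iff' measurableSet_Ioc).2 (Eventually.of_forall fun ε hε => ?_)
    have := hε.1
    positivity

lemma fp_indicator_one (hb : 2 < b) (R : ℝ) :
    Fp b ((Metric.closedBall (0 : Euc N) R).indicator fun _ => 1) := by
  have hm := measurableSet_closedBall (x := (0 : Euc N)) (ε := R)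
  refine Fp.of_le hb (measurable_const.indicator hm).aestronglyMeasurable
    (F := (Metric.closedBall (0 : Euc N) R).indicator fun _ => pw b 1) ?_ fun x => ?_
  · exact (integrable_indicator_iff hm).2 (integrableOn_const measure_closedBall_lt_top.ne)
  · by_cases hx : x ∈ Metric.closedBall (0 : Euc N) R
    · rw [indicator_of_mem hx, indicator_of_mem hx]
    · rw [indicator_of_notMem hx, indicator_of_notMem hx, pw_zero hb]

lemma Fp.integrable_of_support (hb : 2 < b) (hu : Fp b u) {R : ℝ} (hR : ∀ x, R < ‖x‖ → u x = 0) :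
    Integrable u := by
  refine (MemLp.integrable_mul_two hu.memLp (fp_indicator_one hb R).memLp).congr
    (Eventually.of_forall fun x => ?_)
  by_cases hx : x ∈ Metric.closedBall (0 : Euc N) R
  · simp [indicator_of_mem hx]
  · rw [mem_closedBall_zero_iff, not_le] at hx
    simp [hR x hx]

namespace Nonlin
variable (H : Nonlin N Ω k a b M)
include H

lemma integrable_comp {R : ℝ} (hΩ : ∀ x ∈ Ω, ‖x‖ ≤ R) (hu : Fp b u) :
    Integrable (fun x => k x (u x)) := by
  refine (H.integrable_mul hu (fp_indicator_one H.two_lt_b R)).congr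
    (Eventually.of_forall fun x => ?_)
  by_cases hx : x ∈ Ω
  · simp [hΩ x hx]
  · simp [H.off x _ hx]

/-- Weak subsolutions are bounded. -/
lemma exists_ae_bound {R : ℝ} (hΩ : ∀ x ∈ Ω, ‖x‖ ≤ R) (hu : Fp b u) (hum : Measurable u)
    (hu0 : ∀ x, 0 ≤ u x) (hR : ∀ x, R < ‖x‖ → u x = 0)
    (hsub : ∀ x, ‖x‖ ≤ R → ∀ ε, 0 < ε → ε ≤ 1 →
      -(∫ y, u y * lap (fun y => sg ε (x - y)) y) ≤ cv (sg ε) (fun y => k y (u y)) x) :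
    ∃ B, 0 ≤ B ∧ ∀ᵐ x, u x ≤ B := by
  have hb := H.two_lt_b
  have hui := hu.integrable_of_support hb hR
  have hub : Integrable (fun x => |u x| ^ b) := by
    refine (hu.2.sub hu.memLp.integrable_sq).congr (Eventually.of_forall fun x => ?_)
    simp [pw]
  obtain ⟨r, hr0, hr1, hr⟩ := exists_gk_small hb H.dim H.sub H.M_nonneg hub hum
  obtain ⟨C, hC0, hC⟩ := (Tst_rh (N := N) hr0).bdd
  set A := C * ∫ y, |u y| with hA
  have hkm : Measurable fun y => k y (u y) := H.meas.comp (measurable_id.prodMk hum)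
  have hki := H.integrable_comp hΩ hu
  have hkV : ∀ y, ENNReal.ofReal (k y (u y)) ≤
      ENNReal.ofReal (M * (1 + |u y| ^ (b - 2))) * ENNReal.ofReal (u y) := by
    intro y
    have hM := H.M_nonneg
    rw [← ENNReal.ofReal_mul (by positivity)]
    refine ENNReal.ofReal_le_ofReal ((H.le_growth y (hu0 y)).trans_eq ?_)
    rw [abs_of_nonneg (hu0 y), show b - 1 = (b - 2) + 1 by ring,
      Real.rpow_add_one' (hu0 y) (by linarith)]
    ring
  have key := ae_le_of_le_add_lintegral (G := gk r) (A := ENNReal.ofReal A)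
    (V := fun y => ENNReal.ofReal (M * (1 + |u y| ^ (b - 2))))
    (U := fun y => ENNReal.ofReal (u y)) (gk_measurable r) (gk_neg r) (by fun_prop) (by fun_prop)
    ?_ hr ?_
  · refine ⟨2 * A, mul_nonneg two_pos.le (mul_nonneg hC0
      (integral_nonneg fun y => abs_nonneg (u y))), key.mono fun x hx => ?_⟩
    have hA0 : 0 ≤ A := mul_nonneg hC0 (integral_nonneg fun y => abs_nonneg (u y))
    rw [show (2 : ENNReal) = ENNReal.ofReal 2 by simp, ← ENNReal.ofReal_mul two_pos.le,
      ENNReal.ofReal_le_ofReal_iff (by positivity)] at hx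
    exact hx
  · filter_upwards [ae_tendsto_cv_rh hui] with x hx
    rcases lt_or_ge R ‖x‖ with h | h
    · rw [hR x h]; simp
    refine le_of_tendsto (ENNReal.continuous_ofReal.continuousAt.tendsto.comp hx) ?_
    filter_upwards [Ioc_mem_nhdsGT hr0] with δ hδ
    refine (ofReal_cv_rh_le hui hki hkm hδ.1 hδ.2
      (fun ε h1 h2 => hsub x h ε h1 (h2.trans hr1))).trans ?_
    gcongr with y
    · exact (le_abs_self _).trans (abs_cv_le hC hui x)
    · exact hkV y
  · have hi : Integrable (fun x => M * (2 * u x + pw b (u x))) :=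
      ((hui.const_mul 2).add hu.2).const_mul M
    refine ((lintegral_mono fun x => ?_).trans_lt hi.lintegral_lt_top).ne
    have hM := H.M_nonneg
    have h0 := hu0 x
    rw [← ENNReal.ofReal_mul (by positivity)]
    refine ENNReal.ofReal_le_ofReal ?_
    rw [mul_assoc]
    refine mul_le_mul_of_nonneg_left ?_ hM
    have h2 : |u x| ^ (b - 2) * u x ≤ u x + pw b (u x) := by
      unfold pw
      rw [abs_of_nonneg h0]
      rcases le_total (u x) 1 with h | h
      · have e1 : u x ^ (b - 2) * u x ≤ 1 * u x :=
          mul_le_mul_of_nonneg_right (Real.rpow_le_one h0 h (by linarith)) h0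
        nlinarith [Real.rpow_nonneg h0 b]
      · have e1 : u x ^ (b - 2) * u x ≤ u x ^ b := by
          rw [← Real.rpow_add_one' h0 (by linarith)]
          exact Real.rpow_le_rpow_of_exponent_le h (by linarith)
        nlinarith
    linarith
end Nonlin
end

lemma uniformCauchySeqOn_of_le {E G : Type*} [NormedAddCommGroup G] {f : ℝ → E → G} {s : Set E}
    {r C : ℝ} (hr : 0 < r) (hC : 0 ≤ C)
    (h : ∀ δ' δ, 0 < δ' → δ' ≤ δ → δ ≤ r → ∀ x ∈ s, ‖f δ x - f δ' x‖ ≤ C * δ) :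
    UniformCauchySeqOn f (𝓝[>] 0) s := by
  intro v hv
  obtain ⟨ε, hε, hεv⟩ := Metric.mem_uniformity_dist.mp hv
  have hmem : Ioo 0 (min r (ε / (C + 1))) ∈ 𝓝[>] (0 : ℝ) := Ioo_mem_nhdsGT (by positivity)
  have main : ∀ δ' δ, 0 < δ' → δ' ≤ δ → δ < min r (ε / (C + 1)) → ∀ x ∈ s,
      ‖f δ x - f δ' x‖ < ε := by
    intro δ' δ h1 h2 h3 x hx
    refine (h δ' δ h1 h2 (h3.le.trans (min_le_left _ _)) x hx).trans_lt ?_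
    have h4 := (lt_div_iff₀ (by linarith)).mp (h3.trans_le (min_le_right _ _))
    nlinarith
  refine eventually_of_mem (prod_mem_prod hmem hmem) fun m hm x hx => hεv ?_
  rw [dist_eq_norm]
  rcases le_total m.1 m.2 with h' | h'
  · rw [norm_sub_rev]
    exact main _ _ hm.1.1 h' hm.2.2 x hx
  · exact main _ _ hm.2.1 h' hm.1.2 x hx

lemma exists_contDiffOn_limit {E : Type*} [NormedAddCommGroup E] [NormedSpace ℝ E]
    {f : ℝ → E → ℝ} {s : Set E} (hs : IsOpen s) {r C C' : ℝ} (hr : 0 < r) (hC : 0 ≤ C)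
    (hC' : 0 ≤ C') (hf : ∀ δ, 0 < δ → ContDiff ℝ 1 (f δ))
    (h0 : ∀ δ' δ, 0 < δ' → δ' ≤ δ → δ ≤ r → ∀ x ∈ s, ‖f δ x - f δ' x‖ ≤ C * δ)
    (h1 : ∀ δ' δ, 0 < δ' → δ' ≤ δ → δ ≤ r → ∀ x ∈ s,
      ‖fderiv ℝ (f δ) x - fderiv ℝ (f δ') x‖ ≤ C' * δ) :
    ∃ U : E → ℝ, ContDiffOn ℝ 1 U s ∧
      ∀ x ∈ s, Tendsto (fun δ => f δ x) (𝓝[>] 0) (𝓝 (U x)) := by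
  have c0 := uniformCauchySeqOn_of_le hr hC h0
  have c1 := uniformCauchySeqOn_of_le (f := fun δ x => fderiv ℝ (f δ) x) hr hC' h1
  have e0 : ∀ x ∈ s, ∃ y, Tendsto (fun δ => f δ x) (𝓝[>] 0) (𝓝 y) := fun x hx =>
    cauchy_map_iff_exists_tendsto.mp (c0.cauchy_map hx)
  have e1 : ∀ x ∈ s, ∃ y, Tendsto (fun δ => fderiv ℝ (f δ) x) (𝓝[>] 0) (𝓝 y) := fun x hx =>
    cauchy_map_iff_exists_tendsto.mp (c1.cauchy_map hx)
  choose! U hU using e0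
  choose! U' hU' using e1
  have u1 := c1.tendstoUniformlyOn_of_tendsto hU'
  have hpos : ∀ᶠ δ : ℝ in 𝓝[>] 0, 0 < δ := self_mem_nhdsWithin
  have hc : ContinuousOn U' s := u1.continuousOn (hpos.mono fun δ hδ =>
    ((hf δ hδ).continuous_fderiv one_ne_zero).continuousOn).frequently
  have hd : ∀ x ∈ s, HasFDerivAt U (U' x) x := fun x hx => by
    refine hasFDerivAt_of_tendstoUniformlyOnFilter (l := 𝓝[>] (0 : ℝ)) (f := f)
      (f' := fun δ x => fderiv ℝ (f δ) x) ?_ ?_ ?_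
    · exact u1.tendstoUniformlyOnFilter.mono_right (le_principal_iff.mpr (hs.mem_nhds hx))
    · exact (hpos.prod_inl (𝓝 x)).mono fun n hn =>
        ((hf n.1 hn).differentiable one_ne_zero n.2).hasFDerivAt
    · exact (hs.eventually_mem hx).mono hU
  refine ⟨U, ?_, hU⟩
  have e : (1 : WithTop ℕ∞) = 0 + 1 := (zero_add 1).symm
  rw [e, contDiffOn_succ_iff_fderiv_of_isOpen hs]
  exact ⟨fun x hx => (hd x hx).differentiableAt.differentiableWithinAt, fun h => by simp at h,
    (contDiffOn_zero (𝕜 := ℝ)).mpr (hc.congr fun x hx => (hd x hx).fderiv)⟩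

variable {N : ℕ}

lemma abs_cv_le_of_bdd {k h : Euc N → ℝ} {C : ℝ} (hk : Tst k) (hC : ∀ y, |h y| ≤ C)
    (x : Euc N) : |cv k h x| ≤ C * ∫ z, |k z| := by
  have e : (∫ z, |k z|) = ∫ y, |k (x - y)| :=
    (integral_sub_left_eq_self (fun z => |k z|) volume x).symm
  have hi : Integrable fun y => |k (x - y)| := (hk.integrable.abs).comp_sub_left x
  rw [e, ← integral_const_mul]
  refine (norm_integral_le_integral_norm (μ := volume) fun y => h y * k (x - y)).trans ?_
  refine integral_mono_of_nonneg (Eventually.of_forall fun y => norm_nonneg _) (hi.const_mul C)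
    (Eventually.of_forall fun y => ?_)
  simp only [Real.norm_eq_abs, abs_mul]
  exact mul_le_mul_of_nonneg_right (hC y) (abs_nonneg _)

lemma integral_abs_le_of_le_rh {k : Euc N → ℝ} {ε c : ℝ} (hε : 0 < ε)
    (h : ∀ z, |k z| ≤ c * rh ε z) : ∫ z, |k z| ≤ c := by
  have := integral_mono_of_nonneg (μ := volume) (f := fun z => |k z|)
    (g := fun z => c * rh ε z) (Eventually.of_forall fun z => abs_nonneg _)
    ((Tst_rh hε).integrable.const_mul c) (Eventually.of_forall h)
  rwa [integral_const_mul, integral_rh hε, mul_one] at this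

lemma abs_cv_sg_le {h : Euc N → ℝ} {C ε : ℝ} (hε : 0 < ε) (hC : ∀ y, |h y| ≤ C)
    (hC0 : 0 ≤ C) (x : Euc N) : |cv (sg ε) h x| ≤ C := by
  refine (abs_cv_le_of_bdd (Tst_sg hε) hC x).trans ?_
  have := integral_abs_le_of_le_rh (N := N) (k := sg ε) (c := 1) hε fun z => by
    rw [abs_of_nonneg (sg_nonneg hε z)]
    linarith [sg_le_rh hε z, rh_nonneg hε z]
  nlinarith

lemma norm_fderiv_cv_sg_le {h : Euc N → ℝ} {C ε : ℝ} (hε : 0 < ε) (hi : Integrable h)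
    (hC : ∀ y, |h y| ≤ C) (hC0 : 0 ≤ C) (x : Euc N) :
    ‖fderiv ℝ (cv (sg ε) h) x‖ ≤ √N * (C * ε⁻¹) := by
  refine ContinuousLinearMap.opNorm_le_bound _ (by positivity) fun v => ?_
  have h1 := sq_fderiv_apply_le (cv (sg ε) h) x v
  have h2 : ∀ i, |pd i (cv (sg ε) h) x| ≤ C * ε⁻¹ := fun i => by
    rw [pd_cv (Tst_sg hε) hi]
    exact (abs_cv_le_of_bdd ((Tst_sg hε).pderiv i) hC x).trans
      (mul_le_mul_of_nonneg_left (integral_abs_le_of_le_rh hε (abs_pd_sg_le hε i)) hC0)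
  have h3 : ∑ i : Fin N, pd i (cv (sg ε) h) x ^ 2 ≤ N * (C * ε⁻¹) ^ 2 := by
    refine (Finset.sum_le_sum fun i _ => sq_le_sq' (neg_le_of_abs_le (h2 i))
      (le_of_abs_le (h2 i))).trans ?_
    simp
  rw [Real.norm_eq_abs]
  refine abs_le_of_sq_le_sq ?_ (by positivity)
  rw [mul_pow, mul_pow, Real.sq_sqrt (Nat.cast_nonneg N)]
  nlinarith [sq_nonneg ‖v‖, mul_le_mul_of_nonneg_left h3 (sq_nonneg ‖v‖)]

/-- Interior regularity: if `-Δ w = h` weakly near `s` with `h` bounded, then the mollifications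
of `w` converge on `s` to a `C¹` function. -/
lemma exists_contDiffOn_of_weak {w h : Euc N → ℝ} {s : Set (Euc N)} {r C : ℝ}
    (hs : IsOpen s) (hr : 0 < r) (hw : Integrable w) (hh : Integrable h)
    (hC : ∀ y, |h y| ≤ C)
    (hweak : ∀ x ∈ s, ∀ ε, 0 < ε → ε ≤ r →
      -(∫ y, w y * lap (fun y => sg ε (x - y)) y) = cv (sg ε) h x) :
    ∃ U : Euc N → ℝ, ContDiffOn ℝ 1 U s ∧
      ∀ x ∈ s, Tendsto (fun δ => cv (rh δ) w x) (𝓝[>] 0) (𝓝 (U x)) := by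
  have hC0 : 0 ≤ C := (abs_nonneg _).trans (hC 0)
  have hlk : ∀ x ∈ s, ∀ ε, 0 < ε → ε ≤ r → cv (lk ε) w x = -(ε * cv (sg ε) h x) := by
    intro x hx ε h1 h2
    rw [cv_lk_eq, ← hweak x hx ε h1 h2]
    ring
  have hcd : ∀ δ, 0 < δ → ContDiff ℝ 1 (cv (rh δ) w) := fun δ hδ =>
    (contDiff_cv (Tst_rh hδ) hw).of_le (by exact_mod_cast le_top)
  refine exists_contDiffOn_limit hs (f := fun δ => cv (rh δ) w) (C := r * C) (C' := √N * C) hr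
    (by positivity) (by positivity) hcd ?_ ?_
  · intro δ' δ h1 h2 h3 x hx
    rw [cv_rh_sub h1 h2 hw]
    refine (intervalIntegral.norm_integral_le_of_norm_le_const (C := r * C) fun ε hε => ?_).trans ?_
    · rw [uIoc_of_le h2] at hε
      rw [hlk x hx ε (h1.trans hε.1) (hε.2.trans h3), norm_neg, Real.norm_eq_abs, abs_mul,
        abs_of_pos (h1.trans hε.1)]
      exact mul_le_mul (hε.2.trans h3) (abs_cv_sg_le (h1.trans hε.1) hC hC0 x) (abs_nonneg _) hr.le
    · rw [abs_of_nonneg (by linarith)]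
      exact mul_le_mul_of_nonneg_left (by linarith) (by positivity)
  · intro δ' δ h1 h2 h3 x hx
    have hδ := h1.trans_le h2
    have d1 := (hcd δ hδ).differentiable one_ne_zero x
    have d2 := (hcd δ' h1).differentiable one_ne_zero x
    rw [← fderiv_fun_sub d1 d2]
    refine norm_fderiv_le_of_lip' ℝ (by positivity) ?_
    filter_upwards [hs.mem_nhds hx] with y hy
    rw [cv_rh_sub h1 h2 hw, cv_rh_sub h1 h2 hw, ← intervalIntegral.integral_sub
      (cv_lk_intervalIntegrable h1 h2 hw y) (cv_lk_intervalIntegrable h1 h2 hw x)]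
    refine (intervalIntegral.norm_integral_le_of_norm_le_const
      (C := √N * C * ‖y - x‖) fun ε hε => ?_).trans ?_
    · rw [uIoc_of_le h2] at hε
      have hε0 := h1.trans hε.1
      rw [hlk x hx ε hε0 (hε.2.trans h3), hlk y hy ε hε0 (hε.2.trans h3),
        show -(ε * cv (sg ε) h y) - -(ε * cv (sg ε) h x) =
          -(ε * (cv (sg ε) h y - cv (sg ε) h x)) by ring, norm_neg, norm_mul,
        Real.norm_eq_abs ε, abs_of_pos hε0]
      have := Convex.norm_image_sub_le_of_norm_fderiv_le (𝕜 := ℝ) (f := cv (sg ε) h)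
        (s := univ) (x := x) (y := y)
        (fun z _ => (contDiff_cv (Tst_sg hε0) hh).differentiable (by simp) z)
        (fun z _ => norm_fderiv_cv_sg_le hε0 hh hC hC0 z) convex_univ trivial trivial
      calc ε * ‖cv (sg ε) h y - cv (sg ε) h x‖ ≤ ε * (√N * (C * ε⁻¹) * ‖y - x‖) :=
            mul_le_mul_of_nonneg_left this hε0.le
        _ = √N * C * ‖y - x‖ := by field_simp
    · rw [abs_of_nonneg (by linarith)]
      nlinarith [mul_nonneg (by positivity : 0 ≤ √N * C) (norm_nonneg (y - x)), h1.le]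

section LocalCalculus
variable {N : ℕ}

lemma contDiff_mul_of_tsupport {n : WithTop ℕ∞} {Ω : Set (Euc N)} {g φ : Euc N → ℝ}
    (hΩ : IsOpen Ω) (hg : ContDiffOn ℝ n g Ω) (hφ : ContDiff ℝ n φ) (ht : tsupport φ ⊆ Ω) :
    ContDiff ℝ n (fun x => g x * φ x) := by
  refine contDiff_iff_contDiffAt.mpr fun x => ?_
  by_cases hx : x ∈ Ω
  · exact (hg.contDiffAt (hΩ.mem_nhds hx)).mul hφ.contDiffAt
  · refine (contDiffAt_const (c := (0 : ℝ))).congr_of_eventuallyEq ?_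
    filter_upwards [(isClosed_tsupport φ).isOpen_compl.mem_nhds fun h => hx (ht h)] with y hy
    rw [image_eq_zero_of_notMem_tsupport hy, mul_zero]

lemma continuous_mul_of_tsupport {Ω : Set (Euc N)} {g φ : Euc N → ℝ}
    (hΩ : IsOpen Ω) (hg : ContinuousOn g Ω) (hφ : Continuous φ) (ht : tsupport φ ⊆ Ω) :
    Continuous (fun x => g x * φ x) :=
  contDiff_zero.mp (contDiff_mul_of_tsupport hΩ (contDiffOn_zero (𝕜 := ℝ).mpr hg)
    (contDiff_zero.mpr hφ) ht)

lemma tsupport_pd_subset (i : Fin N) (φ : Euc N → ℝ) : tsupport (pd i φ) ⊆ tsupport φ :=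
  tsupport_fderiv_apply_subset ℝ _

lemma continuousOn_pd {Ω : Set (Euc N)} {g : Euc N → ℝ} (hΩ : IsOpen Ω)
    (hg : ContDiffOn ℝ 1 g Ω) (i : Fin N) : ContinuousOn (pd i g) Ω :=
  (hg.continuousOn_fderiv_of_isOpen hΩ le_rfl).clm_apply continuousOn_const

lemma Tst.integrable_mul_on {Ω : Set (Euc N)} {g φ : Euc N → ℝ} (hφ : Tst φ)
    (hΩ : IsOpen Ω) (hg : ContinuousOn g Ω) (ht : tsupport φ ⊆ Ω) :
    Integrable (fun x => g x * φ x) :=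
  (continuous_mul_of_tsupport hΩ hg hφ.continuous ht).integrable_of_hasCompactSupport
    hφ.2.mul_left

/-- Integration by parts for a function which is `C¹` on an open set, against a test function
supported there. -/
lemma Tst.integral_mul_pd_on {Ω : Set (Euc N)} {g φ : Euc N → ℝ} (hφ : Tst φ) (hΩ : IsOpen Ω)
    (hg : ContDiffOn ℝ 1 g Ω) (ht : tsupport φ ⊆ Ω) (i : Fin N) :
    ∫ x, g x * pd i φ x = -∫ x, pd i g x * φ x := by
  have hφ1 : ContDiff ℝ 1 φ := hφ.1.of_le (by exact_mod_cast le_top)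
  have h0 := integral_mul_pd (contDiff_const (c := (1 : ℝ)))
    (contDiff_mul_of_tsupport hΩ hg hφ1 ht) (Or.inr hφ.2.mul_left) i
  have e : ∀ x, pd i (fun x => g x * φ x) x = pd i g x * φ x + g x * pd i φ x := by
    intro x
    by_cases hx : x ∈ Ω
    · unfold pd
      rw [fderiv_fun_mul ((hg.contDiffAt (hΩ.mem_nhds hx)).differentiableAt one_ne_zero)
        (hφ.differentiable x)]
      simp only [add_apply, smul_apply, smul_eq_mul]
      ring
    · have h1 : x ∉ tsupport φ := fun h => hx (ht h)
      have h2 : x ∉ tsupport (fun x => g x * φ x) := fun h => h1 (tsupport_mul_subset_right h)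
      rw [image_eq_zero_of_notMem_tsupport h1,
        image_eq_zero_of_notMem_tsupport fun h => h1 (tsupport_pd_subset i φ h),
        image_eq_zero_of_notMem_tsupport fun h => h2 (tsupport_pd_subset i _ h)]
      simp
  have hz : ∀ x, pd i (fun _ : Euc N => (1 : ℝ)) x = 0 := fun x => by simp [pd]
  simp only [one_mul, hz, zero_mul, integral_zero, neg_zero, e] at h0
  rw [integral_add (hφ.integrable_mul_on hΩ (continuousOn_pd hΩ hg i) ht)
    ((hφ.pderiv i).integrable_mul_on hΩ hg.continuousOn
      ((tsupport_pd_subset i φ).trans ht))] at h0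
  linarith

lemma Tst.pd_comm {φ : Euc N → ℝ} (hφ : Tst φ) (i j : Fin N) (x : Euc N) :
    pd i (pd j φ) x = pd j (pd i φ) x := by
  have hs : IsSymmSndFDerivAt ℝ φ x := hφ.1.contDiffAt.isSymmSndFDerivAt (by
    rw [minSmoothness_of_isRCLikeNormedField]; exact WithTop.coe_le_coe.mpr le_top)
  have hd : DifferentiableAt ℝ (fderiv ℝ φ) x :=
    (hφ.1.fderiv_right (m := 1) (by norm_cast)).differentiable one_ne_zero x
  have e : ∀ i j, pd i (pd j φ) x =
      fderiv ℝ (fderiv ℝ φ) x (EuclideanSpace.single i 1) (EuclideanSpace.single j 1) := by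
    intro i j
    change fderiv ℝ (fun y => fderiv ℝ φ y (EuclideanSpace.single j 1)) x _ = _
    rw [fderiv_clm_apply hd (differentiableAt_const _)]
    simp
  rw [e, e]
  exact hs _ _

lemma Tst.pd_lap {φ : Euc N → ℝ} (hφ : Tst φ) (i : Fin N) (x : Euc N) :
    pd i (lap φ) x = lap (pd i φ) x := by
  have e : pd i (lap φ) x = ∑ j, pd i (pd j (pd j φ)) x := by
    change fderiv ℝ (fun y => ∑ j, pd j (pd j φ) y) x _ = _
    rw [fderiv_fun_sum fun j _ => ((hφ.pderiv j).pderiv j).differentiable x]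
    simp [pd]
  rw [e, lap_eq_sum_pd]
  refine Finset.sum_congr rfl fun j _ => ?_
  rw [(hφ.pderiv j).pd_comm]
  congr 1
  funext y
  exact hφ.pd_comm i j y

lemma tsupport_lap_subset (φ : Euc N → ℝ) : tsupport (lap φ) ⊆ tsupport φ := by
  refine closure_minimal (fun x hx => ?_) (isClosed_tsupport φ)
  by_contra h
  refine hx ?_
  rw [lap_eq_sum_pd]
  exact Finset.sum_eq_zero fun i _ => image_eq_zero_of_notMem_tsupport fun h' =>
    h (tsupport_pd_subset i φ (tsupport_pd_subset i _ h'))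

lemma tsupport_sg_reflect {ε : ℝ} (hε : 0 < ε) (x : Euc N) :
    tsupport (fun y => sg ε (x - y)) ⊆ Metric.closedBall x ε := by
  refine closure_minimal (fun y hy => ?_) Metric.isClosed_closedBall
  rw [Metric.mem_closedBall, dist_comm, dist_eq_norm]
  by_contra! h
  exact hy (sg_zero hε h.le)

lemma exists_contDiffOn_one_of_weak {Ω : Set (Euc N)} (hΩ : IsOpen Ω) {w h : Euc N → ℝ} {C : ℝ}
    (hw : Integrable w) (hh : Integrable h) (hC : ∀ y, |h y| ≤ C)
    (hweak : ∀ φ, Tst φ → tsupport φ ⊆ Ω → -(∫ x, w x * lap φ x) = ∫ x, h x * φ x) :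
    ∃ U : Euc N → ℝ, ContDiffOn ℝ 1 U Ω ∧
      (∀ x ∈ Ω, Tendsto (fun δ => cv (rh δ) w x) (𝓝[>] 0) (𝓝 (U x))) ∧
      ∀ᵐ x, x ∈ Ω → U x = w x := by
  have loc : ∀ x ∈ Ω, ∃ r > 0, ∃ U : Euc N → ℝ, ContDiffOn ℝ 1 U (Metric.ball x r) ∧
      ∀ y ∈ Metric.ball x r, Tendsto (fun δ => cv (rh δ) w y) (𝓝[>] 0) (𝓝 (U y)) := by
    intro x hx
    obtain ⟨ρ, hρ, hb⟩ := Metric.isOpen_iff.mp hΩ x hx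
    refine ⟨ρ / 2, by positivity, ?_⟩
    refine exists_contDiffOn_of_weak Metric.isOpen_ball (r := ρ / 4) (by positivity) hw hh hC
      fun y hy ε h1 h2 => ?_
    refine hweak _ ((Tst_sg h1).reflect y) ((tsupport_sg_reflect h1 y).trans
      (Subset.trans (fun z hz => ?_) hb))
    rw [Metric.mem_closedBall] at hz
    rw [Metric.mem_ball] at hy ⊢
    linarith [dist_triangle z y x]
  have ex : ∀ x ∈ Ω, ∃ a, Tendsto (fun δ => cv (rh δ) w x) (𝓝[>] 0) (𝓝 a) := fun x hx => by
    obtain ⟨r, hr, U, -, hU⟩ := loc x hx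
    exact ⟨U x, hU x (Metric.mem_ball_self hr)⟩
  choose! U hU using ex
  refine ⟨U, fun x hx => ?_, hU, ?_⟩
  · obtain ⟨r, hr, V, hV, hVt⟩ := loc x hx
    have hx' := Metric.ball_mem_nhds x hr
    refine ((hV.contDiffAt hx').congr_of_eventuallyEq ?_).contDiffWithinAt
    filter_upwards [hx', hΩ.mem_nhds hx] with y hy hyΩ
    exact tendsto_nhds_unique (hU y hyΩ) (hVt y hy)
  · filter_upwards [ae_tendsto_cv_rh hw] with x hx hxΩ
    exact tendsto_nhds_unique (hU x hxΩ) hx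

end LocalCalculus

section Classical
variable {N : ℕ} {Ω : Set (Euc N)} {U h : Euc N → ℝ}

lemma contDiffOn_pd_of_weak (hΩ : IsOpen Ω) (hU : ContDiffOn ℝ 1 U Ω) (hh : ContDiffOn ℝ 1 h Ω)
    (hweak : ∀ φ, Tst φ → tsupport φ ⊆ Ω → -(∫ x, U x * lap φ x) = ∫ x, h x * φ x)
    (i : Fin N) : ContDiffOn ℝ 1 (pd i U) Ω := by
  intro x hx
  obtain ⟨ρ, hρ, hb⟩ := Metric.nhds_basis_closedBall.mem_iff.mp (hΩ.mem_nhds hx)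
  set B := Metric.ball x ρ with hB
  have hBΩ : B ⊆ Ω := Metric.ball_subset_closedBall.trans hb
  have hBo : IsOpen B := Metric.isOpen_ball
  have bd : ∀ {v : Euc N → ℝ}, ContDiffOn ℝ 1 v Ω → ∃ C, 0 ≤ C ∧
      ∀ y, |B.indicator (pd i v) y| ≤ C := by
    intro v hv
    obtain ⟨C, hC⟩ := (isCompact_closedBall x ρ).exists_bound_of_continuousOn
      ((continuousOn_pd hΩ hv i).mono hb)
    refine ⟨max C 0, le_max_right _ _, fun y => ?_⟩
    by_cases hy : y ∈ B
    · rw [indicator_of_mem hy]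
      exact (hC y (Metric.ball_subset_closedBall hy)).trans (le_max_left _ _)
    · rw [indicator_of_notMem hy, abs_zero]
      exact le_max_right _ _
  have int : ∀ {v : Euc N → ℝ}, ContDiffOn ℝ 1 v Ω → Integrable (B.indicator (pd i v)) := by
    intro v hv
    exact (((continuousOn_pd hΩ hv i).mono hb).integrableOn_compact
      (isCompact_closedBall x ρ) |>.mono_set Metric.ball_subset_closedBall).integrable_indicator
      measurableSet_ball
  have ind : ∀ {v ψ : Euc N → ℝ}, tsupport ψ ⊆ B →
      ∫ y, B.indicator (pd i v) y * ψ y = ∫ y, pd i v y * ψ y := by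
    intro v ψ hψ
    refine integral_congr_ae (Eventually.of_forall fun y => ?_)
    by_cases hy : y ∈ B
    · simp only [indicator_of_mem hy]
    · simp [image_eq_zero_of_notMem_tsupport fun h => hy (hψ h)]
  obtain ⟨C, -, hC⟩ := bd hh
  obtain ⟨V, hV, -, hVae⟩ := exists_contDiffOn_one_of_weak hBo (int hU) (int hh) hC
    fun φ hφ ht => by
      have e : ∀ y, lap (pd i φ) y = pd i (lap φ) y := fun y => (hφ.pd_lap i y).symm
      rw [ind ((tsupport_lap_subset φ).trans ht), ind ht]
      have h1 := hφ.laplace.integral_mul_pd_on hΩ hU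
        ((tsupport_lap_subset φ).trans (ht.trans hBΩ)) i
      have h2 := hφ.integral_mul_pd_on hΩ hh (ht.trans hBΩ) i
      have h3 := hweak _ (hφ.pderiv i) ((tsupport_pd_subset i φ).trans (ht.trans hBΩ))
      simp only [e] at h3
      linarith
  have heq : EqOn V (pd i U) B := by
    refine Measure.eqOn_open_of_ae_eq (μ := volume) ?_ hBo hV.continuousOn
      ((continuousOn_pd hΩ hU i).mono hBΩ)
    refine (ae_restrict_iff' hBo.measurableSet).mpr (hVae.mono fun y hy hyB => ?_)
    rw [hy hyB, indicator_of_mem hyB]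
  have hxB : B ∈ 𝓝 x := Metric.ball_mem_nhds x hρ
  exact ((hV.contDiffAt hxB).congr_of_eventuallyEq
    (eventually_of_mem hxB fun y hy => (heq hy).symm)).contDiffWithinAt

lemma contDiffOn_two_of_pd (hΩ : IsOpen Ω) (hU : ContDiffOn ℝ 1 U Ω)
    (hpd : ∀ i, ContDiffOn ℝ 1 (pd i U) Ω) : ContDiffOn ℝ 2 U Ω := by
  have e : (2 : WithTop ℕ∞) = 1 + 1 := by norm_num
  rw [e, contDiffOn_succ_iff_fderiv_of_isOpen hΩ]
  refine ⟨hU.differentiableOn one_ne_zero, fun h => by simp at h, ?_⟩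
  have e2 : fderiv ℝ U = fun x => ∑ i : Fin N, pd i U x • EuclideanSpace.proj (𝕜 := ℝ) i := by
    funext x
    ext v
    rw [fderiv_apply_eq_sum]
    simp [mul_comm]
  rw [e2]
  exact ContDiffOn.sum fun i _ => (hpd i).smul contDiffOn_const

lemma neg_lap_eq_of_weak (hΩ : IsOpen Ω) (hU : ContDiffOn ℝ 1 U Ω) (hh : ContinuousOn h Ω)
    (hpd : ∀ i, ContDiffOn ℝ 1 (pd i U) Ω)
    (hweak : ∀ φ, Tst φ → tsupport φ ⊆ Ω → -(∫ x, U x * lap φ x) = ∫ x, h x * φ x) :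
    ∀ x ∈ Ω, -lap U x = h x := by
  have hl : ContinuousOn (lap U) Ω := by
    have : lap U = fun x => ∑ i, pd i (pd i U) x := rfl
    rw [this]
    exact continuousOn_finsetSum _ fun i _ => continuousOn_pd hΩ (hpd i) i
  have hc : ContinuousOn (fun x => lap U x + h x) Ω := hl.add hh
  have hae : ∀ᵐ x, x ∈ Ω → lap U x + h x = 0 := by
    refine hΩ.ae_eq_zero_of_integral_contDiff_smul_eq_zero
      (hc.locallyIntegrableOn hΩ.measurableSet) fun φ h1 h2 ht => ?_
    have hφ : Tst φ := ⟨h1, h2⟩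
    have i1 : ∫ x, U x * lap φ x = ∫ x, lap U x * φ x := by
      have a1 : ∀ i, Integrable fun x => U x * pd i (pd i φ) x := fun i =>
        ((hφ.pderiv i).pderiv i).integrable_mul_on hΩ hU.continuousOn
          ((tsupport_pd_subset i _).trans ((tsupport_pd_subset i φ).trans ht))
      have a2 : ∀ i, Integrable fun x => pd i (pd i U) x * φ x := fun i =>
        hφ.integrable_mul_on hΩ (continuousOn_pd hΩ (hpd i) i) ht
      simp only [lap_eq_sum_pd, Finset.mul_sum, Finset.sum_mul]
      rw [integral_finsetSum _ fun i _ => a1 i, integral_finsetSum _ fun i _ => a2 i]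
      refine Finset.sum_congr rfl fun i _ => ?_
      rw [(hφ.pderiv i).integral_mul_pd_on hΩ hU ((tsupport_pd_subset i φ).trans ht) i,
        hφ.integral_mul_pd_on hΩ (hpd i) ht i, neg_neg]
    have i2 := hweak φ hφ ht
    simp only [smul_eq_mul, mul_comm (φ _), add_mul]
    rw [integral_add (hφ.integrable_mul_on hΩ hl ht) (hφ.integrable_mul_on hΩ hh ht)]
    linarith
  have := Measure.eqOn_open_of_ae_eq (μ := volume) (f := fun x => lap U x + h x)
    (g := fun _ => (0 : ℝ)) ((ae_restrict_iff' hΩ.measurableSet).mpr hae) hΩ hc continuousOn_const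
  intro x hx
  have h0 : lap U x + h x = 0 := this hx
  linarith

/-- Weak solutions of `-Δ U = h` with `U` and `h` of class `C¹` are classical. -/
lemma classical_of_weak (hΩ : IsOpen Ω) (hU : ContDiffOn ℝ 1 U Ω) (hh : ContDiffOn ℝ 1 h Ω)
    (hweak : ∀ φ, Tst φ → tsupport φ ⊆ Ω → -(∫ x, U x * lap φ x) = ∫ x, h x * φ x) :
    ContDiffOn ℝ 2 U Ω ∧ ∀ x ∈ Ω, -lap U x = h x :=
  ⟨contDiffOn_two_of_pd hΩ hU (contDiffOn_pd_of_weak hΩ hU hh hweak),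
    neg_lap_eq_of_weak hΩ hU hh.continuousOn (contDiffOn_pd_of_weak hΩ hU hh hweak) hweak⟩

end Classical

section MeanValue
variable {N : ℕ} {u : Euc N → ℝ}

lemma cv_rh_le_add {δ r C : ℝ} {x : Euc N} (hδ : 0 < δ) (hr : δ ≤ r) (hu : Integrable u)
    (h : ∀ ε, 0 < ε → ε ≤ r → -(∫ y, u y * lap (fun y => sg ε (x - y)) y) ≤ C) (hC : 0 ≤ C) :
    cv (rh δ) u x ≤ cv (rh r) u x + C * r ^ 2 := by
  have h1 := cv_rh_sub hδ hr hu x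
  have h2 : -(∫ ε in δ..r, cv (lk ε) u x) ≤ ∫ _ in δ..r, r * C := by
    rw [← intervalIntegral.integral_neg]
    refine intervalIntegral.integral_mono_on hr (cv_lk_intervalIntegrable hδ hr hu x).neg
      intervalIntegrable_const fun ε hε => ?_
    rw [cv_lk_eq, ← mul_neg]
    have hε0 := hδ.trans_le hε.1
    exact (mul_le_mul_of_nonneg_left (h ε hε0 hε.2) hε0.le).trans
      (mul_le_mul_of_nonneg_right hε.2 hC)
  rw [intervalIntegral.integral_const, smul_eq_mul] at h2
  nlinarith [mul_nonneg hδ.le (mul_nonneg (hδ.le.trans hr) hC)]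

lemma cv_rh_sub_le {δ r C : ℝ} {x : Euc N} (hδ : 0 < δ) (hr : δ ≤ r) (hu : Integrable u)
    (h : ∀ ε, 0 < ε → ε ≤ r → (∫ y, u y * lap (fun y => sg ε (x - y)) y) ≤ C) (hC : 0 ≤ C) :
    cv (rh r) u x ≤ cv (rh δ) u x + C * r ^ 2 := by
  have h1 := cv_rh_sub hδ hr hu x
  have h2 : (∫ ε in δ..r, cv (lk ε) u x) ≤ ∫ _ in δ..r, r * C := by
    refine intervalIntegral.integral_mono_on hr (cv_lk_intervalIntegrable hδ hr hu x)
      intervalIntegrable_const fun ε hε => ?_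
    rw [cv_lk_eq]
    have hε0 := hδ.trans_le hε.1
    exact (mul_le_mul_of_nonneg_left (h ε hε0 hε.2) hε0.le).trans
      (mul_le_mul_of_nonneg_right hε.2 hC)
  rw [intervalIntegral.integral_const, smul_eq_mul] at h2
  nlinarith [mul_nonneg hδ.le (mul_nonneg (hδ.le.trans hr) hC)]

lemma cv_rh_nonneg (hu0 : ∀ x, 0 ≤ u x) {ε : ℝ} (hε : 0 < ε) (x : Euc N) :
    0 ≤ cv (rh ε) u x :=
  integral_nonneg fun y => mul_nonneg (hu0 y) (rh_nonneg hε _)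

lemma cv_sg_le_cv_rh (hu : Integrable u) (hu0 : ∀ x, 0 ≤ u x) {ε : ℝ} (hε : 0 < ε)
    (x : Euc N) : cv (sg ε) u x ≤ cv (rh ε) u x := by
  refine integral_mono (cv_integrable (Tst_sg hε) hu x) (cv_integrable (Tst_rh hε) hu x)
    fun y => mul_le_mul_of_nonneg_left ?_ (hu0 y)
  linarith [sg_le_rh hε (x - y), rh_nonneg hε (x - y)]

/-- If the mollified means of a nonnegative supersolution of `-Δ u + lam u = 0` tend to zero
at a point, they vanish for small radii. -/
lemma cv_rh_eq_zero_of_tendsto {lam r B : ℝ} {x : Euc N} (hlam : 0 ≤ lam) (hr : 0 < r)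
    (hlr : lam * r ^ 2 ≤ 1 / 2) (hu : Integrable u) (hu0 : ∀ x, 0 ≤ u x) (huB : ∀ x, u x ≤ B)
    (hlim : Tendsto (fun δ => cv (rh δ) u x) (𝓝[>] 0) (𝓝 0))
    (h : ∀ ε, 0 < ε → ε ≤ r →
      (∫ y, u y * lap (fun y => sg ε (x - y)) y) ≤ lam * cv (sg ε) u x) :
    cv (rh r) u x = 0 := by
  have hB : 0 ≤ B := (hu0 0).trans (huB 0)
  have key : ∀ n : ℕ, ∀ s, 0 < s → s ≤ r → cv (rh s) u x ≤ B * (1 / 2) ^ n := by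
    intro n
    induction n with
    | zero =>
      intro s hs _
      rw [pow_zero, mul_one]
      refine (le_abs_self _).trans
        ((abs_cv_le_of_bdd (Tst_rh hs) (C := B) (fun y => ?_) x).trans ?_)
      · rw [abs_of_nonneg (hu0 y)]
        exact huB y
      · have := integral_abs_le_of_le_rh (N := N) (k := rh s) (c := 1) hs fun z => by
          rw [abs_of_nonneg (rh_nonneg hs z), one_mul]
        nlinarith
    | succ n ih =>
      intro s hs hsr
      have h1 : ∀ δ, 0 < δ → δ ≤ s →
          cv (rh s) u x ≤ cv (rh δ) u x + lam * (B * (1 / 2) ^ n) * s ^ 2 := by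
        intro δ hδ hδs
        refine cv_rh_sub_le hδ hδs hu (fun ε h1 h2 => (h ε h1 (h2.trans hsr)).trans ?_)
          (by positivity)
        exact mul_le_mul_of_nonneg_left
          ((cv_sg_le_cv_rh hu hu0 h1 x).trans (ih ε h1 (h2.trans hsr))) hlam
      have h2 : cv (rh s) u x ≤ 0 + lam * (B * (1 / 2) ^ n) * s ^ 2 :=
        ge_of_tendsto (hlim.add_const _) (eventually_of_mem (Ioc_mem_nhdsGT hs)
          fun δ hδ => h1 δ hδ.1 hδ.2)
      have h3 : lam * s ^ 2 ≤ 1 / 2 :=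
        (mul_le_mul_of_nonneg_left (pow_le_pow_left₀ hs.le hsr 2) hlam).trans hlr
      have h4 : 0 ≤ B * (1 / 2 : ℝ) ^ n := by positivity
      rw [pow_succ]
      nlinarith [mul_le_mul_of_nonneg_left h3 h4]
  refine le_antisymm ?_ (cv_rh_nonneg hu0 hr x)
  have ht : Tendsto (fun n : ℕ => B * (1 / 2 : ℝ) ^ n) atTop (𝓝 (B * 0)) :=
    (tendsto_pow_atTop_nhds_zero_of_lt_one (by norm_num) (by norm_num)).const_mul B
  rw [mul_zero] at ht
  exact ge_of_tendsto' ht fun n => key n r hr le_rfl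

lemma rh_pos {ε : ℝ} (hε : 0 < ε) {z : Euc N} (hz : ‖z‖ < ε) : 0 < rh ε z := by
  have h1 : ‖z‖ ^ 2 * ε⁻¹ ^ 2 < 1 := by
    rw [← mul_pow, ← div_eq_mul_inv]
    exact pow_lt_one₀ (by positivity) ((div_lt_one hε).mpr hz) two_ne_zero
  have := T1_pos h1
  have := mass_pos N
  unfold rh
  positivity

lemma ae_eq_zero_of_cv_rh_eq_zero {r : ℝ} {x : Euc N} (hr : 0 < r) (hu : Integrable u)
    (hu0 : ∀ x, 0 ≤ u x) (h : cv (rh r) u x = 0) :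
    ∀ᵐ y, y ∈ Metric.ball x r → u y = 0 := by
  have := (integral_eq_zero_iff_of_nonneg (fun y => mul_nonneg (hu0 y) (rh_nonneg hr _))
    (cv_integrable (Tst_rh hr) hu x)).mp h
  filter_upwards [this] with y hy hyx
  rw [Metric.mem_ball, dist_comm, dist_eq_norm] at hyx
  exact (mul_eq_zero.mp hy).resolve_right (rh_pos hr hyx).ne'

/-- Strong maximum principle. -/
lemma pos_of_weak {Ω : Set (Euc N)} {lam B : ℝ} {U : Euc N → ℝ} (hΩ : IsOpen Ω)
    (hconn : IsPreconnected Ω) (hlam : 0 ≤ lam) (hu : Integrable u) (hu0 : ∀ x, 0 ≤ u x)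
    (huB : ∀ x, u x ≤ B) (hne : ¬ ∀ᵐ x, x ∈ Ω → u x = 0) (hU : ContinuousOn U Ω)
    (hlim : ∀ x ∈ Ω, Tendsto (fun δ => cv (rh δ) u x) (𝓝[>] 0) (𝓝 (U x)))
    (hae : ∀ᵐ x, x ∈ Ω → U x = u x)
    (hsup : ∀ φ, Tst φ → (∀ x, 0 ≤ φ x) → tsupport φ ⊆ Ω →
      (∫ y, u y * lap φ y) ≤ lam * ∫ y, u y * φ y) :
    ∀ x ∈ Ω, 0 < U x := by
  have hU0 : ∀ x ∈ Ω, 0 ≤ U x := fun x hx =>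
    ge_of_tendsto (hlim x hx) (eventually_of_mem self_mem_nhdsWithin fun δ hδ =>
      cv_rh_nonneg hu0 hδ x)
  have hzero : ∀ x ∈ Ω, U x = 0 → ∀ᶠ y in 𝓝 x, y ∈ Ω ∧ U y = 0 := by
    intro x hx h0
    obtain ⟨ρ, hρ, hb⟩ := Metric.nhds_basis_closedBall.mem_iff.mp (hΩ.mem_nhds hx)
    set r := min ρ (√((1 / 2) / (lam + 1))) with hr
    have hr0 : 0 < r := by positivity
    have hlr : lam * r ^ 2 ≤ 1 / 2 := by
      have h1 : r ^ 2 ≤ (1 / 2) / (lam + 1) := by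
        rw [← Real.sq_sqrt (show 0 ≤ (1 / 2) / (lam + 1) by positivity)]
        exact pow_le_pow_left₀ hr0.le (min_le_right _ _) 2
      rw [le_div_iff₀ (by positivity)] at h1
      nlinarith [sq_nonneg r]
    have h2 := cv_rh_eq_zero_of_tendsto hlam hr0 hlr hu hu0 huB (h0 ▸ hlim x hx)
      fun ε h1 h2 => hsup _ ((Tst_sg h1).reflect x) (fun y => sg_nonneg h1 _)
        ((tsupport_sg_reflect h1 x).trans
          ((Metric.closedBall_subset_closedBall (h2.trans (min_le_left _ _))).trans hb))
    have hbΩ : Metric.ball x r ⊆ Ω := fun y hy =>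
      hb (Metric.ball_subset_closedBall (Metric.ball_subset_ball (min_le_left _ _) hy))
    have h3 : EqOn U (fun _ => 0) (Metric.ball x r) := by
      refine Measure.eqOn_open_of_ae_eq (μ := volume) ?_ Metric.isOpen_ball (hU.mono hbΩ)
        continuousOn_const
      refine (ae_restrict_iff' measurableSet_ball).mpr ?_
      filter_upwards [ae_eq_zero_of_cv_rh_eq_zero hr0 hu hu0 h2, hae] with y h4 h5 h6
      rw [h5 (hbΩ h6), h4 h6]
    exact eventually_of_mem (Metric.ball_mem_nhds x hr0) fun y hy => ⟨hbΩ hy, h3 hy⟩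
  by_contra! hcon
  obtain ⟨x, hx, hx0⟩ := hcon
  have hA : IsOpen {y | y ∈ Ω ∧ U y = 0} :=
    isOpen_iff_mem_nhds.mpr fun y hy => hzero y hy.1 hy.2
  have hB' : IsOpen (Ω ∩ U ⁻¹' Ioi 0) := hU.isOpen_inter_preimage hΩ isOpen_Ioi
  have hsub : Ω ⊆ {y | y ∈ Ω ∧ U y = 0} := by
    refine hconn.subset_left_of_subset_union hA hB' ?_ ?_ ⟨x, hx, hx, le_antisymm hx0 (hU0 x hx)⟩
    · exact Set.disjoint_left.mpr fun y h1 h2 => (ne_of_gt h2.2) h1.2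
    · intro y hy
      rcases (hU0 y hy).eq_or_lt with h | h
      · exact Or.inl ⟨hy, h.symm⟩
      · exact Or.inr ⟨hy, h⟩
  exact hne (hae.mono fun y hy hyΩ => by rw [← hy hyΩ]; exact (hsub hyΩ).2)

end MeanValue

section Boundary
variable {N : ℕ}

/-- Near a `C¹` boundary point, `Ω` misses a ball of comparable radius. -/
lemma exists_exterior_balls {Ω : Set (Euc N)} (hΩ : IsOpen Ω) {z : Euc N} (hz : z ∈ frontier Ω)
    (h : ∃ U : Set (Euc N), IsOpen U ∧ z ∈ U ∧
      ∃ F : Euc N → ℝ, ContDiff ℝ 1 F ∧ (∀ y ∈ U, fderiv ℝ F y ≠ 0) ∧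
        Ω ∩ U = {y ∈ U | F y < 0}) :
    ∃ e : Euc N, ‖e‖ ≤ 1 ∧ ∀ᶠ r : ℝ in 𝓝[>] 0,
      ∀ y, ‖y - (z + (r / 2) • e)‖ < r / 8 → y ∉ Ω := by
  obtain ⟨U, hU, hzU, F, hF, hF', hFU⟩ := h
  set L := fderiv ℝ F z with hL
  have hL0 : 0 < ‖L‖ := norm_pos_iff.mpr (hF' z hzU)
  have hz0 : 0 ≤ F z := by
    by_contra! hlt
    have : z ∈ Ω ∩ U := hFU ▸ ⟨hzU, hlt⟩
    exact (hΩ.frontier_eq ▸ hz).2 this.1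
  obtain ⟨e, he1, he⟩ : ∃ e : Euc N, ‖e‖ ≤ 1 ∧ 3 / 4 * ‖L‖ ≤ L e := by
    obtain ⟨e, he1, he⟩ := L.exists_lt_apply_of_lt_opNorm (r := 3 / 4 * ‖L‖) (by linarith)
    rw [Real.norm_eq_abs] at he
    rcases le_abs.mp he.le with h | h
    · exact ⟨e, he1.le, h⟩
    · exact ⟨-e, by rw [norm_neg]; exact he1.le, by rw [map_neg]; exact h⟩
  refine ⟨e, he1, ?_⟩
  have hd : ∀ᶠ y in 𝓝 z, ‖F y - F z - L (y - z)‖ ≤ ‖L‖ / 4 * ‖y - z‖ :=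
    (hF.differentiable one_ne_zero z).hasFDerivAt.isLittleO.def (by positivity)
  obtain ⟨ρ, hρ, hb⟩ := Metric.eventually_nhds_iff.mp (hd.and (hU.eventually_mem hzU))
  filter_upwards [Ioo_mem_nhdsGT hρ] with r hr y hy hyΩ
  have hr0 := hr.1
  set w := y - (z + (r / 2) • e) with hw
  have hyz : y - z = (r / 2) • e + w := by rw [hw]; abel
  have hn : ‖y - z‖ < 5 / 8 * r := by
    rw [hyz]
    refine (norm_add_le _ _).trans_lt ?_
    rw [norm_smul, Real.norm_eq_abs, abs_of_pos (by linarith)]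
    nlinarith
  obtain ⟨h1, h2⟩ := hb (show dist y z < ρ by rw [dist_eq_norm]; linarith [hr.2])
  have h3 : F y < 0 := (hFU ▸ (⟨hyΩ, h2⟩ : y ∈ Ω ∩ U) : y ∈ {y ∈ U | F y < 0}).2
  have h4 : L (y - z) = r / 2 * L e + L w := by rw [hyz, map_add, map_smul, smul_eq_mul]
  have h5 : -(‖L‖ * (r / 8)) ≤ L w := by
    have := (L.le_opNorm w).trans (mul_le_mul_of_nonneg_left hy.le hL0.le)
    exact neg_le_of_abs_le this
  have h6 := neg_le_of_abs_le h1
  nlinarith [mul_le_mul_of_nonneg_left he (show 0 ≤ r / 2 by linarith),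
    mul_lt_mul_of_pos_left hn hL0]

lemma exists_rh_lower (N : ℕ) : ∃ c : ℝ, 0 < c ∧ ∀ r : ℝ, 0 < r → ∀ z : Euc N,
    ‖z‖ ≤ 3 / 4 * r → c * r⁻¹ ^ N ≤ rh r z := by
  obtain ⟨s₀, hs₀, hmin⟩ := (isCompact_Icc (a := (0 : ℝ)) (b := 9 / 16)).exists_isMinOn
    (nonempty_Icc.mpr (by norm_num)) contDiff_T1.continuous.continuousOn
  have hp : 0 < T1 s₀ := T1_pos (by linarith [hs₀.2])
  have hm := mass_pos N
  refine ⟨(mass N)⁻¹ * (2 * T1 s₀), by positivity, fun r hr z hz => ?_⟩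
  have h1 : ‖z‖ ^ 2 * r⁻¹ ^ 2 ∈ Icc (0 : ℝ) (9 / 16) := by
    refine ⟨by positivity, ?_⟩
    rw [← mul_pow, ← div_eq_mul_inv]
    have : ‖z‖ / r ≤ 3 / 4 := (div_le_iff₀ hr).mpr hz
    calc (‖z‖ / r) ^ 2 ≤ (3 / 4) ^ 2 := pow_le_pow_left₀ (by positivity) this 2
      _ = 9 / 16 := by norm_num
  have h2 : T1 s₀ ≤ T1 (‖z‖ ^ 2 * r⁻¹ ^ 2) := hmin h1
  unfold rh
  calc (mass N)⁻¹ * (2 * T1 s₀) * r⁻¹ ^ N = (mass N)⁻¹ * r⁻¹ ^ N * (2 * T1 s₀) := by ring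
    _ ≤ _ := by gcongr

/-- The mean of a function vanishing on a large enough portion of the ball is strictly
smaller than its supremum. -/
lemma exists_cv_rh_le_of_hole (N : ℕ) : ∃ θ : ℝ, 0 < θ ∧ θ ≤ 1 ∧
    ∀ (r m : ℝ) (x c : Euc N) (u : Euc N → ℝ), 0 < r → 0 ≤ m → Integrable u →
      ‖x - c‖ ≤ 5 / 8 * r → (∀ y, ‖y - c‖ < r / 8 → u y = 0) →
      (∀ᵐ y, ‖x - y‖ < r → u y ≤ m) → cv (rh r) u x ≤ (1 - θ) * m := by
  obtain ⟨c₀, hc₀, hlow⟩ := exists_rh_lower N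
  set V := (volume (Metric.ball (0 : Euc N) 1)).toReal with hV
  have hVpos : 0 < V := ENNReal.toReal_pos (Metric.measure_ball_pos _ _ one_pos).ne'
    measure_ball_lt_top.ne
  refine ⟨min 1 (c₀ * (1 / 8) ^ N * V), by positivity, min_le_left _ _, ?_⟩
  intro r m x c u hr hm hu hxc hole hum
  set D := Metric.ball c (r / 8) with hD
  have hvol : volume.real D = (r / 8) ^ N * V := by
    rw [hD, Measure.real, Measure.addHaar_ball_of_pos _ _ (by positivity), ENNReal.toReal_mul,
      ENNReal.toReal_ofReal (by positivity), finrank_euclideanSpace_fin]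
  have hki : Integrable fun y => rh r (x - y) := (Tst_rh hr).integrable.comp_sub_left x
  have hk1 : ∫ y, rh r (x - y) = 1 := by
    rw [integral_sub_left_eq_self (fun z => rh r z) volume x, integral_rh hr]
  have hDlow : c₀ * (1 / 8) ^ N * V ≤ ∫ y in D, rh r (x - y) := by
    have h1 : ∫ y in D, c₀ * r⁻¹ ^ N ≤ ∫ y in D, rh r (x - y) := by
      refine setIntegral_mono_on (integrableOn_const measure_ball_lt_top.ne) hki.integrableOn
        measurableSet_ball fun y hy => hlow r hr _ ?_
      rw [hD, Metric.mem_ball, dist_eq_norm] at hy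
      calc ‖x - y‖ = ‖(x - c) - (y - c)‖ := by congr 1; abel
        _ ≤ ‖x - c‖ + ‖y - c‖ := norm_sub_le _ _
        _ ≤ _ := by linarith
    rw [setIntegral_const, hvol, smul_eq_mul] at h1
    refine le_trans (le_of_eq ?_) h1
    have h2 : (1 / 8 : ℝ) ^ N = (r / 8) ^ N * r⁻¹ ^ N := by
      rw [← mul_pow]
      congr 1
      field_simp
    rw [h2]
    ring
  have hle : cv (rh r) u x ≤ ∫ y, m * (rh r (x - y) - D.indicator (fun y => rh r (x - y)) y) := by
    refine integral_mono_ae (cv_integrable (Tst_rh hr) hu x)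
      ((hki.sub (hki.indicator measurableSet_ball)).const_mul m) (hum.mono fun y hy => ?_)
    by_cases hyD : y ∈ D
    · have h0 : u y = 0 := by
        rw [hD, Metric.mem_ball, dist_eq_norm] at hyD
        exact hole y hyD
      simp only [indicator_of_mem hyD, h0]
      simp
    · simp only [indicator_of_notMem hyD, sub_zero]
      rcases lt_or_ge ‖x - y‖ r with h | h
      · exact mul_le_mul_of_nonneg_right (hy h) (rh_nonneg hr _)
      · simp [rh_zero hr h]
  rw [integral_const_mul, integral_sub hki (hki.indicator measurableSet_ball), hk1,
    integral_indicator measurableSet_ball] at hle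
  have := min_le_right 1 (c₀ * (1 / 8) ^ N * V)
  nlinarith

/-- Bounded subsolutions vanishing outside `Ω` are continuous at `C¹` boundary points. -/
lemma boundary_decay {Ω : Set (Euc N)} (hΩ : IsOpen Ω) {z : Euc N} (hz : z ∈ frontier Ω)
    (hreg : ∃ U : Set (Euc N), IsOpen U ∧ z ∈ U ∧
      ∃ F : Euc N → ℝ, ContDiff ℝ 1 F ∧ (∀ y ∈ U, fderiv ℝ F y ≠ 0) ∧
        Ω ∩ U = {y ∈ U | F y < 0}) {u U : Euc N → ℝ} {B C : ℝ} (hu : Integrable u)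
    (hB : 0 ≤ B) (hC : 0 ≤ C) (hUB : ∀ x ∈ Ω, U x ≤ B) (hu0 : ∀ x, x ∉ Ω → u x = 0)
    (hlim : ∀ x ∈ Ω, Tendsto (fun δ => cv (rh δ) u x) (𝓝[>] 0) (𝓝 (U x)))
    (hae : ∀ᵐ x, x ∈ Ω → U x = u x)
    (hsub : ∀ x ∈ Ω, ∀ ε, 0 < ε → ε ≤ 1 → -(∫ y, u y * lap (fun y => sg ε (x - y)) y) ≤ C) :
    ∀ η > 0, ∃ ρ > 0, ∀ x ∈ Ω, dist x z < ρ → U x ≤ η := by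
  obtain ⟨e, he1, hball⟩ := exists_exterior_balls hΩ hz hreg
  obtain ⟨θ, hθ, hθ1, hhole⟩ := exists_cv_rh_le_of_hole N
  set S := {m : ℝ | 0 ≤ m ∧ ∃ ρ > 0, ∀ x ∈ Ω, dist x z < ρ → U x ≤ m} with hS
  have hBS : B ∈ S := ⟨hB, 1, one_pos, fun x hx _ => hUB x hx⟩
  have hbdd : BddBelow S := ⟨0, fun m hm => hm.1⟩
  have hL0 : 0 ≤ sInf S := le_csInf ⟨B, hBS⟩ fun m hm => hm.1
  have step : ∀ m ∈ S, ∀ η > 0, (1 - θ) * m + η ∈ S := by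
    rintro m ⟨hm, ρ, hρ, hUm⟩ η hη
    refine ⟨by nlinarith, ?_⟩
    have hsmall : ∀ᶠ r : ℝ in 𝓝[>] 0, C * r ^ 2 ≤ η := by
      have : Tendsto (fun r : ℝ => C * r ^ 2) (𝓝[>] 0) (𝓝 (C * 0 ^ 2)) :=
        ((continuous_const.mul (continuous_pow 2)).tendsto 0).mono_left nhdsWithin_le_nhds
      rw [zero_pow two_ne_zero, mul_zero] at this
      exact (this.eventually (gt_mem_nhds hη)).mono fun r hr => le_of_lt hr
    obtain ⟨r, hr1, hr2, hr3⟩ := (hball.and (hsmall.and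
      (Ioc_mem_nhdsGT (show (0 : ℝ) < min 1 (ρ / 2) by positivity)))).exists
    have hr0 := hr3.1
    refine ⟨r / 8, by linarith, fun x hx hxz => ?_⟩
    rw [dist_eq_norm] at hxz
    have h1 : cv (rh r) u x ≤ (1 - θ) * m := by
      refine hhole r m x (z + (r / 2) • e) u hr0 hm hu ?_ (fun y hy => hu0 y (hr1 y hy)) ?_
      · rw [show x - (z + (r / 2) • e) = (x - z) - (r / 2) • e by abel]
        refine (norm_sub_le _ _).trans ?_
        rw [norm_smul, Real.norm_eq_abs, abs_of_pos (by linarith)]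
        nlinarith
      · filter_upwards [hae] with y hy hxy
        by_cases hyΩ : y ∈ Ω
        · rw [← hy hyΩ]
          refine hUm y hyΩ ?_
          rw [dist_eq_norm]
          have := norm_sub_le (x - z) (x - y)
          rw [show x - z - (x - y) = y - z by abel] at this
          linarith [hr3.2.trans (min_le_right _ _)]
        · rw [hu0 y hyΩ]
          exact hm
    have h2 : ∀ δ, 0 < δ → δ ≤ r → cv (rh δ) u x ≤ cv (rh r) u x + C * r ^ 2 := fun δ hδ hδr =>
      cv_rh_le_add hδ hδr hu (fun ε h1 h2 => hsub x hx ε h1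
        (h2.trans (hr3.2.trans (min_le_left _ _)))) hC
    have h3 : U x ≤ cv (rh r) u x + C * r ^ 2 := le_of_tendsto (hlim x hx)
      (eventually_of_mem (Ioc_mem_nhdsGT hr0) fun δ hδ => h2 δ hδ.1 hδ.2)
    linarith
  have hle : sInf S ≤ (1 - θ) * sInf S := by
    refine le_of_forall_pos_le_add fun η hη => ?_
    obtain ⟨m, hmS, hm⟩ := exists_lt_of_csInf_lt ⟨B, hBS⟩ (show sInf S < sInf S + η / 2 by linarith)
    have := csInf_le hbdd (step m hmS (η / 2) (by linarith))
    nlinarith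
  have hL : sInf S ≤ 0 := by nlinarith
  intro η hη
  obtain ⟨m, ⟨-, ρ, hρ, hm⟩, hmη⟩ := exists_lt_of_csInf_lt ⟨B, hBS⟩ (hL.trans_lt hη)
  exact ⟨ρ, hρ, fun x hx hxz => (hm x hx hxz).trans hmη.le⟩

end Boundary

section ClassicalSolution
variable {N : ℕ}

lemma lap_neg_one_mul {φ : Euc N → ℝ} (hφ : Tst φ) (x : Euc N) :
    lap (fun y => -1 * φ y) x = -lap φ x := by
  have e : ∀ {ψ : Euc N → ℝ}, Tst ψ → ∀ i, pd i (fun y => -1 * ψ y) = fun y => -1 * pd i ψ y := by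
    intro ψ hψ i
    funext y
    unfold pd
    rw [fderiv_const_mul (hψ.differentiable y)]
    simp
  simp only [lap_eq_sum_pd, ← Finset.sum_neg_distrib]
  refine Finset.sum_congr rfl fun i _ => ?_
  rw [e hφ, e (hφ.pderiv i)]
  ring

lemma lap_congr {u v : Euc N → ℝ} {x : Euc N} (h : u =ᶠ[𝓝 x] v) : lap u x = lap v x := by
  simp only [lap_eq_sum_pd]
  refine Finset.sum_congr rfl fun i _ => ?_
  have h1 : pd i u =ᶠ[𝓝 x] pd i v :=
    h.eventuallyEq_nhds.mono fun y hy => by unfold pd; rw [hy.fderiv_eq]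
  unfold pd at h1 ⊢
  rw [h1.fderiv_eq]

lemma integrable_mul_tst {w φ : Euc N → ℝ} (hw : Integrable w) (hφ : Tst φ) :
    Integrable fun x => w x * φ x := by
  obtain ⟨c, -, hc⟩ := hφ.bdd
  exact hw.mul_bdd hφ.continuous.aestronglyMeasurable (Eventually.of_forall hc)

namespace Nonlin
variable {Ω : Set (Euc N)} {k : Euc N → ℝ → ℝ} {a b M : ℝ} (H : Nonlin N Ω k a b M)
include H

/-- A bounded, everywhere-defined representative of the weak solution. -/
lemma exists_bounded_weak_solution {lam R K₀ ℓ₀ : ℝ} {u₀ : Euc N → ℝ} (hΩ : IsOpen Ω)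
    (hΩR : ∀ x ∈ Ω, ‖x‖ ≤ R) (hlam : 0 < lam) (h₀ : Adm Ω k (R + 1) lam u₀ K₀ ℓ₀) :
    ∃ (u : Euc N → ℝ) (B : ℝ), Measurable u ∧ (∀ x, 0 ≤ u x) ∧ (∀ x, u x ≤ B) ∧
      (∀ x, x ∉ Ω → u x = 0) ∧ (¬ u =ᵐ[volume] 0) ∧ Integrable u ∧
      lam * (1 / 2 - 1 / a) * (∫ x, u x ^ 2) ≤ ℓ₀ ∧
      ∀ φ, Tst φ → (∀ x, x ∉ Ω → φ x ≤ 0) → (∀ x, R + 1 < ‖x‖ → φ x = 0) →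
        ∫ x, k x (u x) * φ x ≤ -(∫ x, u x * lap φ x) + lam * ∫ x, u x * φ x := by
  obtain ⟨v, K, hv0, hvoff, hne, hEn, hL2, hweak⟩ := H.exists_weak_solution hlam h₀
  have hm := hEn.1.aestronglyMeasurable
  set v₁ : Euc N → ℝ := Ω.indicator (fun x => max 0 (hm.mk v x)) with hv₁
  have hv₁m : Measurable v₁ :=
    (measurable_const.max hm.stronglyMeasurable_mk.measurable).indicator hΩ.measurableSet
  have hv₁v : v₁ =ᵐ[volume] v := by
    filter_upwards [hm.ae_eq_mk] with x hx
    by_cases hxΩ : x ∈ Ω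
    · rw [hv₁, indicator_of_mem hxΩ, ← hx, max_eq_right (hv0 x)]
    · rw [hv₁, indicator_of_notMem hxΩ, hvoff x hxΩ]
  have hv₁0 : ∀ x, 0 ≤ v₁ x := fun x => indicator_nonneg (fun y _ => le_max_left _ _) x
  have hv₁off : ∀ x, x ∉ Ω → v₁ x = 0 := fun x hx => indicator_of_notMem hx _
  have weak_congr : ∀ w : Euc N → ℝ, w =ᵐ[volume] v →
      ∀ φ, Tst φ → (∀ x, x ∉ Ω → φ x ≤ 0) → (∀ x, R + 1 < ‖x‖ → φ x = 0) →
        ∫ x, k x (w x) * φ x ≤ -(∫ x, w x * lap φ x) + lam * ∫ x, w x * φ x := by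
    intro w hw φ h1 h2 h3
    have e1 : ∫ x, k x (w x) * φ x = ∫ x, k x (v x) * φ x :=
      integral_congr_ae (hw.mono fun x hx => by simp only [hx])
    have e2 : ∫ x, w x * lap φ x = ∫ x, v x * lap φ x :=
      integral_congr_ae (hw.mono fun x hx => by simp only [hx])
    have e3 : ∫ x, w x * φ x = ∫ x, v x * φ x :=
      integral_congr_ae (hw.mono fun x hx => by simp only [hx])
    rw [e1, e2, e3]
    exact hweak φ h1 h2 h3
  have hfp : Fp b v₁ := (H.fp hEn).congr hv₁v.symm
  have hR0 : ∀ x, R < ‖x‖ → v₁ x = 0 := fun x hx => hv₁off x fun h => (hΩR x h).not_gt hx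
  have hi₁ := hfp.integrable_of_support H.two_lt_b hR0
  obtain ⟨B, hB0, hB⟩ := H.exists_ae_bound hΩR hfp hv₁m hv₁0 hR0 fun x hx ε h1 h2 => by
    have hT := (Tst_sg (N := N) h1).reflect x
    have := weak_congr v₁ hv₁v _ (hT.const_mul (-1))
      (fun y _ => by nlinarith [sg_nonneg h1 (x - y)])
      (fun y hy => by
        rw [sg_zero h1, mul_zero]
        have := norm_sub_norm_le y x
        rw [norm_sub_rev] at this
        linarith)
    simp only [lap_neg_one_mul hT] at this
    simp only [mul_neg, neg_mul, one_mul, integral_neg, neg_neg] at this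
    have h3 : 0 ≤ lam * ∫ y, v₁ y * sg ε (x - y) :=
      mul_nonneg hlam.le (integral_nonneg fun y => mul_nonneg (hv₁0 y) (sg_nonneg h1 _))
    simp only [cv]
    linarith
  have hev : (fun x => min (v₁ x) B) =ᵐ[volume] v := by
    filter_upwards [hv₁v, hB] with x h1 h2
    rw [min_eq_left h2, h1]
  refine ⟨fun x => min (v₁ x) B, B, hv₁m.min measurable_const, fun x => le_min (hv₁0 x) hB0,
    fun x => min_le_right _ _, fun x hx => by simp only [hv₁off x hx, min_eq_left hB0],
    fun h => hne (hev.symm.trans h), hi₁.congr (hv₁v.trans hev.symm), ?_, weak_congr _ hev⟩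
  rwa [integral_congr_ae (hev.mono fun x hx => by simp only [hx] :
    (fun x => (min (v₁ x) B) ^ 2) =ᵐ[volume] fun x => v x ^ 2)]

/-- Existence of a classical positive solution with controlled `L²` norm. -/
lemma exists_isPosSolution {lam R K₀ ℓ₀ : ℝ} {u₀ : Euc N → ℝ} {f : Euc N → ℝ → ℝ}
    (hΩ : IsOpen Ω) (hconn : IsPreconnected Ω) (hΩR : ∀ x ∈ Ω, ‖x‖ ≤ R)
    (hreg : ∀ z ∈ frontier Ω, ∃ U : Set (Euc N), IsOpen U ∧ z ∈ U ∧
      ∃ F : Euc N → ℝ, ContDiff ℝ 1 F ∧ (∀ y ∈ U, fderiv ℝ F y ≠ 0) ∧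
        Ω ∩ U = {y ∈ U | F y < 0})
    (hf : ContDiffOn ℝ 1 (Function.uncurry f) (Ω ×ˢ (univ : Set ℝ)))
    (hkf : ∀ x ∈ Ω, ∀ t, 0 ≤ t → k x t = f x t) (hlam : 0 < lam)
    (h₀ : Adm Ω k (R + 1) lam u₀ K₀ ℓ₀) :
    ∃ U, IsPosSolution Ω f lam U ∧ lam * (1 / 2 - 1 / a) * (∫ x in Ω, U x ^ 2) ≤ ℓ₀ := by
  obtain ⟨u, B, hum, hu0, huB, huoff, hne, hui, hL2, hweak⟩ :=
    H.exists_bounded_weak_solution hΩ hΩR hlam h₀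
  have hB0 : 0 ≤ B := (hu0 0).trans (huB 0)
  set h : Euc N → ℝ := fun x => k x (u x) with hh
  have hh0 : ∀ x, 0 ≤ h x := fun x => H.nonneg x _
  set C := M * (B + B ^ (b - 1)) with hC
  have hC0 : 0 ≤ C := mul_nonneg H.M_nonneg (add_nonneg hB0 (Real.rpow_nonneg hB0 _))
  have hhC : ∀ x, h x ≤ C := fun x => (H.le_growth x (hu0 x)).trans
    (mul_le_mul_of_nonneg_left (add_le_add (huB x) (Real.rpow_le_rpow (hu0 x) (huB x)
      (by linarith [H.two_lt_b]))) H.M_nonneg)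
  have hhm : Measurable h := H.meas.comp (measurable_id.prodMk hum)
  have hhi : Integrable h := by
    have hv : volume Ω ≠ ⊤ := ((measure_mono (fun x hx => by simpa using hΩR x hx)).trans_lt
      (measure_closedBall_lt_top (x := (0 : Euc N)) (r := R))).ne
    have h1 : Integrable (Ω.indicator fun _ : Euc N => C) :=
      (integrable_indicator_iff hΩ.measurableSet).mpr (integrableOn_const hv)
    refine h1.mono' hhm.aestronglyMeasurable (Eventually.of_forall fun x => ?_)
    rw [Real.norm_eq_abs, abs_of_nonneg (hh0 x)]
    by_cases hx : x ∈ Ω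
    · rw [indicator_of_mem hx]; exact hhC x
    · rw [indicator_of_notMem hx]; exact (H.off x _ hx).le
  have hoff : ∀ {φ : Euc N → ℝ}, tsupport φ ⊆ Ω → ∀ x, x ∉ Ω → φ x = 0 := fun ht x hx =>
    image_eq_zero_of_notMem_tsupport fun h => hx (ht h)
  have hweq : ∀ φ, Tst φ → tsupport φ ⊆ Ω →
      -(∫ x, u x * lap φ x) = (∫ x, h x * φ x) - lam * ∫ x, u x * φ x := by
    intro φ hφ ht
    have hR : ∀ x, R + 1 < ‖x‖ → φ x = 0 := fun x hx =>
      hoff ht x fun h => by linarith [hΩR x h]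
    have h1 := hweak φ hφ (fun x hx => (hoff ht x hx).le) hR
    have h2 := hweak _ (hφ.const_mul (-1)) (fun x hx => by simp [hoff ht x hx])
      (fun x hx => by simp [hR x hx])
    simp only [lap_neg_one_mul hφ] at h2
    simp only [mul_neg, neg_mul, one_mul, integral_neg, neg_neg] at h2
    linarith
  have hsub : ∀ x ∈ Ω, ∀ ε, 0 < ε → ε ≤ 1 →
      -(∫ y, u y * lap (fun y => sg ε (x - y)) y) ≤ C := by
    intro x hx ε h1 h2
    have hT := (Tst_sg (N := N) h1).reflect x
    have h3 := hweak _ (hT.const_mul (-1)) (fun y _ => by nlinarith [sg_nonneg h1 (x - y)])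
      (fun y hy => by
        rw [sg_zero h1, mul_zero]
        have := norm_sub_norm_le y x
        rw [norm_sub_rev] at this
        linarith [hΩR x hx])
    simp only [lap_neg_one_mul hT] at h3
    simp only [mul_neg, neg_mul, one_mul, integral_neg, neg_neg] at h3
    have h4 : 0 ≤ lam * ∫ y, u y * sg ε (x - y) :=
      mul_nonneg hlam.le (integral_nonneg fun y => mul_nonneg (hu0 y) (sg_nonneg h1 _))
    have h5 : (∫ y, h y * sg ε (x - y)) ≤ C := (le_abs_self _).trans
      (abs_cv_sg_le h1 (fun y => by rw [abs_of_nonneg (hh0 y)]; exact hhC y) hC0 x)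
    linarith
  obtain ⟨V, hV, hlim, hae⟩ := exists_contDiffOn_one_of_weak hΩ hui
    (hhi.sub (hui.const_mul lam)) (C := C + lam * B)
    (fun y => by
      simp only [Pi.sub_apply]
      have := mul_le_mul_of_nonneg_left (huB y) hlam.le
      have := mul_nonneg hlam.le (hu0 y)
      rw [abs_le]
      constructor <;> linarith [hh0 y, hhC y])
    (fun φ hφ ht => by
      rw [hweq φ hφ ht, ← integral_const_mul, ← integral_sub
        (integrable_mul_tst hhi hφ) ((integrable_mul_tst hui hφ).const_mul lam)]
      refine integral_congr_ae (Eventually.of_forall fun x => ?_)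
      simp only [Pi.sub_apply]
      ring)
  have hpos : ∀ x ∈ Ω, 0 < V x := by
    refine pos_of_weak hΩ hconn hlam.le hui hu0 huB (fun h => hne ?_) hV.continuousOn hlim hae
      fun φ hφ hφ0 ht => ?_
    · filter_upwards [h] with x hx
      by_cases hxΩ : x ∈ Ω
      · exact hx hxΩ
      · exact huoff x hxΩ
    · have := hweq φ hφ ht
      have : 0 ≤ ∫ x, h x * φ x := integral_nonneg fun x => mul_nonneg (hh0 x) (hφ0 x)
      linarith
  have hcl := classical_of_weak (h := fun x => f x (V x) - lam * V x) hΩ hV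
    ((hf.comp (contDiffOn_id.prodMk hV) fun x hx => ⟨hx, trivial⟩).sub
      (contDiffOn_const.mul hV)) fun φ hφ ht => by
    have e1 : ∫ x, V x * lap φ x = ∫ x, u x * lap φ x := by
      refine integral_congr_ae (hae.mono fun x hx => ?_)
      by_cases hxΩ : x ∈ Ω
      · simp only [hx hxΩ]
      · simp [hoff ((tsupport_lap_subset φ).trans ht) x hxΩ]
    have e2 : ∫ x, (f x (V x) - lam * V x) * φ x = ∫ x, (h x * φ x - lam * (u x * φ x)) := by
      refine integral_congr_ae (hae.mono fun x hx => ?_)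
      by_cases hxΩ : x ∈ Ω
      · simp only [hh, hx hxΩ, hkf x hxΩ _ (hu0 x)]
        ring
      · simp [hoff ht x hxΩ]
    rw [e1, e2, hweq φ hφ ht, integral_sub (integrable_mul_tst hhi hφ)
      ((integrable_mul_tst hui hφ).const_mul lam), integral_const_mul]
  have hVB : ∀ x ∈ Ω, V x ≤ B := fun x hx =>
    le_of_tendsto (hlim x hx) (eventually_of_mem self_mem_nhdsWithin fun δ hδ => by
      refine (le_abs_self _).trans
        ((abs_cv_le_of_bdd (Tst_rh hδ) (C := B) (fun y => ?_) x).trans ?_)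
      · rw [abs_of_nonneg (hu0 y)]
        exact huB y
      · have := integral_abs_le_of_le_rh (N := N) (k := rh δ) (c := 1) hδ fun z => by
          rw [abs_of_nonneg (rh_nonneg hδ z), one_mul]
        nlinarith)
  have heq : ∀ x ∈ Ω, Ω.indicator V =ᶠ[𝓝 x] V := fun x hx =>
    eventually_of_mem (hΩ.mem_nhds hx) fun y hy => indicator_of_mem hy _
  refine ⟨Ω.indicator V, ⟨?_, ?_, ?_, ?_, ?_⟩, ?_⟩
  · exact hcl.1.congr fun x hx => indicator_of_mem hx _
  · intro z hz
    by_cases hzΩ : z ∈ Ω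
    · exact ((hV.continuousOn.continuousAt (hΩ.mem_nhds hzΩ)).congr
        (heq z hzΩ).symm).continuousWithinAt
    · have hzf : z ∈ frontier Ω := by rw [hΩ.frontier_eq]; exact ⟨hz, hzΩ⟩
      have hdec := boundary_decay hΩ hzf (hreg z hzf) hui hB0 hC0 hVB huoff hlim hae hsub
      refine Metric.continuousWithinAt_iff.mpr fun η hη => ?_
      obtain ⟨ρ, hρ, hd⟩ := hdec (η / 2) (by positivity)
      refine ⟨ρ, hρ, fun {y} _ hy => ?_⟩
      rw [indicator_of_notMem hzΩ, dist_zero_right]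
      by_cases hyΩ : y ∈ Ω
      · rw [indicator_of_mem hyΩ, Real.norm_eq_abs, abs_of_pos (hpos y hyΩ)]
        linarith [hd y hyΩ hy]
      · rw [indicator_of_notMem hyΩ, norm_zero]
        exact hη
  · intro x hx
    rw [indicator_of_mem hx]
    exact hpos x hx
  · intro x hx
    rw [hΩ.frontier_eq] at hx
    exact indicator_of_notMem hx.2 _
  · intro x hx
    rw [lap_congr (heq x hx), indicator_of_mem hx]
    have := hcl.2 x hx
    linarith
  · have e : ∫ x in Ω, Ω.indicator V x ^ 2 = ∫ x, u x ^ 2 := by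
      rw [← integral_indicator hΩ.measurableSet]
      refine integral_congr_ae (hae.mono fun x hx => ?_)
      by_cases hxΩ : x ∈ Ω
      · simp only [indicator_of_mem hxΩ, hx hxΩ]
      · simp only [indicator_of_notMem hxΩ, huoff x hxΩ]
        simp
    rw [e]
    exact hL2

end Nonlin
end ClassicalSolution

section Growth

/-- A differential inequality integrates to superhomogeneity. -/
lemma rpow_mul_le_of_deriv {h : ℝ → ℝ} {c s t : ℝ} (hd : ∀ r, 0 < r → DifferentiableAt ℝ h r)
    (hc : ∀ r, 0 < r → c * h r ≤ deriv h r * r) (hs : 1 ≤ s) (ht : 0 < t) :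
    s ^ c * h t ≤ h (s * t) := by
  have hder : ∀ r, 0 < r → HasDerivAt (fun r => h (r * t) * r ^ (-c))
      (deriv h (r * t) * (1 * t) * r ^ (-c) + h (r * t) * (-c * r ^ (-c - 1))) r := fun r hr =>
    ((hd _ (mul_pos hr ht)).hasDerivAt.comp r ((hasDerivAt_id r).mul_const t)).mul
      (Real.hasDerivAt_rpow_const (Or.inl hr.ne'))
  have hmono : MonotoneOn (fun r => h (r * t) * r ^ (-c)) (Ici 1) := by
    refine monotoneOn_of_deriv_nonneg (convex_Ici 1)
      (fun r hr => (hder r (one_pos.trans_le hr)).continuousAt.continuousWithinAt)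
      (fun r hr => ?_) fun r hr => ?_
    all_goals
      rw [interior_Ici] at hr
      have hr0 : 0 < r := one_pos.trans hr
    · exact (hder r hr0).differentiableAt.differentiableWithinAt
    · rw [(hder r hr0).deriv, Real.rpow_sub_one hr0.ne']
      have h1 := hc _ (mul_pos hr0 ht)
      have h2 : 0 ≤ r ^ (-c) / r := by positivity
      have h3 : r ^ (-c) = r ^ (-c) / r * r := by field_simp
      have h4 := mul_nonneg h2 (sub_nonneg.2 h1)
      calc 0 ≤ _ := h4
        _ = deriv h (r * t) * (1 * t) * (r ^ (-c) / r * r)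
            + h (r * t) * (-c * (r ^ (-c) / r)) := by ring
        _ = _ := by rw [← h3]
  have h1 := hmono (mem_Ici.2 le_rfl) (mem_Ici.2 hs) hs
  have hs0 : 0 < s := one_pos.trans_le hs
  simp only [one_mul, Real.one_rpow, mul_one, Real.rpow_neg hs0.le] at h1
  calc s ^ c * h t ≤ s ^ c * (h (s * t) * (s ^ c)⁻¹) :=
        mul_le_mul_of_nonneg_left h1 (by positivity)
    _ = h (s * t) := by
        have : s ^ c ≠ 0 := (Real.rpow_pos_of_pos hs0 c).ne'
        field_simp

/-- The nonlinearity, extended by zero outside `Ω × (0, ∞)`. -/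
def truncation {N : ℕ} (Ω : Set (Euc N)) (f : Euc N → ℝ → ℝ) (x : Euc N) (t : ℝ) : ℝ :=
  Ω.indicator (fun x => f x (max t 0)) x

namespace Standing
variable {N : ℕ} {Ω : Set (Euc N)} {f : Euc N → ℝ → ℝ} {d : Euc N → ℝ} {g : Euc N → ℝ → ℝ}
  {p : ℝ} {u : ℝ → Euc N → ℝ} (H : Standing N Ω f d g p u)
include H

lemma continuousOn_uncurry : ContinuousOn (Function.uncurry f) (Ω ×ˢ (univ : Set ℝ)) :=
  H.f_c1.continuousOn

lemma continuousOn_left (t : ℝ) : ContinuousOn (fun x => f x t) Ω :=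
  H.continuousOn_uncurry.comp (f := fun x => (x, t)) (by fun_prop) fun _ hx => ⟨hx, trivial⟩

lemma differentiableAt_right {x : Euc N} (hx : x ∈ Ω) (t : ℝ) : DifferentiableAt ℝ (f x) t := by
  have h1 : DifferentiableAt ℝ (Function.uncurry f) (x, t) :=
    (H.f_c1.contDiffAt ((H.isOpen.prod isOpen_univ).mem_nhds ⟨hx, trivial⟩)).differentiableAt
      one_ne_zero
  exact h1.comp t (f := fun t => (x, t)) (by fun_prop)

lemma exists_growth : ∃ a b : ℝ, 2 < a ∧ a ≤ b ∧ (3 ≤ N → b < 2 * N / ((N : ℝ) - 2)) ∧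
    ∀ x ∈ Ω, ∀ s t, 1 ≤ s → 0 < t →
      0 ≤ f x t ∧ s ^ (a - 1) * f x t ≤ f x (s * t) ∧ f x (s * t) ≤ s ^ (b - 1) * f x t := by
  obtain ⟨a, b, ha, hab, hb, hae⟩ := H.f_ar
  refine ⟨a, b, ha, hab, hb, fun x hx s t hs ht => ?_⟩
  set P : Set (Euc N) := {x | x ∈ Ω → ∀ t : ℝ, t ≠ 0 → 0 < (a - 1) * f x t * t ∧
    (a - 1) * f x t * t ≤ deriv (f x) t * t ^ 2 ∧
      deriv (f x) t * t ^ 2 ≤ (b - 1) * f x t * t} with hP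
  have hdense : Dense P :=
    Measure.dense_of_ae ((ae_restrict_iff' H.isOpen.measurableSet).mp hae)
  have hcl : x ∈ closure (Ω ∩ P) := hdense.open_subset_closure_inter H.isOpen hx
  have hcont : ∀ r, ContinuousWithinAt (fun y => f y r) (Ω ∩ P) x := fun r =>
    (H.continuousOn_left r x hx).mono inter_subset_left
  have key : ∀ y ∈ Ω ∩ P, ∀ r, 0 < r → 0 ≤ f y r ∧ (a - 1) * f y r ≤ deriv (f y) r * r ∧
      deriv (f y) r * r ≤ (b - 1) * f y r := by
    intro y hy r hr
    obtain ⟨h1, h2, h3⟩ := hy.2 hy.1 r hr.ne'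
    refine ⟨?_, le_of_mul_le_mul_right (by linarith) hr, le_of_mul_le_mul_right (by linarith) hr⟩
    have h4 : 0 < (a - 1) * f y r := pos_of_mul_pos_left h1 hr.le
    exact (pos_of_mul_pos_right h4 (by linarith)).le
  refine ⟨continuousWithinAt_const.closure_le hcl (hcont t) fun y hy => (key y hy t ht).1,
    (continuousWithinAt_const.mul (hcont t)).closure_le hcl (hcont _) fun y hy => ?_,
    (hcont _).closure_le hcl (continuousWithinAt_const.mul (hcont t)) fun y hy => ?_⟩
  · exact rpow_mul_le_of_deriv (fun r _ => H.differentiableAt_right hy.1 r)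
      (fun r hr => (key y hy r hr).2.1) hs ht
  · have h1 := rpow_mul_le_of_deriv (h := fun r => -f y r) (c := b - 1)
      (fun r _ => (H.differentiableAt_right hy.1 r).neg)
      (fun r hr => by
        rw [(H.differentiableAt_right hy.1 r).hasDerivAt.fun_neg.deriv]
        linarith [(key y hy r hr).2.2]) hs ht
    rw [mul_neg] at h1
    exact neg_le_neg_iff.mp h1

lemma exists_nonlin : ∃ a b M, Nonlin N Ω (truncation Ω f) a b M := by
  obtain ⟨a, b, ha, hab, hb, hg⟩ := H.exists_growth
  obtain ⟨M, hM, hfM⟩ := H.f_bdd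
  have hN := H.dim
  have hk : ∀ x ∈ Ω, ∀ t, 0 ≤ t → truncation Ω f x t = f x t := fun x hx t ht => by
    rw [truncation, indicator_of_mem hx, max_eq_left ht]
  have hoff : ∀ x, x ∉ Ω → ∀ t, truncation Ω f x t = 0 := fun x hx t => indicator_of_notMem hx _
  have hneg : ∀ x t, t ≤ 0 → truncation Ω f x t = 0 := fun x t ht => by
    by_cases hx : x ∈ Ω
    · rw [truncation, indicator_of_mem hx, max_eq_right ht, (H.f_zero x hx).1]
    · exact hoff x hx t
  have h1M : ∀ x ∈ Ω, f x 1 ≤ M := fun x hx => (le_abs_self _).trans (hfM x hx).1.le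
  refine ⟨a, b, M, ha, hab, ?_, hN, ?_, ?_, ?_, hneg, fun x t hx => hoff x hx t, ?_, ?_, ?_⟩
  · have hb0 : 0 < b := by linarith
    rcases hN.eq_or_lt with h2 | h3
    · rw [← h2]
      norm_num
      exact hb0
    · have hN3 : (3 : ℝ) ≤ N := by exact_mod_cast h3
      have := (lt_div_iff₀ (by linarith)).mp (hb h3)
      rw [lt_div_iff₀ hb0]
      have e : (1 / 2 - 1 / (N : ℝ)) * b = b * (N - 2) / (2 * N) := by field_simp
      rw [e, div_lt_one (by positivity)]
      linarith
  · classical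
    have e : Function.uncurry (truncation Ω f) = (Ω ×ˢ (univ : Set ℝ)).piecewise
        (fun q => f q.1 (max q.2 0)) 0 := by
      funext q
      by_cases hq : q.1 ∈ Ω
      · rw [piecewise_eq_of_mem _ _ _ (mk_mem_prod hq (mem_univ q.2)), Function.uncurry, truncation,
          indicator_of_mem hq]
      · rw [piecewise_eq_of_notMem _ _ _ fun h => hq h.1, Function.uncurry, hoff _ hq,
          Pi.zero_apply]
    rw [e]
    refine ContinuousOn.measurable_piecewise ?_ continuousOn_const
      (H.isOpen.prod isOpen_univ).measurableSet
    exact H.continuousOn_uncurry.comp (f := fun q : Euc N × ℝ => (q.1, max q.2 0))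
      (by fun_prop) fun q hq => ⟨hq.1, trivial⟩
  · intro x
    by_cases hx : x ∈ Ω
    · have : truncation Ω f x = fun t => f x (max t 0) := by
        funext t
        rw [truncation, indicator_of_mem hx]
      rw [this]
      exact (continuous_iff_continuousAt.2 fun t =>
        (H.differentiableAt_right hx t).continuousAt).comp (by fun_prop)
    · rw [show truncation Ω f x = fun _ => 0 from funext (hoff x hx)]
      exact continuous_const
  · intro x t
    by_cases hx : x ∈ Ω
    · rcases le_or_gt t 0 with ht | ht
      · exact (hneg x t ht).ge
      · rw [hk x hx t ht.le]
        exact (hg x hx 1 t le_rfl ht).1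
    · exact (hoff x hx t).ge
  · intro x t ht
    by_cases hx : x ∈ Ω
    · rw [hk x hx t (by linarith)]
      have h1 := (hg x hx t 1 ht one_pos).2.2
      rw [mul_one] at h1
      rw [mul_comm M]
      exact h1.trans (mul_le_mul_of_nonneg_left (h1M x hx) (by positivity))
    · rw [hoff x hx]
      positivity
  · intro x t ht0 ht
    by_cases hx : x ∈ Ω
    · rcases ht0.eq_or_lt with rfl | ht0
      · rw [hneg x 0 le_rfl]
        positivity
      · rw [hk x hx t ht0.le]
        have h1 := (hg x hx t⁻¹ t ((one_le_inv₀ ht0).2 ht) ht0).2.1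
        rw [inv_mul_cancel₀ ht0.ne', Real.inv_rpow ht0.le, inv_mul_le_iff₀ (by positivity)] at h1
        rw [mul_comm M]
        exact h1.trans (mul_le_mul_of_nonneg_left (h1M x hx) (by positivity))
    · rw [hoff x hx]
      positivity
  · intro x s t hs ht
    by_cases hx : x ∈ Ω
    · rw [hk x hx t ht.le, hk x hx _ (by positivity)]
      exact (hg x hx s t hs ht).2.1
    · rw [hoff x hx, hoff x hx, mul_zero]

/-- Flipping the sign of one coordinate preserves `Ω`. -/
lemma reflect_mem (i : Fin N) {x y : Euc N} (hx : x ∈ Ω) (hi : y i = -x i)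
    (hj : ∀ j, j ≠ i → y j = x j) : y ∈ Ω := by
  obtain ⟨ℓ, -, β, -, -, -, hsymm⟩ := H.symm
  set e : Euc N ≃ₗᵢ[ℝ] Euc N := LinearIsometryEquiv.piLpCongrRight 2 fun j =>
    if j = i then LinearIsometryEquiv.neg ℝ else LinearIsometryEquiv.refl ℝ ℝ with he
  have hei : ∀ z : Euc N, e z i = -z i := fun z => by
    simp [he, LinearIsometryEquiv.piLpCongrRight_apply]
  have hej : ∀ z : Euc N, ∀ j, j ≠ i → e z j = z j := fun z j hj => by
    simp [he, LinearIsometryEquiv.piLpCongrRight_apply, hj]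
  have h := (hsymm e fun j z hz k hk => by
    by_cases hki : k = i
    · rw [hki, hei, ← hki, hz k hk, neg_zero]
    · rw [hej z k hki, hz k hk]).1
  rw [← h]
  refine ⟨x, hx, ?_⟩
  ext j
  by_cases hji : j = i
  · rw [hji, hei, hi]
  · rw [hej x j hji, hj j hji]

lemma zero_mem : (0 : Euc N) ∈ Ω := by
  obtain ⟨x, hx⟩ := H.conn.nonempty
  have key : ∀ s : Finset (Fin N), ∃ y ∈ Ω, ∀ i ∈ s, y i = 0 := by
    intro s
    induction s using Finset.induction_on with
    | empty => exact ⟨x, hx, by simp⟩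
    | insert i s _ ih =>
      obtain ⟨y, hy, hys⟩ := ih
      set z : Euc N := WithLp.toLp 2 (Function.update y i (-y i)) with hz
      have hzi : z i = -y i := by simp [hz]
      have hzj : ∀ j, j ≠ i → z j = y j := fun j hj => by simp [hz, hj]
      have hzΩ : z ∈ Ω := H.reflect_mem i hy hzi hzj
      refine ⟨(1 / 2 : ℝ) • y + (1 / 2 : ℝ) • z,
        H.conv i y hy z hzΩ (fun j hj => (hzj j hj).symm)
          ⟨1 / 2, 1 / 2, by norm_num, by norm_num, by norm_num, rfl⟩, fun j hj => ?_⟩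
      by_cases hji : j = i
      · simp [hji, hzi]
      · have := hys j ((Finset.mem_insert.mp hj).resolve_left hji)
        simp [hzj j hji, this]
  obtain ⟨y, hy, h0⟩ := key Finset.univ
  rwa [show y = 0 from by ext i; simpa using h0 i (Finset.mem_univ i)] at hy

/-- Near the origin the nonlinearity grows at least like `t ^ (p - 1)`. -/
lemma exists_lower_bound : ∃ ρ T : ℝ, 0 < ρ ∧ 0 < T ∧
    ∀ x : Euc N, ‖x‖ < ρ → x ∈ Ω ∧ ∀ t, T ≤ t → t ^ (p - 1) / 4 ≤ f x t := by
  obtain ⟨r, hr, hball⟩ := Metric.isOpen_iff.mp H.isOpen 0 H.zero_mem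
  have hdc : ContinuousAt d 0 := H.d_c1.continuousOn.continuousAt
    (mem_of_superset (H.isOpen.mem_nhds H.zero_mem) subset_closure)
  obtain ⟨r', hr', hd⟩ := Metric.eventually_nhds_iff_ball.mp
    (hdc.eventually (lt_mem_nhds (show 1 / 2 < d 0 by rw [H.d_zero]; norm_num)))
  have hN0 : 0 < √(N : ℝ) := Real.sqrt_pos.2 (by exact_mod_cast (by linarith [H.dim] : 0 < N))
  set ρ := min r r' / (2 * √N) with hρ
  have hρ0 : 0 < ρ := by positivity
  have hnorm : ∀ z : Euc N, (∀ i, |z i| ≤ ρ) → ‖z‖ < min r r' := by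
    intro z hz
    have h1 : ‖z‖ ^ 2 ≤ (√N * ρ) ^ 2 := by
      rw [EuclideanSpace.norm_sq_eq, mul_pow, Real.sq_sqrt (Nat.cast_nonneg N)]
      calc ∑ i, ‖z i‖ ^ 2 ≤ ∑ _i : Fin N, ρ ^ 2 := Finset.sum_le_sum fun i _ =>
            pow_le_pow_left₀ (norm_nonneg _) (hz i) 2
        _ = N * ρ ^ 2 := by simp
    have h2 := le_of_sq_le_sq h1 (by positivity)
    have h3 : √N * ρ = min r r' / 2 := by rw [hρ]; field_simp
    have : 0 < min r r' := lt_min hr hr'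
    linarith
  have hmem : ∀ z : Euc N, (∀ i, |z i| ≤ ρ) → z ∈ Ω := fun z hz =>
    hball (by simpa using (hnorm z hz).trans_le (min_le_left _ _))
  set y : Euc N := WithLp.toLp 2 fun _ => ρ with hy
  have hyi : ∀ i, |y i| ≤ ρ := fun i => by simp [hy, abs_of_pos hρ0]
  have hdy : 1 / 2 < d y := hd y (by simpa using (hnorm y hyi).trans_le (min_le_right _ _))
  obtain ⟨T, hT⟩ := (((H.g_top y (hmem y hyi)).eventually
    (lt_mem_nhds (show (-(1 / 4) : ℝ) < 0 by norm_num))).and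
      (eventually_gt_atTop 0)).exists_forall_of_atTop
  refine ⟨ρ, T, hρ0, (hT T le_rfl).2, fun x hx => ?_⟩
  have hxi : ∀ i, |x i| ≤ ρ := fun i => (PiLp.norm_apply_le x i).trans hx.le
  refine ⟨hmem x hxi, fun t ht => ?_⟩
  obtain ⟨h1, h0⟩ := hT t ht
  have hfy : t ^ (p - 1) / 4 ≤ f y t := by
    have hpos : 0 < t ^ (p - 1) := Real.rpow_pos_of_pos h0 _
    rw [lt_div_iff₀ hpos] at h1
    have e : |t| ^ (p - 2) * t = t ^ (p - 1) := by
      rw [abs_of_pos h0, show p - 2 = p - 1 - 1 by ring, Real.rpow_sub_one h0.ne']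
      field_simp
    rw [H.f_split, mul_assoc, e]
    nlinarith
  refine hfy.trans ?_
  have key : ∀ s : Finset (Fin N), f (WithLp.toLp 2 fun i => if i ∈ s then y i else x i) t ≤
      f x t := by
    intro s
    induction s using Finset.induction_on with
    | empty => simp
    | insert i s hi ih =>
      have hin : ∀ s : Finset (Fin N),
          (WithLp.toLp 2 fun i => if i ∈ s then y i else x i : Euc N) ∈ Ω := fun s =>
        hmem _ fun j => by
          by_cases hj : j ∈ s
          · simpa [hj] using hyi j
          · simpa [hj] using hxi j
      refine (H.mono i _ (hin s) _ (hin _) (fun j hj => by simp [hj]) ?_).1 t |>.trans ih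
      simpa [hi, hy, abs_of_pos hρ0] using hxi i
  have := key Finset.univ
  simpa using this

end Standing
end Growth

section Concentration
variable {N : ℕ}

lemma Tst.comp_smul {ψ : Euc N → ℝ} (hψ : Tst ψ) {r : ℝ} (hr : r ≠ 0) :
    Tst fun x => ψ (r • x) :=
  ⟨hψ.1.comp (contDiff_const_smul r), hψ.2.comp_homeomorph (Homeomorph.smulOfNeZero r hr)⟩

lemma pd_comp_smul (i : Fin N) {ψ : Euc N → ℝ} (hψ : Tst ψ) (r : ℝ) (x : Euc N) :
    pd i (fun x => ψ (r • x)) x = r * pd i ψ (r • x) := by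
  unfold pd
  have h1 : HasFDerivAt (fun x : Euc N => r • x) (r • ContinuousLinearMap.id ℝ (Euc N)) x :=
    (hasFDerivAt_id x).const_smul r
  have h2 := (hψ.differentiable (r • x)).hasFDerivAt.comp x h1
  rw [show (fun x => ψ (r • x)) = ψ ∘ fun x : Euc N => r • x from rfl, h2.fderiv]
  simp

lemma integral_comp_smul_pos (F : Euc N → ℝ) {r : ℝ} (hr : 0 < r) :
    ∫ x, F (r • x) = (r ^ N)⁻¹ * ∫ x, F x := by
  rw [Measure.integral_comp_smul, finrank_euclideanSpace_fin, smul_eq_mul,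
    abs_of_pos (by positivity)]

lemma Dir_comp_smul {ψ : Euc N → ℝ} (hψ : Tst ψ) {r : ℝ} (hr : 0 < r) :
    Dir (fun x => ψ (r • x)) = (r ^ N)⁻¹ * (r ^ 2 * Dir ψ) := by
  unfold Dir
  rw [Finset.mul_sum, Finset.mul_sum]
  refine Finset.sum_congr rfl fun i _ => ?_
  simp only [pd_comp_smul i hψ, mul_pow]
  rw [integral_const_mul, integral_comp_smul_pos (fun x => pd i ψ x ^ 2) hr]
  ring

/-- The maximum of a quadratic minus a superquadratic power. -/
lemma mul_sq_sub_rpow_le {p A c t : ℝ} (hp : 2 < p) (hA : 0 ≤ A) (hc : 0 < c) (ht : 0 ≤ t) :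
    A * t ^ 2 - c * t ^ p ≤ A * (A / c) ^ (2 / (p - 2)) := by
  have hA' : 0 ≤ A * (A / c) ^ (2 / (p - 2)) := by positivity
  rcases ht.eq_or_lt with rfl | ht
  · rw [Real.zero_rpow (by linarith)]
    simpa using hA'
  rcases le_or_gt (A / c) (t ^ (p - 2)) with h | h
  · have e : t ^ p = t ^ 2 * t ^ (p - 2) := by
      rw [← Real.rpow_natCast, ← Real.rpow_add ht]
      norm_num
    rw [div_le_iff₀ hc] at h
    have := mul_le_mul_of_nonneg_right h (sq_nonneg t)
    rw [e]
    linarith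
  · have h1 : t ^ 2 ≤ (A / c) ^ (2 / (p - 2)) := by
      have h2 := Real.rpow_le_rpow (by positivity) h.le
        (show 0 ≤ 2 / (p - 2) from div_nonneg zero_le_two (by linarith))
      rwa [← Real.rpow_mul ht.le, mul_div_cancel₀ _ (by linarith), Real.rpow_two] at h2
    have h3 := mul_le_mul_of_nonneg_left h1 hA
    have : 0 ≤ c * t ^ p := by positivity
    linarith

namespace Nonlin
variable {Ω : Set (Euc N)} {k : Euc N → ℝ → ℝ} {a b M : ℝ} (H : Nonlin N Ω k a b M)
include H

lemma prim_ge {T p : ℝ} {x : Euc N} (hp : 2 < p) (hT : 0 < T)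
    (hx : ∀ t, T ≤ t → t ^ (p - 1) / 4 ≤ k x t) {t : ℝ} (ht : 0 ≤ t) :
    t ^ p / (4 * p) - T ^ (p - 1) / 4 * t ≤ prim k x t := by
  have hi : IntervalIntegrable (fun s : ℝ => s ^ (p - 1)) volume 0 t :=
    intervalIntegral.intervalIntegrable_rpow' (by linarith)
  have h1 : ∫ s in (0 : ℝ)..t, (s ^ (p - 1) / 4 - T ^ (p - 1) / 4) ≤ prim k x t := by
    refine intervalIntegral.integral_mono_on ht
      ((hi.div_const 4).sub intervalIntegrable_const)
      ((H.cont x).intervalIntegrable _ _) fun s hs => ?_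
    rcases le_total T s with h | h
    · have := hx s h
      have : 0 ≤ T ^ (p - 1) := by positivity
      linarith
    · have := Real.rpow_le_rpow hs.1 h (show 0 ≤ p - 1 by linarith)
      have := H.nonneg x s
      linarith
  rw [intervalIntegral.integral_sub (hi.div_const 4) intervalIntegrable_const,
    intervalIntegral.integral_div, integral_rpow (Or.inl (by linarith)),
    intervalIntegral.integral_const, sub_add_cancel, Real.zero_rpow (by linarith)] at h1
  refine le_trans (le_of_eq ?_) h1
  simp only [sub_zero, smul_eq_mul]
  field_simp

/-- Concentrated bumps are admissible with an explicit energy bound. -/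
lemma exists_adm {p ρ T R : ℝ} (hp : 2 < p) (hρ : 0 < ρ) (hT : 0 < T) (hρR : ρ ≤ R)
    (hlow : ∀ x : Euc N, ‖x‖ < ρ → x ∈ Ω ∧ ∀ t, T ≤ t → t ^ (p - 1) / 4 ≤ k x t) :
    ∃ C : ℝ, 0 ≤ C ∧ ∀ r : ℝ, 1 ≤ r → ∃ w K, Adm Ω k R (r ^ 2) w K
      (C * ((r ^ N)⁻¹ * (1 + r ^ 2 * (r ^ 2) ^ (2 / (p - 2))))) := by
  have hb := H.two_lt_b
  set ψ : Euc N → ℝ := rh ρ with hψ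
  have hψT : Tst ψ := Tst_rh hρ
  have hψ0 : ∀ x, 0 ≤ ψ x := rh_nonneg hρ
  have hψc : Continuous fun x => ψ x ^ p := hψT.continuous.rpow_const fun _ => Or.inr (by linarith)
  have hψs : HasCompactSupport fun x => ψ x ^ p :=
    hψT.2.comp_left (g := fun s : ℝ => s ^ p) (Real.zero_rpow (by linarith))
  set B := ∫ x, ψ x ^ p with hB
  have hB0 : 0 < B := hψc.integral_pos_of_hasCompactSupport_nonneg_nonzero hψs
    (fun x => Real.rpow_nonneg (hψ0 x) _) (x := 0)
    (Real.rpow_pos_of_pos (rh_pos hρ (by simpa using hρ)) _).ne'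
  set Q := ∫ x, ψ x ^ 2 with hQ
  have hQ0 : 0 ≤ Q := integral_nonneg fun x => sq_nonneg _
  set D := T ^ (p - 1) / 4 with hD
  have hD0 : 0 ≤ D := by positivity
  set A := (Dir ψ + Q) / 2 + D with hA
  have hA0 : 0 ≤ A := by have := Dir_nonneg ψ; positivity
  set c := B / (4 * p) with hc
  have hc0 : 0 < c := div_pos hB0 (by linarith)
  set C := A * (A / c) ^ (2 / (p - 2)) with hC
  have hC0 : 0 ≤ C := by positivity
  refine ⟨D + C, by positivity, fun r hr => ?_⟩
  have hr0 : 0 < r := one_pos.trans_le hr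
  have hwT := hψT.comp_smul hr0.ne'
  have hzero : ∀ x : Euc N, ρ ≤ ‖x‖ → ψ (r • x) = 0 := fun x hx => by
    refine rh_zero hρ (hx.trans ?_)
    rw [norm_smul, Real.norm_eq_abs, abs_of_pos hr0]
    exact le_mul_of_one_le_left (norm_nonneg x) hr
  refine ⟨fun x => ψ (r • x), _, fun x => hψ0 _, fun x hx => hzero x ?_, fun h => ?_,
    En.of_Tst hwT fun x hx => hzero x (hρR.trans hx.le), fun t ht => ?_⟩
  · by_contra! hlt
    exact hx (hlow x hlt).1
  · have h1 : ∫ x, ψ (r • x) = 0 := (integral_congr_ae h).trans (by simp)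
    rw [integral_comp_smul_pos ψ hr0, hψ, integral_rh hρ, mul_one] at h1
    exact (inv_pos.2 (pow_pos hr0 N)).ne' h1
  · have i1 : Integrable fun x => ψ (r • x) ^ p :=
      (hψc.comp (continuous_const_smul r)).integrable_of_hasCompactSupport
        (hψs.comp_homeomorph (Homeomorph.smulOfNeZero r hr0.ne'))
    have h1 : (r ^ N)⁻¹ * (c * t ^ p - D * t) ≤ ∫ x, prim k x (t * ψ (r • x)) := by
      have e : (r ^ N)⁻¹ * (c * t ^ p - D * t) =
          ∫ x, (t ^ p / (4 * p) * ψ (r • x) ^ p - D * t * ψ (r • x)) := by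
        rw [integral_sub (i1.const_mul _) (hwT.integrable.const_mul _), integral_const_mul,
          integral_const_mul, integral_comp_smul_pos (fun x => ψ x ^ p) hr0,
          integral_comp_smul_pos ψ hr0, hψ, integral_rh hρ, ← hψ, ← hB, hc]
        ring
      rw [e]
      refine integral_mono ((i1.const_mul _).sub (hwT.integrable.const_mul _))
        (H.integrable_prim ((hwT.const_mul t).fp hb)) fun x => ?_
      rcases lt_or_ge ‖x‖ ρ with hx | hx
      · have h2 := H.prim_ge hp hT (hlow x hx).2 (mul_nonneg ht (hψ0 (r • x)))
        rw [Real.mul_rpow ht (hψ0 _)] at h2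
        refine le_trans (le_of_eq ?_) h2
        ring
      · simp only [hzero x hx, mul_zero, prim_zero, sub_zero]
        rw [Real.zero_rpow (by linarith), mul_zero]
    have hr2 : 1 ≤ r ^ 2 := one_le_pow₀ hr
    have h2 := mul_sq_sub_rpow_le hp (mul_nonneg (sq_nonneg r) hA0) hc0 ht
    have e2 : r ^ 2 * A * (r ^ 2 * A / c) ^ (2 / (p - 2)) =
        C * (r ^ 2 * (r ^ 2) ^ (2 / (p - 2))) := by
      rw [mul_div_assoc, Real.mul_rpow (by positivity) (by positivity), hC]
      ring
    rw [e2] at h2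
    have h3 : D * t ≤ D + r ^ 2 * D * t ^ 2 := by
      have h4 : t ≤ 1 + r ^ 2 * t ^ 2 := by nlinarith [sq_nonneg (t - 1), sq_nonneg t]
      nlinarith
    rw [Dir_comp_smul hψT hr0, integral_comp_smul_pos (fun x => ψ x ^ 2) hr0, ← hQ]
    have hS : 0 ≤ r ^ 2 * (r ^ 2) ^ (2 / (p - 2)) := by positivity
    have h5 : t ^ 2 / 2 * (r ^ 2 * Dir ψ + r ^ 2 * Q) - (c * t ^ p - D * t) ≤
        (D + C) * (1 + r ^ 2 * (r ^ 2) ^ (2 / (p - 2))) := by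
      have : t ^ 2 / 2 * (r ^ 2 * Dir ψ + r ^ 2 * Q) = r ^ 2 * A * t ^ 2 - r ^ 2 * D * t ^ 2 := by
        rw [hA]; ring
      nlinarith [mul_nonneg hD0 hS]
    have h6 := mul_le_mul_of_nonneg_left h5 (inv_pos.2 (pow_pos hr0 N)).le
    linarith

end Nonlin
end Concentration

lemma firstEig_nonneg {N : ℕ} (Ω : Set (Euc N)) : 0 ≤ firstEig Ω := by
  refine Real.sInf_nonneg ?_
  rintro r ⟨φ, -, -, -, -, rfl⟩
  exact div_nonneg (integral_nonneg fun _ => by positivity) (integral_nonneg fun _ => sq_nonneg _)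

/-- in the mass-supercritical case `2 + 4/N < p < 2*`,
`∫_Ω u_λ² → 0` as `λ → +∞`. -/
theorem statement3 {N : ℕ} {Ω : Set (Euc N)} {f : Euc N → ℝ → ℝ} {d : Euc N → ℝ}
    {g : Euc N → ℝ → ℝ} {p : ℝ} {u : ℝ → Euc N → ℝ}
    (H : Standing N Ω f d g p u) (hp : 2 + 4 / (N : ℝ) < p) :
    Tendsto (fun lam : ℝ => ∫ x in Ω, (u lam x) ^ 2) atTop (𝓝 0) := by
  obtain ⟨a, b, M, hk⟩ := H.exists_nonlin
  obtain ⟨R₀, hR₀⟩ := H.bdd.exists_norm_le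
  obtain ⟨ρ, T, hρ, hT, hlow⟩ := H.exists_lower_bound
  have hkf : ∀ x ∈ Ω, ∀ t, 0 ≤ t → truncation Ω f x t = f x t := fun x hx t ht => by
    rw [truncation, indicator_of_mem hx, max_eq_left ht]
  set R := max R₀ ρ with hR
  have hΩR : ∀ x ∈ Ω, ‖x‖ ≤ R := fun x hx => (hR₀ x hx).trans (le_max_left _ _)
  have hp2 := H.hp.1
  obtain ⟨C, hC0, hadm⟩ := hk.exists_adm (R := R + 1) hp2 hρ hT
    ((le_max_right R₀ ρ).trans (by linarith)) fun x hx => ⟨(hlow x hx).1, fun t ht =>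
      (hkf x (hlow x hx).1 t (hT.le.trans ht)).symm ▸ (hlow x hx).2 t ht⟩
  have ha := hk.two_lt
  set θ := 1 / 2 - 1 / a with hθ
  have hθ0 : 0 < θ := by
    rw [hθ, sub_pos]
    exact one_div_lt_one_div_of_lt two_pos ha
  have hN : (0 : ℝ) < N := by exact_mod_cast (by linarith [H.dim] : 0 < N)
  set q := 2 / (p - 2) with hq
  have hqN : q < N / 2 := by
    have h1 : 4 < (p - 2) * N := (div_lt_iff₀ hN).mp (by linarith)
    rw [hq, div_lt_iff₀ (by linarith)]
    linarith
  have hbound : ∀ lam : ℝ, 1 ≤ lam → ∫ x in Ω, u lam x ^ 2 ≤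
      C / θ * (lam ^ (-(1 + N / 2 : ℝ)) + lam ^ (-(N / 2 - q))) := by
    intro lam hlam
    have hl0 : 0 < lam := one_pos.trans_le hlam
    obtain ⟨w, K, hw⟩ := hadm (√lam) (Real.one_le_sqrt.2 hlam)
    rw [Real.sq_sqrt hl0.le] at hw
    obtain ⟨U, hU, hU2⟩ := hk.exists_isPosSolution H.isOpen H.conn.isPreconnected hΩR H.c1bdry
      H.f_c1 hkf hl0 hw
    have hEq := (H.sol lam (by linarith [firstEig_nonneg Ω])).2 U hU
    rw [setIntegral_congr_fun H.isOpen.measurableSet fun x hx => by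
      rw [← hEq (subset_closure hx)]]
    have e : (√lam ^ N)⁻¹ = lam ^ (-(N / 2 : ℝ)) := by
      rw [Real.sqrt_eq_rpow, ← Real.rpow_mul_natCast hl0.le, ← Real.rpow_neg hl0.le]
      ring_nf
    have e1 : lam ^ (-(1 + N / 2 : ℝ)) = lam⁻¹ * lam ^ (-(N / 2 : ℝ)) := by
      rw [← Real.rpow_neg_one, ← Real.rpow_add hl0]
      ring_nf
    have e2 : lam ^ (-(N / 2 - q)) = lam ^ (-(N / 2 : ℝ)) * lam ^ q := by
      rw [← Real.rpow_add hl0]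
      ring_nf
    rw [e] at hU2
    rw [e1, e2]
    have h1 := mul_le_mul_of_nonneg_left hU2 (by positivity : 0 ≤ (lam * θ)⁻¹)
    rw [inv_mul_cancel_left₀ (by positivity)] at h1
    refine h1.trans (le_of_eq ?_)
    field_simp
  have hlim : Tendsto (fun lam : ℝ => C / θ * (lam ^ (-(1 + N / 2 : ℝ)) + lam ^ (-(N / 2 - q))))
      atTop (𝓝 0) := by
    have := ((tendsto_rpow_neg_atTop (show (0 : ℝ) < 1 + N / 2 by positivity)).add
      (tendsto_rpow_neg_atTop (sub_pos.2 hqN))).const_mul (C / θ)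
    simpa using this
  exact tendsto_of_tendsto_of_tendsto_of_le_of_le' tendsto_const_nhds hlim
    (Eventually.of_forall fun lam => integral_nonneg fun x => sq_nonneg _)
    ((eventually_ge_atTop 1).mono hbound)
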